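/- (Second maximal inequality, approximate independence at different scales.) Let γ ∈ [0,1), α ∈ (−1/2 + γ/2, 1/2 + γ/2), θ > 0, and let τ be any number with 0 < τ ≤ min{(1−H)/3, (1−γ)/12, H/6}. Then there exist constants ε₀ > 0 and c₂, c₃, c₄ > 0 (independent of u, t, ν, η) such that for all u > t > 0 and all ν, η ∈ (0, ε₀): P( M(t) ≤ ν t^{H+θ}, M(u) ≤ η u^{H+θ} ) ≤ φ(ν) φ(η) exp( c₂ (t/u)^{τ} ( ν^{−(1+1/β)} + η^{−(1+1/β)} ) ) + c₃ exp( −c₄ (u/t)^{τ} ). -/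

import Mathlib

open MeasureTheory ProbabilityTheory Real Set Filter

/-- A process is a centered Gaussian process if every finite linear combination of its
values has a centered Gaussian distribution. -/
def IsCenteredGaussianProcess {Ω : Type*} [MeasurableSpace Ω] (P : Measure Ω)
    (X : ℝ → Ω → ℝ) : Prop :=
  ∀ (n : ℕ) (t : Fin n → ℝ) (c : Fin n → ℝ), ∃ v : NNReal,
    P.map (fun ω => ∑ i, c i * X (t i) ω) = ProbabilityTheory.gaussianReal 0 v

/-- The covariance function of the generalized fractional Brownian motion:
`E[X s X t] = ∫_ℝ ((s−u)₊^α − (−u)₊^α)((t−u)₊^α − (−u)₊^α)|u|^{−γ} du`. -/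
noncomputable def gfbmCov (α γ s t : ℝ) : ℝ :=
  ∫ u : ℝ, ((max (s - u) 0) ^ α - (max (-u) 0) ^ α) *
    ((max (t - u) 0) ^ α - (max (-u) 0) ^ α) * |u| ^ (-γ)

/-- `X` is a generalized fractional Brownian motion with parameters `(α, γ)` under `P`. -/
def IsGFBM {Ω : Type*} [MeasurableSpace Ω] (P : Measure Ω) (α γ : ℝ)
    (X : ℝ → Ω → ℝ) : Prop :=
  IsCenteredGaussianProcess P X ∧
  (∀ ω, ContinuousOn (fun t => X t ω) (Set.Ici 0)) ∧
  (∀ ω, X 0 ω = 0) ∧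
  (∀ s t : ℝ, 0 ≤ s → 0 ≤ t → ∫ ω, X s ω * X t ω ∂P = gfbmCov α γ s t)

/-- The fractional integral `Y(t) = (1/Γ(θ)) ∫₀^t (t−u)^{θ−1} X(u) du` of a process `X`. -/
noncomputable def fracInt {Ω : Type*} (θ : ℝ) (X : ℝ → Ω → ℝ) (t : ℝ) (ω : Ω) : ℝ :=
  (Real.Gamma θ)⁻¹ * ∫ u in (0:ℝ)..t, (t - u) ^ (θ - 1) * X u ω

/-- The running maximum `M(t) = sup_{0 ≤ s ≤ t} |Y(s)|`. -/
noncomputable def runSup {Ω : Type*} (Y : ℝ → Ω → ℝ) (t : ℝ) (ω : Ω) : ℝ :=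
  ⨆ s : Set.Icc (0:ℝ) t, |Y s.1 ω|

/-- The small ball function `φ(ε) = P(M(1) ≤ ε)`. -/
noncomputable def smallBall {Ω : Type*} [MeasurableSpace Ω] (P : Measure Ω)
    (Y : ℝ → Ω → ℝ) (ε : ℝ) : ℝ :=
  (P {ω | runSup Y 1 ω ≤ ε}).toReal

section

open scoped ENNReal Topology

/-- One-dimensional Brunn–Minkowski for compact sets. -/
theorem volume_add_le_of_compact {A B C : Set ℝ} (hA : IsCompact A) (hB : IsCompact B)
    (hA0 : A.Nonempty) (hB0 : B.Nonempty) (hC : ∀ x ∈ A, ∀ y ∈ B, x + y ∈ C) :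
    volume A + volume B ≤ volume C := by
  obtain ⟨a, ha, hamax⟩ := hA.exists_isGreatest hA0
  obtain ⟨b, hb, hbmin⟩ := hB.exists_isLeast hB0
  have h1 : (fun x => x + b) '' A ⊆ C := by
    rintro _ ⟨x, hx, rfl⟩; exact hC x hx b hb
  have h2 : (fun y => a + y) '' B ⊆ C := by
    rintro _ ⟨x, hx, rfl⟩; exact hC a ha x hx
  have e1 : volume ((fun x => x + b) '' A) = volume A := by
    simp [Set.image_add_right]
  have e2 : volume ((fun y => a + y) '' B) = volume B := by
    simp [Set.image_add_left]
  have hd : (fun x => x + b) '' A ∩ (fun y => a + y) '' B ⊆ {a + b} := by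
    rintro _ ⟨⟨x, hx, rfl⟩, ⟨y, hy, hxy⟩⟩
    have := hamax hx
    have := hbmin hy
    simp only [] at hxy
    simp; linarith
  have hd' : volume ((fun x => x + b) '' A ∩ (fun y => a + y) '' B) = 0 :=
    measure_mono_null hd (by simp)
  have hm : NullMeasurableSet ((fun y => a + y) '' B) :=
    ((hB.image (by fun_prop)).measurableSet).nullMeasurableSet
  rw [← e1, ← e2, ← measure_union₀ hm hd']
  exact measure_mono (Set.union_subset h1 h2)

open Pointwise in
theorem volume_brunnMinkowski {A B C : Set ℝ} {a b : ℝ} (ha : 0 < a) (hb : 0 < b)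
    (hA : MeasurableSet A) (hB : MeasurableSet B)
    (hA0 : A.Nonempty) (hB0 : B.Nonempty) (hC : ∀ x ∈ A, ∀ y ∈ B, a * x + b * y ∈ C) :
    ENNReal.ofReal a * volume A + ENNReal.ofReal b * volume B ≤ volume C := by
  have sc : ∀ (c : ℝ), 0 < c → ∀ K : Set ℝ, volume ((fun x => c * x) '' K) =
      ENNReal.ofReal c * volume K := by
    intro c hc K
    calc volume ((fun x => c * x) '' K) = volume (c • K) := rfl
      _ = _ := by rw [Measure.addHaar_smul]; simp [abs_of_pos hc]
  have key : ∀ K1 ⊆ A, IsCompact K1 → ∀ K2 ⊆ B, IsCompact K2 →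
      ENNReal.ofReal a * volume K1 + ENNReal.ofReal b * volume K2 ≤ volume C := by
    intro K1 h1 c1 K2 h2 c2
    obtain ⟨p, hp⟩ := hA0
    obtain ⟨q, hq⟩ := hB0
    have := volume_add_le_of_compact (A := (fun x => a * x) '' (insert p K1))
      (B := (fun x => b * x) '' (insert q K2)) (C := C)
      ((c1.insert p).image (by fun_prop)) ((c2.insert q).image (by fun_prop))
      ⟨_, ⟨p, by simp, rfl⟩⟩ ⟨_, ⟨q, by simp, rfl⟩⟩ (by
        rintro _ ⟨x, hx, rfl⟩ _ ⟨y, hy, rfl⟩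
        apply hC
        · rcases hx with rfl | hx
          · exact hp
          · exact h1 hx
        · rcases hy with rfl | hy
          · exact hq
          · exact h2 hy)
    rw [sc a ha, sc b hb] at this
    refine le_trans ?_ this
    gcongr <;> exact Set.subset_insert _ _
  rw [hA.measure_eq_iSup_isCompact, hB.measure_eq_iSup_isCompact]
  simp only [ENNReal.mul_iSup]
  refine ENNReal.iSup_add_iSup_le (fun K1 K2 => ?_)
  by_cases h1 : K1 ⊆ A <;> by_cases c1 : IsCompact K1 <;>  by_cases h2 : K2 ⊆ B <;>
    by_cases c2 : IsCompact K2 <;> simp [h1, h2, c1, c2]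
  · exact key K1 h1 c1 K2 h2 c2
  · simpa using key K1 h1 c1 ∅ (by simp) (by simp)
  · simpa using key K1 h1 c1 ∅ (by simp) (by simp)
  · simpa using key K1 h1 c1 ∅ (by simp) (by simp)
  all_goals simpa using key ∅ (by simp) (by simp) K2 h2 c2

/-- A measure satisfies the Prékopa–Leindler inequality with weights `a`, `b`. -/
def IsPL {E : Type*} [AddCommGroup E] [Module ℝ E] [MeasurableSpace E] (μ : Measure E)
    (a b : ℝ) : Prop :=
  ∀ f g h : E → ℝ≥0∞, Measurable f → Measurable g → Measurable h →
    (∀ x, f x ≤ 1) → (∀ x, g x ≤ 1) →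
    (∀ x y, f x ^ a * g y ^ b ≤ h (a • x + b • y)) →
    (∫⁻ x, f x ∂μ) ^ a * (∫⁻ x, g x ∂μ) ^ b ≤ ∫⁻ x, h x ∂μ

theorem lintegral_layercake_Ioo {f : ℝ → ℝ≥0∞} (hf : Measurable f) (h1 : ∀ x, f x ≤ 1) :
    ∫⁻ x, f x = ∫⁻ t in Ioo (0:ℝ) 1, volume {x | ENNReal.ofReal t < f x} := by
  have h2 : ∀ x, f x ≠ ∞ := fun x => ne_top_of_le_ne_top (by simp) (h1 x)
  have := lintegral_eq_lintegral_meas_lt (volume : Measure ℝ) (f := fun x => (f x).toReal)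
    (Filter.Eventually.of_forall fun x => ENNReal.toReal_nonneg) (by fun_prop)
  simp only [ENNReal.ofReal_toReal (h2 _)] at this
  rw [this]
  have e : ∀ t ∈ Ioi (0:ℝ), volume {x | t < (f x).toReal} =
      (Ioo (0:ℝ) 1).indicator (fun t => volume {x | ENNReal.ofReal t < f x}) t := by
    intro t ht
    by_cases h : t < 1
    · rw [Set.indicator_of_mem (by exact ⟨ht, h⟩)]
      congr 1; ext x
      simp only [mem_ofPred_eq]
      rw [ENNReal.ofReal_lt_iff_lt_toReal (le_of_lt ht) (h2 x)]
    · rw [Set.indicator_of_notMem (by simp; intro _; linarith)]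
      have : {x | t < (f x).toReal} = ∅ := by
        ext x
        simp only [mem_ofPred_eq, mem_empty_iff_false, iff_false, not_lt]
        have : (f x).toReal ≤ 1 := ENNReal.toReal_le_of_le_ofReal (by simp) (by simpa using h1 x)
        linarith
      simp [this]
  rw [setLIntegral_congr_fun measurableSet_Ioi e, setLIntegral_indicator measurableSet_Ioo]
  congr 2
  ext x; simp; tauto

theorem ENNReal.rpow_mul_rpow_le {a b : ℝ} (ha : 0 < a) (hb : 0 < b) (hab : a + b = 1)
    (x y : ℝ≥0∞) : x ^ a * y ^ b ≤ ENNReal.ofReal a * x + ENNReal.ofReal b * y := by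
  rcases eq_or_ne x ∞ with rfl | hx
  · simp [ha]
  rcases eq_or_ne y ∞ with rfl | hy
  · simp [hb]
  lift x to NNReal using hx
  lift y to NNReal using hy
  lift a to NNReal using ha.le
  lift b to NNReal using hb.le
  have := NNReal.geom_mean_le_arith_mean2_weighted a b x y (by exact_mod_cast hab)
  rw [← ENNReal.coe_rpow_of_nonneg _ ha.le, ← ENNReal.coe_rpow_of_nonneg _ hb.le,
    ENNReal.ofReal_coe_nnreal, ENNReal.ofReal_coe_nnreal]
  exact_mod_cast this

theorem lintegral_normalized_PL {a b : ℝ} (ha : 0 < a) (hb : 0 < b) (hab : a + b = 1)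
    (f g h : ℝ → ℝ≥0∞) (hf : Measurable f) (hg : Measurable g) (hh : Measurable h)
    (hf1 : ⨆ x, f x = 1) (hg1 : ⨆ x, g x = 1)
    (H : ∀ x y, f x ^ a * g y ^ b ≤ h (a • x + b • y)) :
    (∫⁻ x, f x) ^ a * (∫⁻ x, g x) ^ b ≤ ∫⁻ x, h x := by
  refine (ENNReal.rpow_mul_rpow_le ha hb hab _ _).trans ?_
  have hh' : ∫⁻ x, min (h x) 1 ≤ ∫⁻ x, h x := lintegral_mono fun x => min_le_left _ _
  refine le_trans ?_ hh'
  rw [lintegral_layercake_Ioo hf (fun x => hf1 ▸ le_iSup f x),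
    lintegral_layercake_Ioo hg (fun x => hg1 ▸ le_iSup g x),
    lintegral_layercake_Ioo (by fun_prop) (fun x => min_le_right _ _)]
  have mono : ∀ f : ℝ → ℝ≥0∞, Measurable (fun t : ℝ => volume {x | ENNReal.ofReal t < f x}) := by
    intro f
    apply Antitone.measurable
    intro s t hst
    apply measure_mono
    intro x hx
    exact lt_of_le_of_lt (ENNReal.ofReal_le_ofReal hst) hx
  rw [← lintegral_const_mul _ (mono f), ← lintegral_const_mul _ (mono g),
    ← lintegral_add_left ((mono f).const_mul _)]
  refine setLIntegral_mono (mono _) fun t ht => ?_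
  have ht1 : ENNReal.ofReal t < 1 := by simpa using ht.2
  apply volume_brunnMinkowski ha hb (measurableSet_lt measurable_const hf)
    (measurableSet_lt measurable_const hg)
  · rw [← hf1] at ht1; obtain ⟨x, hx⟩ := lt_iSup_iff.1 ht1; exact ⟨x, hx⟩
  · rw [← hg1] at ht1; obtain ⟨x, hx⟩ := lt_iSup_iff.1 ht1; exact ⟨x, hx⟩
  · intro x hx y hy
    simp only [mem_ofPred_eq, lt_min_iff] at hx hy ⊢
    refine ⟨lt_of_lt_of_le ?_ (H x y), ht1⟩
    have : ENNReal.ofReal t = ENNReal.ofReal t ^ a * ENNReal.ofReal t ^ b := by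
      rw [← ENNReal.rpow_add _ _ (by simpa using ht.1) (by simp), hab, ENNReal.rpow_one]
    rw [this]
    exact ENNReal.mul_lt_mul (ENNReal.rpow_lt_rpow hx ha) (ENNReal.rpow_lt_rpow hy hb)

theorem isPL_volume {a b : ℝ} (ha : 0 < a) (hb : 0 < b) (hab : a + b = 1) :
    IsPL (volume : Measure ℝ) a b := by
  intro f g h hf hg hh hf1 hg1 H
  set F := ⨆ x, f x with hF
  set G := ⨆ x, g x with hG
  have hFt : F ≠ ∞ := ne_top_of_le_ne_top (by simp) (iSup_le hf1)
  have hGt : G ≠ ∞ := ne_top_of_le_ne_top (by simp) (iSup_le hg1)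
  rcases eq_or_ne F 0 with h0 | hF0
  · have : ∀ x, f x = 0 := by rw [hF, ENNReal.iSup_eq_zero] at h0; exact h0
    simp [this, ha]
  rcases eq_or_ne G 0 with h0 | hG0
  · have : ∀ x, g x = 0 := by rw [hG, ENNReal.iSup_eq_zero] at h0; exact h0
    simp [this, hb]
  have key := lintegral_normalized_PL ha hb hab (fun x => F⁻¹ * f x) (fun x => G⁻¹ * g x)
    (fun x => F⁻¹ ^ a * G⁻¹ ^ b * h x) (hf.const_mul _) (hg.const_mul _) (hh.const_mul _)
    (by rw [← ENNReal.mul_iSup, ENNReal.inv_mul_cancel hF0 hFt])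
    (by rw [← ENNReal.mul_iSup, ENNReal.inv_mul_cancel hG0 hGt]) (by
      intro x y
      rw [ENNReal.mul_rpow_of_nonneg _ _ ha.le, ENNReal.mul_rpow_of_nonneg _ _ hb.le]
      calc _ = F⁻¹ ^ a * G⁻¹ ^ b * (f x ^ a * g y ^ b) := by ring
        _ ≤ _ := by gcongr; exact H x y)
  rw [lintegral_const_mul _ hf, lintegral_const_mul _ hg, lintegral_const_mul _ hh,
    ENNReal.mul_rpow_of_nonneg _ _ ha.le, ENNReal.mul_rpow_of_nonneg _ _ hb.le] at key
  have e : F⁻¹ ^ a * (∫⁻ x, f x) ^ a * (G⁻¹ ^ b * (∫⁻ x, g x) ^ b) =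
    (F⁻¹ ^ a * G⁻¹ ^ b) * ((∫⁻ x, f x) ^ a * (∫⁻ x, g x) ^ b) := by ring
  rw [e] at key
  have c0 : F⁻¹ ^ a * G⁻¹ ^ b ≠ 0 := by
    apply mul_ne_zero <;> simp [ENNReal.rpow_eq_zero_iff, hFt, hGt, hF0, hG0]
  have ct : F⁻¹ ^ a * G⁻¹ ^ b ≠ ∞ :=
    ENNReal.mul_ne_top (ENNReal.rpow_ne_top_of_nonneg ha.le (by simpa))
      (ENNReal.rpow_ne_top_of_nonneg hb.le (by simpa))
  exact (ENNReal.mul_le_mul_iff_right c0 ct).1 key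

section PL
variable {a b : ℝ}

theorem IsPL.withDensity (ha : 0 < a) (hb : 0 < b) {μ : Measure ℝ} (h : IsPL μ a b)
    {ρ : ℝ → ℝ≥0∞} (hρ : Measurable ρ) (h1 : ∀ x, ρ x ≤ 1)
    (hlc : ∀ x y, ρ x ^ a * ρ y ^ b ≤ ρ (a • x + b • y)) : IsPL (μ.withDensity ρ) a b := by
  intro f g k hf hg hk hf1 hg1 H
  rw [lintegral_withDensity_eq_lintegral_mul _ hρ hf,
      lintegral_withDensity_eq_lintegral_mul _ hρ hg,
    lintegral_withDensity_eq_lintegral_mul _ hρ hk]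
  refine h _ _ _ (hρ.mul hf) (hρ.mul hg) (hρ.mul hk) (fun x => mul_le_one' (h1 x) (hf1 x))
    (fun x => mul_le_one' (h1 x) (hg1 x)) fun x y => ?_
  simp only [Pi.mul_apply]
  rw [ENNReal.mul_rpow_of_nonneg _ _ ha.le, ENNReal.mul_rpow_of_nonneg _ _ hb.le]
  calc _ = ρ x ^ a * ρ y ^ b * (f x ^ a * g y ^ b) := by ring
    _ ≤ _ := mul_le_mul' (hlc x y) (H x y)

theorem isPL_gaussianReal (ha : 0 < a) (hb : 0 < b) (hab : a + b = 1) :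
    IsPL (gaussianReal 0 1) a b := by
  rw [gaussianReal_of_var_ne_zero _ one_ne_zero]
  refine (isPL_volume ha hb hab).withDensity ha hb (measurable_gaussianPDF 0 1) ?_ ?_
  · intro x
    rw [gaussianPDF, ENNReal.ofReal_le_one, gaussianPDFReal]
    have h2 : (1:ℝ) ≤ √(2 * π * (1:NNReal)) := by
      rw [Real.one_le_sqrt]; have := Real.pi_gt_three; simp; linarith
    calc _ ≤ (1:ℝ) * 1 := by
          gcongr
          · exact inv_le_one_of_one_le₀ h2
          · rw [Real.exp_le_one_iff]; simp; nlinarith [sq_nonneg x]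
      _ = 1 := by norm_num
  · intro x y
    simp only [gaussianPDF, gaussianPDFReal]
    set c := (√(2 * π * (1:NNReal)))⁻¹ with hc
    have hc0 : 0 < c := by rw [hc]; simp; positivity
    rw [ENNReal.ofReal_rpow_of_nonneg (by positivity) ha.le,
      ENNReal.ofReal_rpow_of_nonneg (by positivity) hb.le, ← ENNReal.ofReal_mul (by positivity)]
    apply ENNReal.ofReal_le_ofReal
    rw [Real.mul_rpow hc0.le (by positivity), Real.mul_rpow hc0.le (by positivity),
      ← Real.exp_mul, ← Real.exp_mul]
    have e : c ^ a * c ^ b = c := by rw [← Real.rpow_add hc0, hab, Real.rpow_one]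
    calc _ = (c ^ a * c ^ b) * (rexp (-(x - 0) ^ 2 / (2 * (1:NNReal)) * a) *
            rexp (-(y - 0) ^ 2 / (2 * (1:NNReal)) * b)) := by ring
      _ ≤ _ := by
        rw [e, ← Real.exp_add]
        gcongr
        simp
        obtain rfl : b = 1 - a := by linarith
        nlinarith [mul_nonneg (mul_nonneg ha.le hb.le) (sq_nonneg (x - y))]

theorem IsPL.prod {E F : Type*} [AddCommGroup E] [Module ℝ E] [MeasurableSpace E]
    [AddCommGroup F] [Module ℝ F] [MeasurableSpace F] {μ : Measure E} {ν : Measure F}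
    [IsProbabilityMeasure μ] [IsProbabilityMeasure ν] (hμ : IsPL μ a b) (hν : IsPL ν a b) :
    IsPL (μ.prod ν) a b := by
  intro f g k hf hg hk hf1 hg1 H
  rw [lintegral_prod _ hf.aemeasurable, lintegral_prod _ hg.aemeasurable,
    lintegral_prod _ hk.aemeasurable]
  have le1 : ∀ f : E × F → ℝ≥0∞, (∀ x, f x ≤ 1) → ∀ x, ∫⁻ y, f (x, y) ∂ν ≤ 1 := fun f h x =>
    (lintegral_mono fun y => h (x, y)).trans (by simp)
  refine hμ _ _ _ hf.lintegral_prod_right' hg.lintegral_prod_right' hk.lintegral_prod_right'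
    (le1 f hf1) (le1 g hg1) fun x x' => ?_
  exact hν _ _ _ (by fun_prop) (by fun_prop) (by fun_prop) (fun y => hf1 _) (fun y => hg1 _)
    fun y y' => H (x, y) (x', y')

theorem IsPL.map {E F : Type*} [AddCommGroup E] [Module ℝ E] [MeasurableSpace E]
    [AddCommGroup F] [Module ℝ F] [MeasurableSpace F] {μ : Measure E} (hμ : IsPL μ a b)
    {L : E → F} (hL : Measurable L) (hlin : ∀ x y, L (a • x + b • y) = a • L x + b • L y) :
    IsPL (μ.map L) a b := by
  intro f g k hf hg hk hf1 hg1 H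
  rw [lintegral_map hf hL, lintegral_map hg hL, lintegral_map hk hL]
  refine hμ _ _ _ (hf.comp hL) (hg.comp hL) (hk.comp hL) (fun _ => hf1 _) (fun _ => hg1 _)
    fun x y => ?_
  rw [hlin]; exact H _ _

theorem isPL_pi_gaussianReal (ha : 0 < a) (hb : 0 < b) (hab : a + b = 1) (n : ℕ) :
    IsPL (Measure.pi fun _ : Fin n => gaussianReal 0 1) a b := by
  induction n with
  | zero =>
    intro f g k hf hg hk hf1 hg1 H
    have : (Measure.pi fun _ : Fin 0 => gaussianReal 0 1) = Measure.dirac 0 :=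
      Measure.pi_of_empty _ _
    rw [this, lintegral_dirac' _ hf, lintegral_dirac' _ hg, lintegral_dirac' _ hk]
    simpa using H 0 0
  | succ n ih =>
    have h := (measurePreserving_piFinSuccAbove (fun _ : Fin (n+1) => gaussianReal 0 1)
        0).symm.map_eq
    rw [← h]
    refine ((isPL_gaussianReal ha hb hab).prod ih).map (MeasurableEquiv.measurable _) ?_
    rintro ⟨x, p⟩ ⟨y, q⟩
    ext i
    refine Fin.cases ?_ (fun j => ?_) i <;> simp [MeasurableEquiv.piFinSuccAbove]

theorem IsPL.measure_le {E : Type*} [AddCommGroup E] [Module ℝ E] [MeasurableSpace E]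
    {μ : Measure E} (hμ : IsPL μ a b) (ha : 0 < a) (hb : 0 < b) {A B C : Set E}
    (hA : MeasurableSet A)
    (hB : MeasurableSet B) (hC : MeasurableSet C) (h : ∀ x ∈ A, ∀ y ∈ B, a • x + b • y ∈ C) :
    μ A ^ a * μ B ^ b ≤ μ C := by
  have := hμ (A.indicator 1) (B.indicator 1) (C.indicator 1) (measurable_one.indicator hA)
    (measurable_one.indicator hB) (measurable_one.indicator hC)
    (fun x => Set.indicator_apply_le' (fun _ => le_rfl) (fun _ => zero_le))
    (fun x => Set.indicator_apply_le' (fun _ => le_rfl) (fun _ => zero_le)) (by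
      intro x y
      by_cases hx : x ∈ A
      · by_cases hy : y ∈ B
        · simp [hx, hy, h x hx y hy]
        · simp [hy, hb]
      · simp [hx, ha])
  simpa [hA, hB, hC] using this

end PL

/-- `μ` is the centered Gaussian law on `ℝⁿ` with covariance matrix `S`. -/
def IsGaussLaw {n : ℕ} (μ : Measure (Fin n → ℝ)) (S : Matrix (Fin n) (Fin n) ℝ) : Prop :=
  ∀ c : Fin n → ℝ, μ.map (fun x => c ⬝ᵥ x) = gaussianReal 0 (c ⬝ᵥ S.mulVec c).toNNReal

namespace IsGaussLaw
variable {n : ℕ} {μ ν : Measure (Fin n → ℝ)} {S S' : Matrix (Fin n) (Fin n) ℝ}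

theorem isProbabilityMeasure (h : IsGaussLaw μ S) : IsProbabilityMeasure μ := by
  have := h 0
  have h2 : IsProbabilityMeasure (μ.map (fun x => (0 : Fin n → ℝ) ⬝ᵥ x)) := by
    rw [this]; infer_instance
  exact (Measure.isProbabilityMeasure_map_iff
    (by fun_prop)).1 h2

theorem unique (h : IsGaussLaw μ S) (h' : IsGaussLaw ν S) : μ = ν := by
  have := h.isProbabilityMeasure
  have := h'.isProbabilityMeasure
  refine Measure.ext_of_charFunDual ?_
  ext L
  rw [charFunDual_eq_charFun_map_one, charFunDual_eq_charFun_map_one]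
  have : (L : (Fin n → ℝ) → ℝ) = fun x => (fun i => L (Pi.single i 1)) ⬝ᵥ x := by
    ext x
    conv_lhs => rw [← Finset.univ_sum_single x]
    simp only [map_sum, dotProduct]
    refine Finset.sum_congr rfl fun i _ => ?_
    have : Pi.single i (x i) = x i • (Pi.single i (1:ℝ) : Fin n → ℝ) := by
      rw [← Pi.single_smul]; simp
    simp [this, mul_comm]
  rw [this, h, h']

theorem pi_gaussianReal (n : ℕ) :
    IsGaussLaw (Measure.pi fun _ : Fin n => gaussianReal 0 1) 1 := by
  intro c
  apply Measure.ext_of_charFun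
  ext t
  rw [charFun_apply, integral_map (by fun_prop) (by fun_prop), charFun_gaussianReal]
  have : ∀ x : Fin n → ℝ, Complex.exp (((inner ℝ (c ⬝ᵥ x) t : ℝ) : ℂ) * Complex.I) =
      ∏ i, Complex.exp (((inner ℝ (x i) (t * c i) : ℝ) : ℂ) * Complex.I) := by
    intro x
    rw [← Complex.exp_sum]
    congr 1
    simp [dotProduct, Finset.sum_mul, Finset.mul_sum]
    refine Finset.sum_congr rfl fun i _ => by ring
  simp_rw [this]
  rw [integral_fintype_prod_eq_prod (μ := fun _ : Fin n => gaussianReal 0 1)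
    (f := fun i (x : ℝ) => Complex.exp (((inner ℝ x (t * c i) : ℝ) : ℂ) * Complex.I))]
  simp_rw [← charFun_apply, charFun_gaussianReal, ← Complex.exp_sum]
  congr 1
  have h0 : 0 ≤ c ⬝ᵥ c := by simp [dotProduct]; exact Finset.sum_nonneg fun i _ => mul_self_nonneg _
  rw [Matrix.one_mulVec, Real.coe_toNNReal _ h0]
  simp only [dotProduct]
  push_cast
  rw [Finset.sum_mul, Finset.sum_div]
  simp [Finset.sum_neg_distrib]
  refine Finset.sum_congr rfl fun i _ => by ring

theorem map_mulVec (h : IsGaussLaw μ S) (B : Matrix (Fin n) (Fin n) ℝ) :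
    IsGaussLaw (μ.map (fun x => B.mulVec x)) (B * S * B.transpose) := by
  intro c
  rw [Measure.map_map (by fun_prop) (by fun_prop)]
  have : (fun x => c ⬝ᵥ x) ∘ (fun x => B.mulVec x) = fun x => (B.transpose.mulVec c) ⬝ᵥ x := by
    ext x; simp [Matrix.dotProduct_mulVec, Matrix.mulVec_transpose]
  rw [this, h]
  congr 2
  rw [← Matrix.mulVec_mulVec, ← Matrix.mulVec_mulVec, Matrix.mulVec_transpose,
    ← Matrix.dotProduct_mulVec]

end IsGaussLaw

open scoped MatrixOrder Matrix.Norms.L2Operator in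
theorem exists_isGaussLaw {n : ℕ} {S : Matrix (Fin n) (Fin n) ℝ} (hS : S.PosSemidef) :
    ∃ μ, IsGaussLaw μ S ∧ ∀ a b : ℝ, 0 < a → 0 < b → a + b = 1 → IsPL μ a b := by
  obtain ⟨B, rfl⟩ : ∃ B : Matrix (Fin n) (Fin n) ℝ, S = B * B.transpose := by
    obtain ⟨y, rfl⟩ := CStarAlgebra.nonneg_iff_eq_star_mul_self.mp hS.nonneg
    refine ⟨y.transpose, ?_⟩
    rw [Matrix.star_eq_conjTranspose, Matrix.conjTranspose_eq_transpose_of_trivial,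
      Matrix.transpose_transpose]
  refine ⟨_, by simpa using (IsGaussLaw.pi_gaussianReal n).map_mulVec B, fun a b ha hb hab =>
    (isPL_pi_gaussianReal ha hb hab n).map (by fun_prop) ?_⟩
  intro x y; simp [Matrix.mulVec_add, Matrix.mulVec_smul]

theorem IsGaussLaw.isPL {n : ℕ} {μ : Measure (Fin n → ℝ)} {S : Matrix (Fin n) (Fin n) ℝ}
    (h : IsGaussLaw μ S) (hS : S.PosSemidef) {a b : ℝ} (ha : 0 < a) (hb : 0 < b)
    (hab : a + b = 1) : IsPL μ a b := by
  obtain ⟨ν, h1, h2⟩ := exists_isGaussLaw hS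
  rw [h.unique h1]; exact h2 a b ha hb hab

namespace IsGaussLaw
variable {n : ℕ} {μ ν : Measure (Fin n → ℝ)} {S S' : Matrix (Fin n) (Fin n) ℝ}

theorem add (h : IsGaussLaw μ S) (h' : IsGaussLaw ν S') (hS : S.PosSemidef) (hS' : S'.PosSemidef) :
    IsGaussLaw ((μ.prod ν).map (fun p => p.1 + p.2)) (S + S') := by
  have := h.isProbabilityMeasure
  have := h'.isProbabilityMeasure
  intro c
  rw [Measure.map_map (by fun_prop) (by fun_prop)]
  have e : (fun x => c ⬝ᵥ x) ∘ (fun p : (Fin n → ℝ) × (Fin n → ℝ) => p.1 + p.2) =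
      (fun q : ℝ × ℝ => q.1 + q.2) ∘ Prod.map (fun x => c ⬝ᵥ x) (fun x => c ⬝ᵥ x) := by
    ext p; simp [dotProduct_add]
  rw [e, ← Measure.map_map (by fun_prop) (by fun_prop), ← Measure.map_prod_map _ _ (by fun_prop)
    (by fun_prop), h, h']
  change Measure.conv (gaussianReal _ _) (gaussianReal _ _) = _
  rw [gaussianReal_conv_gaussianReal, Matrix.add_mulVec, dotProduct_add, Real.toNNReal_add]
  · simp
  · simpa using hS.dotProduct_mulVec_nonneg c
  · simpa using hS'.dotProduct_mulVec_nonneg c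

theorem smul_gaussianReal (c : Fin n → ℝ) :
    IsGaussLaw ((gaussianReal 0 1).map (fun z : ℝ => z • c)) (Matrix.vecMulVec c c) := by
  intro d
  rw [Measure.map_map (by fun_prop) (by fun_prop)]
  have e : (fun x => d ⬝ᵥ x) ∘ (fun z : ℝ => z • c) = fun z => z * (d ⬝ᵥ c) := by
    ext z; simp
  rw [e, gaussianReal_map_mul_const]
  congr 1
  · simp
  · ext
    have : 0 ≤ d ⬝ᵥ (Matrix.vecMulVec c c).mulVec d := by
      simp [Matrix.vecMulVec_mulVec]
      rw [dotProduct_comm c d]; exact mul_self_nonneg _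
    rw [Real.coe_toNNReal _ this]
    simp [Matrix.vecMulVec_mulVec, dotProduct_comm c d]; ring

theorem map_neg (h : IsGaussLaw μ S) : μ.map (fun x => -x) = μ := by
  refine IsGaussLaw.unique (S := S) ?_ h
  have := h.map_mulVec (-1)
  simpa [Matrix.neg_mulVec] using this

theorem measure_neg (h : IsGaussLaw μ S) {A : Set (Fin n → ℝ)} (hA : MeasurableSet A) :
    μ {x | -x ∈ A} = μ A := by
  conv_rhs => rw [← h.map_neg, Measure.map_apply (by fun_prop) hA]
  rfl

theorem shift_mono (h : IsGaussLaw μ S) (hS : S.PosSemidef) {K : Set (Fin n → ℝ)}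
    (hK : MeasurableSet K) (hc : Convex ℝ K) (hs : ∀ x ∈ K, -x ∈ K) (c : Fin n → ℝ) {z z' : ℝ}
    (hz : |z| ≤ |z'|) : μ {y | y + z' • c ∈ K} ≤ μ {y | y + z • c ∈ K} := by
  have hm : ∀ z : ℝ, MeasurableSet {y | y + z • c ∈ K} := fun z =>
    hK.preimage (f := fun y => y + z • c) (by fun_prop)
  have even : ∀ z : ℝ, μ {y | y + z • c ∈ K} = μ {y | y + (-z) • c ∈ K} := by
    intro z
    rw [← h.measure_neg (hm (-z))]
    congr 1
    ext y
    have e : -y + (-z) • c = -(y + z • c) := by simp; abel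
    simp only [mem_ofPred_eq, e]
    exact ⟨fun h => hs _ h, fun h => by simpa using hs _ h⟩
  rcases eq_or_lt_of_le hz with hz | hz
  · rcases abs_eq_abs.1 hz with rfl | rfl
    · exact le_rfl
    · rw [← even]
  have h0 : 0 < |z'| := lt_of_le_of_lt (abs_nonneg _) hz
  have hz0 : z' ≠ 0 := abs_pos.1 h0
  have hr : |z / z'| < 1 := by rw [abs_div, div_lt_one h0]; exact hz
  rw [abs_lt] at hr
  have := (h.isPL hS (a := (1 + z / z') / 2) (b := (1 - z / z') / 2) (by linarith)
    (by linarith) (by ring)).measure_le (by linarith) (by linarith) (hm z') (hm (-z')) (hm z) (by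
      intro x hx y hy
      have e : ((1 + z / z') / 2) • x + ((1 - z / z') / 2) • y + z • c =
        ((1 + z / z') / 2) • (x + z' • c) + ((1 - z / z') / 2) • (y + (-z') • c) := by
        ext i; simp; field_simp; ring
      simp only [mem_ofPred_eq, e]
      exact hc hx hy (by linarith) (by linarith) (by ring))
  rw [← even, ← ENNReal.rpow_add_of_nonneg _ _ (by linarith) (by linarith)] at this
  convert this using 1
  rw [show (1 + z / z') / 2 + (1 - z / z') / 2 = 1 by ring, ENNReal.rpow_one]

end IsGaussLaw

theorem mul_lintegral_le_of_unimodal {N : Measure ℝ} [IsProbabilityMeasure N] {f : ℝ → ℝ≥0∞}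
    (hf : ∀ z z', |z| ≤ |z'| → f z' ≤ f z) (r : ℝ) :
    (∫⁻ z, f z ∂N) * N {z | |z| ≤ r} ≤ ∫⁻ z in {z | |z| ≤ r}, f z ∂N := by
  set I := {z : ℝ | |z| ≤ r}
  have hI : MeasurableSet I := measurableSet_le (by fun_prop) (by fun_prop)
  rcases lt_or_ge r 0 with hr | hr
  · have : I = ∅ := by ext z; simp [I]; linarith [abs_nonneg z]
    simp [this]
  have h1 : f r * N I ≤ ∫⁻ z in I, f z ∂N := by
    rw [← setLIntegral_const]
    exact setLIntegral_mono' hI fun z hz => hf _ _ (by rw [abs_of_nonneg hr]; exact hz)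
  have h2 : ∫⁻ z in Iᶜ, f z ∂N ≤ f r * N Iᶜ := by
    rw [← setLIntegral_const]
    refine setLIntegral_mono' hI.compl fun z hz => hf _ _ ?_
    rw [abs_of_nonneg hr]
    simp [I] at hz; exact hz.le
  calc (∫⁻ z, f z ∂N) * N I = (∫⁻ z in I, f z ∂N) * N I + (∫⁻ z in Iᶜ, f z ∂N) * N I := by
        rw [← lintegral_add_compl f hI, add_mul]
    _ ≤ (∫⁻ z in I, f z ∂N) * N I + (f r * N Iᶜ) * N I := by gcongr
    _ = (∫⁻ z in I, f z ∂N) * N I + (f r * N I) * N Iᶜ := by ring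
    _ ≤ (∫⁻ z in I, f z ∂N) * N I + (∫⁻ z in I, f z ∂N) * N Iᶜ := by gcongr
    _ = ∫⁻ z in I, f z ∂N := by
        rw [← mul_add, measure_add_measure_compl hI, measure_univ, mul_one]

theorem Matrix.PosSemidef.sub_vecMulVec {n : ℕ} {S : Matrix (Fin n) (Fin n) ℝ} (hS : S.PosSemidef)
    (l : Fin n → ℝ) (hv : 0 < l ⬝ᵥ S.mulVec l) :
    (S - Matrix.vecMulVec ((√(l ⬝ᵥ S.mulVec l))⁻¹ • S.mulVec l)
      ((√(l ⬝ᵥ S.mulVec l))⁻¹ • S.mulVec l)).PosSemidef := by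
  set v := l ⬝ᵥ S.mulVec l
  have hsym : ∀ x y, x ⬝ᵥ S.mulVec y = y ⬝ᵥ S.mulVec x := by
    intro x y
    have : S.transpose = S := by simpa using hS.1.eq
    rw [Matrix.dotProduct_mulVec, ← Matrix.mulVec_transpose, this, dotProduct_comm]
  rw [Matrix.posSemidef_iff_dotProduct_mulVec]
  constructor
  · refine hS.1.sub ?_
    ext i j; simp [Matrix.vecMulVec]; ring
  · intro x
    have h := hS.dotProduct_mulVec_nonneg (x - ((x ⬝ᵥ S.mulVec l) / v) • l)
    simp only [star_trivial, Matrix.mulVec_sub, Matrix.mulVec_smul, dotProduct_sub, sub_dotProduct,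
      dotProduct_smul, smul_dotProduct, smul_eq_mul, hsym l x] at h
    have hvl : l ⬝ᵥ S.mulVec l = v := rfl
    rw [hvl] at h
    simp only [star_trivial, Matrix.sub_mulVec, dotProduct_sub, Matrix.vecMulVec_mulVec,
      smul_dotProduct, dotProduct_smul, smul_eq_mul]
    simp
    rw [dotProduct_comm (S.mulVec l) x]
    have h3 : (√v)⁻¹ * (√v)⁻¹ = v⁻¹ := by
      rw [← mul_inv, Real.mul_self_sqrt hv.le]
    have h4 : (x ⬝ᵥ S.mulVec l / v) * v = x ⬝ᵥ S.mulVec l := by field_simp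
    rw [h4] at h
    have : (√v)⁻¹ * (x ⬝ᵥ S.mulVec l) * ((√v)⁻¹ * (x ⬝ᵥ S.mulVec l)) =
      (x ⬝ᵥ S.mulVec l) / v * (x ⬝ᵥ S.mulVec l) := by
      calc _ = ((√v)⁻¹ * (√v)⁻¹) * (x ⬝ᵥ S.mulVec l)^2 := by ring
        _ = _ := by rw [h3]; field_simp
    linarith

namespace IsGaussLaw
variable {n : ℕ} {μ ν : Measure (Fin n → ℝ)} {S S' : Matrix (Fin n) (Fin n) ℝ}

theorem sidak (h : IsGaussLaw μ S) (hS : S.PosSemidef) {K : Set (Fin n → ℝ)}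
    (hK : MeasurableSet K) (hc : Convex ℝ K) (hs : ∀ x ∈ K, -x ∈ K) (l : Fin n → ℝ) (b : ℝ) :
    μ K * μ {x | |l ⬝ᵥ x| ≤ b} ≤ μ (K ∩ {x | |l ⬝ᵥ x| ≤ b}) := by
  have := h.isProbabilityMeasure
  have hB : MeasurableSet {x : Fin n → ℝ | |l ⬝ᵥ x| ≤ b} :=
    measurableSet_le (by fun_prop) (by fun_prop)
  rcases lt_or_ge b 0 with hb | hb
  · have : {x : Fin n → ℝ | |l ⬝ᵥ x| ≤ b} = ∅ := by
      ext x; simp; linarith [abs_nonneg (l ⬝ᵥ x)]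
    simp [this]
  have hv : 0 ≤ l ⬝ᵥ S.mulVec l := by simpa using hS.dotProduct_mulVec_nonneg l
  rcases eq_or_lt_of_le hv with hv | hv
  · have h0 := h l
    rw [← hv, Real.toNNReal_zero, gaussianReal_zero_var] at h0
    have h1 : ∀ᵐ x ∂μ, l ⬝ᵥ x = 0 := by
      have : ∀ᵐ y ∂(μ.map fun x => l ⬝ᵥ x), y = 0 := by
        rw [h0, ae_dirac_eq]; simp
      exact ae_of_ae_map (by fun_prop) this
    have h2 : μ (K ∩ {x | |l ⬝ᵥ x| ≤ b}) = μ K := by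
      apply measure_congr
      filter_upwards [h1] with x hx
      apply propext
      change (x ∈ K ∧ |l ⬝ᵥ x| ≤ b) ↔ x ∈ K
      simp [hx, hb]
    rw [h2]
    exact mul_le_of_le_one_right' prob_le_one
  set v := l ⬝ᵥ S.mulVec l with hvdef
  set c := (√v)⁻¹ • S.mulVec l with hcdef
  have hS2 : (S - Matrix.vecMulVec c c).PosSemidef := hS.sub_vecMulVec l hv
  obtain ⟨ν, hν, -⟩ := exists_isGaussLaw hS2
  have hνp := hν.isProbabilityMeasure
  have hsq : 0 < √v := Real.sqrt_pos.2 hv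
  have hlc : l ⬝ᵥ c = √v := by
    rw [hcdef, dotProduct_smul, smul_eq_mul, ← hvdef]
    rw [inv_mul_eq_div, Real.div_sqrt]
  have hsv := smul_gaussianReal c
  have hμ : μ = ((gaussianReal 0 1).prod ν).map (fun p => p.2 + p.1 • c) := by
    have h3 : (Matrix.vecMulVec c c).PosSemidef := by
      simpa using Matrix.posSemidef_vecMulVec_self_star c
    have h4 := hsv.add hν h3 hS2
    rw [add_sub_cancel] at h4
    have h5 : ν = ν.map id := by simp
    rw [h.unique h4]
    conv_lhs => rw [h5]
    rw [Measure.map_prod_map _ _ (by fun_prop) (by fun_prop),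
      Measure.map_map (by fun_prop) (by fun_prop)]
    congr 1; ext p; simp [add_comm]
  have hly : ∀ᵐ y ∂ν, l ⬝ᵥ y = 0 := by
    have h0 := hν l
    have e : l ⬝ᵥ (S - Matrix.vecMulVec c c).mulVec l = 0 := by
      rw [Matrix.sub_mulVec, dotProduct_sub, Matrix.vecMulVec_mulVec, ← hvdef]
      simp [dotProduct_comm c l, hlc, Real.mul_self_sqrt hv.le]
    rw [e, Real.toNNReal_zero, gaussianReal_zero_var] at h0
    have : ∀ᵐ y ∂(ν.map fun x => l ⬝ᵥ x), y = 0 := by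
      rw [h0, ae_dirac_eq]; simp
    exact ae_of_ae_map (by fun_prop) this
  have slice : ∀ A : Set (Fin n → ℝ), MeasurableSet A →
      μ A = ∫⁻ z, ν {y | y + z • c ∈ A} ∂(gaussianReal 0 1) := by
    intro A hA
    rw [hμ, Measure.map_apply (by fun_prop) hA, Measure.prod_apply (hA.preimage (by fun_prop))]
    rfl
  set f : ℝ → ℝ≥0∞ := fun z => ν {y | y + z • c ∈ K} with hf
  have hmain : ∀ A : Set (Fin n → ℝ), MeasurableSet A → μ (A ∩ {x | |l ⬝ᵥ x| ≤ b}) =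
      ∫⁻ z in {z | |z| ≤ b / √v}, ν {y | y + z • c ∈ A} ∂(gaussianReal 0 1) := by
    intro A hA
    rw [slice _ (hA.inter hB), ← lintegral_indicator (measurableSet_le (by fun_prop) (by fun_prop))]
    congr 1; ext z
    have : ν {y | y + z • c ∈ A ∩ {x | |l ⬝ᵥ x| ≤ b}} =
        ν {y | y + z • c ∈ A ∧ |z| * √v ≤ b} := by
      apply measure_congr
      filter_upwards [hly] with y hy
      apply propext
      change (y + z • c ∈ A ∧ |l ⬝ᵥ (y + z • c)| ≤ b) ↔ (y + z • c ∈ A ∧ |z| * √v ≤ b)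
      rw [dotProduct_add, hy, dotProduct_smul, hlc, zero_add, smul_eq_mul, abs_mul,
        abs_of_pos hsq]
    rw [this]
    by_cases hz : |z| * √v ≤ b
    · rw [Set.indicator_of_mem (by exact (le_div_iff₀ hsq).2 hz)]
      simp [hz]
    · rw [Set.indicator_of_notMem (by simp only [mem_ofPred_eq]; rwa [le_div_iff₀ hsq])]
      simp [hz]
  have h6 := hmain univ MeasurableSet.univ
  simp only [univ_inter, mem_univ, ofPred_true, measure_univ] at h6
  rw [hmain K hK, h6, slice K hK]
  simp only [lintegral_const, one_mul, Measure.restrict_apply, MeasurableSet.univ, univ_inter]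
  exact mul_lintegral_le_of_unimodal (fun z z' hz => hν.shift_mono hS2 hK hc hs c hz) _

theorem sidak_finset (h : IsGaussLaw μ S) (hS : S.PosSemidef) {K : Set (Fin n → ℝ)}
    (hK : MeasurableSet K) (hc : Convex ℝ K) (hs : ∀ x ∈ K, -x ∈ K) {ι : Type*} (s : Finset ι)
    (l : ι → Fin n → ℝ) (b : ι → ℝ) :
    μ K * ∏ i ∈ s, μ {x | |l i ⬝ᵥ x| ≤ b i} ≤ μ (K ∩ {x | ∀ i ∈ s, |l i ⬝ᵥ x| ≤ b i}) := by
  classical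
  induction s using Finset.induction_on with
  | empty => simp
  | insert i s hi ih =>
    rw [Finset.prod_insert hi]
    have hset : K ∩ {x | ∀ j ∈ insert i s, |l j ⬝ᵥ x| ≤ b j} =
      (K ∩ {x | ∀ j ∈ s, |l j ⬝ᵥ x| ≤ b j}) ∩ {x | |l i ⬝ᵥ x| ≤ b i} := by
      ext x; simp; tauto
    rw [hset]
    have hconv : Convex ℝ {x : Fin n → ℝ | ∀ j ∈ s, |l j ⬝ᵥ x| ≤ b j} := by
      intro x hx y hy p q hp hq hpq j hj
      rw [dotProduct_add, dotProduct_smul, dotProduct_smul]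
      calc _ ≤ |p • (l j ⬝ᵥ x)| + |q • (l j ⬝ᵥ y)| := abs_add_le _ _
        _ ≤ p * b j + q * b j := by
          rw [smul_eq_mul, smul_eq_mul, abs_mul, abs_mul, abs_of_nonneg hp, abs_of_nonneg hq]
          gcongr
          · exact hx j hj
          · exact hy j hj
        _ = b j := by rw [← add_mul, hpq, one_mul]
    refine le_trans ?_ (h.sidak hS (hK.inter ?_) (hc.inter hconv) ?_ (l i) (b i))
    · calc _ = (μ K * ∏ i ∈ s, μ {x | |l i ⬝ᵥ x| ≤ b i}) * μ {x | |l i ⬝ᵥ x| ≤ b i} := by ring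
        _ ≤ _ := by gcongr
    · have : {x : Fin n → ℝ | ∀ j ∈ s, |l j ⬝ᵥ x| ≤ b j} =
        ⋂ j ∈ s, {x : Fin n → ℝ | |l j ⬝ᵥ x| ≤ b j} := by ext; simp
      rw [this]
      exact Finset.measurableSet_biInter _ fun j _ => measurableSet_le (by fun_prop) (by fun_prop)
    · rintro x ⟨h1, h2⟩
      exact ⟨hs x h1, fun j hj => by simpa using h2 j hj⟩

end IsGaussLaw

/-- Fernique's tail bound with universal constants. -/
theorem exists_fernique_tail : ∃ C c : ℝ, 0 < C ∧ 0 < c ∧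
    ∀ (n : ℕ) (μ : Measure (Fin n → ℝ)) (S : Matrix (Fin n) (Fin n) ℝ), IsGaussLaw μ S →
    ∀ A : ℝ, 0 < A → ENNReal.ofReal (3/4) ≤ μ {x | ‖x‖ ≤ A} → ∀ t : ℝ, 0 ≤ t →
      μ {x | t < ‖x‖} ≤ ENNReal.ofReal (C * rexp (-(c * (t / A) ^ 2))) := by
  set c : ℝ≥0∞ := ENNReal.ofReal (3/4) with hc
  have hc1 : 1 - c = ENNReal.ofReal (1/4) := by
    rw [hc, ← ENNReal.ofReal_one, ← ENNReal.ofReal_sub _ (by norm_num)]; norm_num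
  have hcdiv : (c / (1 - c)).toReal = 3 := by
    rw [hc1, hc, ← ENNReal.ofReal_div_of_pos (by norm_num), ENNReal.toReal_ofReal] <;> norm_num
  have hgt : 2⁻¹ < c := by
    rw [hc, show (2:ℝ≥0∞)⁻¹ = ENNReal.ofReal (1/2) by
      rw [one_div, ENNReal.ofReal_inv_of_pos (by norm_num)]; simp]
    exact (ENNReal.ofReal_lt_ofReal_iff (by norm_num)).2 (by norm_num)
  have hlt : c < 1 := by
    rw [hc, ← ENNReal.ofReal_one]; exact (ENNReal.ofReal_lt_ofReal_iff (by norm_num)).2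
        (by norm_num)
  have hl3 : 0 < Real.log 3 := Real.log_pos (by norm_num)
  set R : ℝ≥0∞ := .ofReal (rexp (Fernique.logRatio c)) + ∑' n : ℕ,
      .ofReal (rexp (-2⁻¹ * Real.log (c/(1-c)).toReal * 2^n)) with hR
  have hRt : R ≠ ∞ := by
    refine ENNReal.add_ne_top.2 ⟨by simp, ?_⟩
    rw [hcdiv]
    have hs : Summable (fun n : ℕ => rexp (-2⁻¹ * Real.log 3) ^ n) :=
      summable_geometric_of_lt_one (by positivity) (by rw [Real.exp_lt_one_iff]; linarith)
    refine Summable.tsum_ofReal_ne_top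
        (Summable.of_nonneg_of_le (fun _ => by positivity) (fun n => ?_) hs)
    rw [← Real.exp_nat_mul, Real.exp_le_exp]
    have : (n:ℝ) ≤ 2 ^ n := by exact_mod_cast (Nat.lt_two_pow_self).le
    nlinarith
  refine ⟨R.toReal + 1, Fernique.logRatio c, by positivity, Fernique.logRatio_pos hgt hlt, ?_⟩
  intro n μ S h A hA hμ t ht
  have := h.isProbabilityMeasure
  have hG : IsGaussian μ := by
    refine isGaussian_of_map_eq_gaussianReal fun L =>
      ⟨0, ((fun i => L (Pi.single i 1)) ⬝ᵥ S.mulVec (fun i => L (Pi.single i 1))).toNNReal, ?_⟩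
    · rw [← h]
      congr 1
      ext x
      conv_lhs => rw [← Finset.univ_sum_single x]
      simp only [map_sum, dotProduct]
      refine Finset.sum_congr rfl fun i _ => ?_
      have : Pi.single i (x i) = x i • (Pi.single i (1:ℝ) : Fin n → ℝ) := by
        rw [← Pi.single_smul]; simp
      simp [this, mul_comm]
  have h0 : μ[id] = 0 := by
    have h1 : μ[id] = -μ[id] := by
      conv_lhs => rw [← h.map_neg]
      rw [integral_map (by fun_prop) (by fun_prop)]
      exact MeasureTheory.integral_neg _
    exact self_eq_neg.1 h1
  have hF := lintegral_exp_mul_sq_norm_le_of_map_rotation_eq_self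
    (IsGaussian.map_rotation_eq_self h0 _) hμ hgt
  rw [← hR] at hF
  have hM := mul_meas_ge_le_lintegral (μ := μ)
    (f := fun x => ENNReal.ofReal (rexp (Fernique.logRatio c * A⁻¹^2 * ‖x‖^2))) (by fun_prop)
    (ENNReal.ofReal (rexp (Fernique.logRatio c * A⁻¹^2 * t^2)))
  have hsub : {x : Fin n → ℝ | t < ‖x‖} ⊆
      {x | ENNReal.ofReal (rexp (Fernique.logRatio c * A⁻¹^2 * t^2)) ≤
      ENNReal.ofReal (rexp (Fernique.logRatio c * A⁻¹^2 * ‖x‖^2))} := by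
    intro x hx
    simp only [mem_ofPred_eq] at hx ⊢
    have := (Fernique.logRatio_pos hgt hlt).le
    gcongr
  set e := ENNReal.ofReal (rexp (Fernique.logRatio c * A⁻¹^2 * t^2)) with he
  have he0 : e ≠ 0 := by simp [he]; positivity
  have het : e ≠ ∞ := by simp [he]
  calc μ {x | t < ‖x‖} ≤ e⁻¹ * R := by
        rw [← one_mul (μ _), ← ENNReal.inv_mul_cancel he0 het, mul_assoc]
        have h2 := (mul_le_mul_right (measure_mono (μ := μ) hsub) e).trans (hM.trans hF)
        gcongr
    _ ≤ _ := by
        rw [← ENNReal.ofReal_toReal hRt, he, ← ENNReal.ofReal_inv_of_pos (by positivity),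
          ← ENNReal.ofReal_mul (by positivity), ← Real.exp_neg]
        apply ENNReal.ofReal_le_ofReal
        rw [ENNReal.toReal_ofReal (by positivity), mul_comm]
        have e2 : Fernique.logRatio c * A⁻¹ ^ 2 * t ^ 2 =
            Fernique.logRatio c * (t / A) ^ 2 := by field_simp
        rw [e2]
        gcongr
        linarith

/-- A one-dimensional small ball estimate with an arbitrary exponent. -/
theorem exists_gaussianReal_smallBall {q : ℝ} (hq : 0 < q) : ∃ C : ℝ, 0 < C ∧
    ∀ (v : NNReal) (σ b : ℝ), 0 < σ → 0 < b → (v : ℝ) ≤ σ ^ 2 →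
      ENNReal.ofReal (rexp (-(C * (σ / b) ^ q))) ≤ gaussianReal 0 v {x | |x| ≤ b} := by
  set p : ℝ≥0∞ := ENNReal.ofReal q
  have hp0 : p ≠ 0 := by simp [p, hq]
  have hpt : p ≠ ∞ := by simp [p]
  have hpr : p.toReal = q := by simp [p, hq.le]
  set N := gaussianReal 0 1 with hN
  have hmem := memLp_id_gaussianReal' (μ := 0) (v := 1) p hpt
  set M : ℝ := (eLpNorm id p N ^ q).toReal + 1 with hM
  have hMt : eLpNorm id p N ^ q ≠ ∞ := ENNReal.rpow_ne_top_of_nonneg hq.le hmem.2.ne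
  have hM1 : 1 ≤ M := by have : 0 ≤ (eLpNorm id p N ^ q).toReal := ENNReal.toReal_nonneg
                         linarith
  have tail : ∀ x : ℝ, 0 < x → 1 - ENNReal.ofReal (M * (1 / x) ^ q) ≤ N {z | |z| ≤ x} := by
    intro x hx
    have h1 := meas_ge_le_mul_pow_eLpNorm_enorm N hp0 hpt (f := id) (by fun_prop)
      (ε := ENNReal.ofReal x) (by simpa using hx) (by simp)
    rw [hpr, ← ENNReal.ofReal_inv_of_pos hx, ENNReal.ofReal_rpow_of_pos (by positivity),
      ← ENNReal.ofReal_toReal hMt, ← ENNReal.ofReal_mul (by positivity)] at h1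
    have h2 : {z : ℝ | |z| ≤ x}ᶜ ⊆ {z | ENNReal.ofReal x ≤ ‖id z‖ₑ} := by
      intro z hz
      simp only [mem_compl_iff, mem_ofPred_eq, not_le] at hz
      simp only [id, mem_ofPred_eq, Real.enorm_eq_ofReal_abs]
      exact ENNReal.ofReal_le_ofReal hz.le
    have h3 : N {z : ℝ | |z| ≤ x}ᶜ ≤ ENNReal.ofReal (M * (1 / x) ^ q) := by
      refine (measure_mono h2).trans (h1.trans (ENNReal.ofReal_le_ofReal ?_))
      rw [one_div, mul_comm M]
      gcongr; linarith
    rw [tsub_le_iff_right, ← measure_univ (μ := N),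
      ← measure_add_measure_compl (μ := N) (measurableSet_le (by fun_prop) (by fun_prop) :
        MeasurableSet {z : ℝ | |z| ≤ x})]
    gcongr
  set x₀ : ℝ := (2 * M) ^ (1 / q) with hx₀
  have hx0 : 0 < x₀ := by positivity
  set d : ℝ := gaussianPDFReal 0 1 x₀ with hd
  have hd0 : 0 < d := gaussianPDFReal_pos _ _ _ one_ne_zero
  have small : ∀ x : ℝ, 0 < x → x ≤ x₀ → ENNReal.ofReal (d * x) ≤ N {z | |z| ≤ x} := by
    intro x hx hxx
    rw [hN, gaussianReal_apply _ one_ne_zero]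
    have hsub : Icc 0 x ⊆ {z : ℝ | |z| ≤ x} := fun z hz => by
      simp only [mem_ofPred_eq]; rw [abs_of_nonneg hz.1]; exact hz.2
    calc ENNReal.ofReal (d * x) = ∫⁻ z in Icc 0 x, ENNReal.ofReal d := by
          rw [setLIntegral_const, Real.volume_Icc, ENNReal.ofReal_mul hd0.le, sub_zero]
      _ ≤ ∫⁻ z in Icc 0 x, gaussianPDF 0 1 z := by
          refine setLIntegral_mono (measurable_gaussianPDF 0 1) fun z hz => ?_
          rw [gaussianPDF]
          apply ENNReal.ofReal_le_ofReal
          rw [hd, gaussianPDFReal, gaussianPDFReal]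
          have h1 : z ≤ x₀ := hz.2.trans hxx
          have h0 : 0 ≤ z := hz.1
          simp only [sub_zero]
          gcongr
      _ ≤ _ := lintegral_mono_set hsub
  have key : ∀ x : ℝ, 0 < x → ENNReal.ofReal (rexp (-((2 * M + d ^ (-q) / q) * (1 / x) ^ q))) ≤
      N {z | |z| ≤ x} := by
    intro x hx
    have hdq : 0 < d ^ (-q) / q := by positivity
    rcases le_total (M * (1 / x) ^ q) (1 / 2) with h | h
    · refine le_trans ?_ (tail x hx)
      rw [← ENNReal.ofReal_one, ← ENNReal.ofReal_sub _ (by positivity)]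
      apply ENNReal.ofReal_le_ofReal
      set y := M * (1 / x) ^ q
      have hy : 0 ≤ y := by positivity
      have h1 : rexp (-((2 * M + d ^ (-q) / q) * (1 / x) ^ q)) ≤ rexp (-(2 * y)) := by
        rw [Real.exp_le_exp]
        have : 0 ≤ d ^ (-q) / q * (1/x)^q := by positivity
        simp only [y]; linarith
      have h2 : rexp (-(2 * y)) ≤ 1 - y := by
        rw [Real.exp_neg, inv_le_comm₀ (Real.exp_pos _) (by linarith)]
        refine le_trans ?_ (Real.add_one_le_exp _)
        rw [inv_le_iff_one_le_mul₀ (by linarith)]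
        nlinarith
      exact h1.trans h2
    · have hxx : x ≤ x₀ := by
        rw [hx₀, one_div q, Real.le_rpow_inv_iff_of_pos hx.le (by positivity) hq]
        rw [one_div x, Real.inv_rpow hx.le] at h
        have := mul_le_mul_of_nonneg_right h (by positivity : 0 ≤ 2 * x ^ q)
        have hxq : 0 < x ^ q := by positivity
        field_simp at this
        linarith
      refine le_trans (ENNReal.ofReal_le_ofReal ?_) (small x hx hxx)
      have hdx : 0 < d * x := by positivity
      have h1 : -Real.log (d * x) ≤ (d * x) ^ (-q) / q := by
        have := Real.log_le_rpow_div (x := (d * x)⁻¹) (by positivity) hq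
        rwa [Real.log_inv, Real.inv_rpow hdx.le, ← Real.rpow_neg hdx.le] at this
      rw [← Real.le_log_iff_exp_le hdx]
      have h2 : (d * x) ^ (-q) / q = d ^ (-q) / q * (1/x) ^ q := by
        rw [Real.mul_rpow hd0.le hx.le, one_div, Real.inv_rpow hx.le, ← Real.rpow_neg hx.le]; ring
      have : 0 ≤ 2 * M * (1/x)^q := by positivity
      rw [h2] at h1
      linarith
  refine ⟨2 * M + d ^ (-q) / q, by positivity, fun v σ b hσ hb hv => ?_⟩
  have hmap : gaussianReal 0 v = N.map (fun z => √v * z) := by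
    rw [hN, gaussianReal_map_const_mul]
    congr 1
    · simp
    · ext; simp
  rw [hmap, Measure.map_apply (by fun_prop) (measurableSet_le (by fun_prop) (by fun_prop))]
  refine le_trans ?_ ((key (b / σ) (by positivity)).trans (measure_mono ?_))
  · rw [one_div_div]
  · intro z hz
    simp only [mem_ofPred_eq, mem_preimage] at hz ⊢
    rw [abs_mul, abs_of_nonneg (Real.sqrt_nonneg _)]
    have : √v ≤ σ := Real.sqrt_le_iff.2 ⟨hσ.le, hv⟩
    rw [le_div_iff₀ hσ] at hz
    nlinarith [abs_nonneg z]

theorem IsGaussLaw.le_measure_abs_le {q C : ℝ}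
    (hC : ∀ (v : NNReal) (σ b : ℝ), 0 < σ → 0 < b → (v : ℝ) ≤ σ ^ 2 →
      ENNReal.ofReal (rexp (-(C * (σ / b) ^ q))) ≤ gaussianReal 0 v {x | |x| ≤ b}) {n : ℕ}
    {μ : Measure (Fin n → ℝ)} {S : Matrix (Fin n) (Fin n) ℝ} (h : IsGaussLaw μ S)
    (l : Fin n → ℝ) {σ b : ℝ} (hσ : 0 < σ) (hb : 0 < b) (hl : l ⬝ᵥ S.mulVec l ≤ σ ^ 2) :
    ENNReal.ofReal (rexp (-(C * (σ / b) ^ q))) ≤ μ {x | |l ⬝ᵥ x| ≤ b} := by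
  have := hC (l ⬝ᵥ S.mulVec l).toNNReal σ b hσ hb (by simp [hl]; positivity)
  rwa [← h l, Measure.map_apply (by fun_prop)
      (measurableSet_le (by fun_prop) (by fun_prop))] at this

theorem lintegral_Icc_rpow {p c : ℝ} (hp : -1 < p) (hc : 0 ≤ c) :
    ∫⁻ x in Icc 0 c, ENNReal.ofReal (x ^ p) = ENNReal.ofReal (c ^ (p + 1) / (p + 1)) := by
  have h1 : IntegrableOn (fun x : ℝ => x ^ p) (Icc 0 c) := by
    rw [integrableOn_Icc_iff_integrableOn_Ioc, ← intervalIntegrable_iff_integrableOn_Ioc_of_le hc]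
    exact intervalIntegral.intervalIntegrable_rpow' hp
  rw [← ofReal_integral_eq_lintegral_ofReal h1, integral_Icc_eq_integral_Ioc,
    ← intervalIntegral.integral_of_le hc, integral_rpow (Or.inl hp),
    Real.zero_rpow (by linarith), sub_zero]
  exact (ae_restrict_mem measurableSet_Icc).mono fun x hx => Real.rpow_nonneg hx.1 _

theorem lintegral_Ici_rpow {p c : ℝ} (hp : p < -1) (hc : 0 < c) :
    ∫⁻ x in Ici c, ENNReal.ofReal (x ^ p) = ENNReal.ofReal (c ^ (p + 1) / (-p - 1)) := by
  have h1 := integrableOn_Ioi_rpow_of_lt hp hc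
  rw [setLIntegral_congr Ioi_ae_eq_Ici.symm, ← ofReal_integral_eq_lintegral_ofReal h1,
    integral_Ioi_rpow_of_lt hp hc]
  · congr 1
    rw [show -p - 1 = -(p+1) by ring, div_neg, neg_div]
  · exact (ae_restrict_mem measurableSet_Ioi).mono fun x hx => Real.rpow_nonneg (hc.trans hx).le _

theorem setLIntegral_comp_sub_left (f : ℝ → ℝ≥0∞) (s : ℝ) (A : Set ℝ) :
    ∫⁻ x in (fun x => s - x) ⁻¹' A, f (s - x) = ∫⁻ x in A, f x :=
  (volume.measurePreserving_sub_left s).setLIntegral_comp_preimage_emb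
    (MeasurableEquiv.subLeft s).measurableEmbedding f A

theorem lintegral_Icc_sub_rpow (s : ℝ) {p c : ℝ} (hp : -1 < p) (hc : 0 ≤ c) :
    ∫⁻ x in Icc (s - c) s, ENNReal.ofReal ((s - x) ^ p) =
      ENNReal.ofReal (c ^ (p + 1) / (p + 1)) := by
  rw [← lintegral_Icc_rpow hp hc,
    ← setLIntegral_comp_sub_left (fun x => ENNReal.ofReal (x ^ p)) s (Icc 0 c)]
  congr 2
  ext x
  simp only [mem_Icc, mem_preimage]
  constructor <;> rintro ⟨h1, h2⟩ <;> constructor <;> linarith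

theorem lintegral_Iic_neg_rpow {p c : ℝ} (hp : p < -1) (hc : 0 < c) :
    ∫⁻ x in Iic (-c), ENNReal.ofReal ((-x) ^ p) = ENNReal.ofReal (c ^ (p + 1) / (-p - 1)) := by
  rw [← lintegral_Ici_rpow hp hc,
    ← setLIntegral_comp_sub_left (fun x => ENNReal.ofReal (x ^ p)) 0 (Ici c)]
  simp only [zero_sub]
  congr 2
  ext x
  simp only [mem_Iic, mem_Ici, mem_preimage]
  constructor <;> intro h <;> linarith

theorem lintegral_Icc_abs_rpow {p c : ℝ} (hp : -1 < p) (hc : 0 ≤ c) :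
    ∫⁻ x in Icc (-c) c, ENNReal.ofReal (|x| ^ p) ≤
      ENNReal.ofReal (2 * (c ^ (p + 1) / (p + 1))) := by
  have hsub : Icc (-c) c ⊆ Icc (0 - c) 0 ∪ Icc 0 c := by
    intro x hx; rcases le_total x 0 with h | h
    · left; constructor <;> simp_all
    · right; exact ⟨h, hx.2⟩
  refine (lintegral_mono_set hsub).trans ((lintegral_union_le _ _ _).trans ?_)
  have hp' : 0 < p + 1 := by linarith
  rw [two_mul, ENNReal.ofReal_add (by positivity) (by positivity)]
  gcongr
  · rw [← lintegral_Icc_sub_rpow 0 hp hc]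
    apply le_of_eq
    refine setLIntegral_congr_fun measurableSet_Icc fun x hx => ?_
    simp only [abs_of_nonpos hx.2, zero_sub]
  · rw [← lintegral_Icc_rpow hp hc]
    apply le_of_eq
    refine setLIntegral_congr_fun measurableSet_Icc fun x hx => ?_
    simp only [abs_of_nonneg hx.1]

theorem abs_one_add_rpow_sub_one_le {α p v : ℝ} (hα : |α| ≤ 1) (hp : α ≤ p) (hp0 : 0 ≤ p)
    (hp1 : p ≤ 1) (hv : 0 ≤ v) : |(1 + v) ^ α - 1| ≤ v ^ p := by
  rcases hv.eq_or_lt with rfl | hv0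
  · simp; exact Real.rpow_nonneg le_rfl _
  obtain ⟨h1, h2⟩ := abs_le.1 hα
  rcases le_total 0 α with ha | ha
  · have h3 : 1 ≤ (1 + v) ^ α := Real.one_le_rpow (by linarith) ha
    rw [abs_of_nonneg (by linarith)]
    rcases le_total v 1 with hv1 | hv1
    · have h4 : (1 + v) ^ α ≤ 1 + α * v :=
        rpow_one_add_le_one_add_mul_self (by linarith) ha h2
      have h5 : v ≤ v ^ p := by
        conv_lhs => rw [← Real.rpow_one v]
        exact Real.rpow_le_rpow_of_exponent_ge hv0 hv1 hp1
      nlinarith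
    · have h4 : (1 + v) ^ α ≤ 1 ^ α + v ^ α := Real.rpow_add_le_add_rpow zero_le_one hv ha h2
      have h5 : v ^ α ≤ v ^ p := Real.rpow_le_rpow_of_exponent_le hv1 hp
      rw [Real.one_rpow] at h4
      linarith
  · have h3 : (1 + v) ^ α ≤ 1 := Real.rpow_le_one_of_one_le_of_nonpos (by linarith) ha
    have h3' : 0 < (1 + v) ^ α := by positivity
    rw [abs_of_nonpos (by linarith)]
    rcases le_total v 1 with hv1 | hv1
    · have h5 : v ≤ v ^ p := by
        conv_lhs => rw [← Real.rpow_one v]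
        exact Real.rpow_le_rpow_of_exponent_ge hv0 hv1 hp1
      have h6 : (1 + v) ^ (-(1:ℝ)) ≤ (1 + v) ^ α :=
        Real.rpow_le_rpow_of_exponent_le (by linarith) h1
      have h7 : 1 - v ≤ (1 + v) ^ (-(1:ℝ)) := by
        rw [Real.rpow_neg_one, ← one_div, le_div_iff₀ (by linarith)]; nlinarith
      linarith
    · have : 1 ≤ v ^ p := Real.one_le_rpow hv1 hp0
      linarith

theorem abs_add_rpow_sub_rpow_le {α p z h : ℝ} (hα : |α| ≤ 1) (hp : α ≤ p) (hp0 : 0 ≤ p)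
    (hp1 : p ≤ 1) (hz : 0 < z) (hh : 0 ≤ h) : |(z + h) ^ α - z ^ α| ≤ h ^ p * z ^ (α - p) := by
  have h1 := abs_one_add_rpow_sub_one_le hα hp hp0 hp1 (div_nonneg hh hz.le)
  have h2 : (z + h) ^ α - z ^ α = z ^ α * ((1 + h / z) ^ α - 1) := by
    rw [mul_sub, ← Real.mul_rpow hz.le (by positivity), mul_add, mul_div_cancel₀ _ hz.ne']; ring_nf
  rw [h2, abs_mul, abs_of_pos (by positivity)]
  calc _ ≤ z ^ α * (h / z) ^ p := by gcongr
    _ = _ := by rw [Real.div_rpow hh hz.le, Real.rpow_sub hz]; ring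

/-- The kernel of the moving average representation of generalized fractional Brownian motion. -/
noncomputable def gfKer (α s x : ℝ) : ℝ := max (s - x) 0 ^ α - max (-x) 0 ^ α

/-- The weighted energy of a function over a set. -/
noncomputable def gfEnergy (γ : ℝ) (A : Set ℝ) (f : ℝ → ℝ) : ℝ≥0∞ :=
  ∫⁻ x in A, ENNReal.ofReal (f x ^ 2 * |x| ^ (-γ))

@[fun_prop]
theorem measurable_gfKer (α s : ℝ) : Measurable (gfKer α s) := by
  unfold gfKer; fun_prop

theorem gfKer_sub (α s s' x : ℝ) :
    gfKer α s' x - gfKer α s x = max (s' - x) 0 ^ α - max (s - x) 0 ^ α := by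
  simp [gfKer]

theorem gfKer_zero (α x : ℝ) : gfKer α 0 x = 0 := by simp [gfKer]

theorem abs_max_rpow_sub_le {α p s h x : ℝ} (hα : |α| ≤ 1) (hp : α ≤ p) (hp0 : 0 ≤ p)
    (hp1 : p ≤ 1) (hx : x < s) (hh : 0 ≤ h) :
    |max (s + h - x) 0 ^ α - max (s - x) 0 ^ α| ≤ h ^ p * (s - x) ^ (α - p) := by
  have := abs_add_rpow_sub_rpow_le hα hp hp0 hp1 (sub_pos.2 hx) hh
  rw [max_eq_left (by linarith), max_eq_left (by linarith)]
  convert this using 5; ring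

theorem abs_rpow_sub_zero_rpow_le {z α : ℝ} (hz : 0 < z) : |z ^ α - 0 ^ α| ≤ z ^ α := by
  have : 0 < z ^ α := by positivity
  rcases eq_or_ne α 0 with rfl | h
  · simp
  · rw [Real.zero_rpow h, sub_zero, abs_of_pos this]

theorem sq_mul_rpow_le {y z a b : ℝ} (hz : 0 < z) (h : |y| ≤ b * z ^ a) :
    y ^ 2 ≤ b ^ 2 * z ^ (2 * a) := by
  have : y ^ 2 ≤ (b * z ^ a) ^ 2 := by rw [← sq_abs y]; gcongr
  rwa [mul_pow, ← Real.rpow_natCast (z ^ a), ← Real.rpow_mul hz.le, Nat.cast_ofNat,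
      mul_comm a] at this

theorem gfEnergy_mono {γ : ℝ} {A B : Set ℝ} (h : A ⊆ B) (f : ℝ → ℝ) :
    gfEnergy γ A f ≤ gfEnergy γ B f := lintegral_mono_set h

theorem gfEnergy_union_le (γ : ℝ) (A B : Set ℝ) (f : ℝ → ℝ) :
    gfEnergy γ (A ∪ B) f ≤ gfEnergy γ A f + gfEnergy γ B f := lintegral_union_le _ _ _

theorem gfEnergy_le_of_forall_le {γ c : ℝ} {A : Set ℝ} {f g : ℝ → ℝ} (hc : 0 ≤ c)
    (hA : MeasurableSet A) (h : ∀ x ∈ A, x ≠ 0 → f x ^ 2 * |x| ^ (-γ) ≤ c * g x)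
    {D : ℝ} (hg : ∫⁻ x in A, ENNReal.ofReal (g x) ≤ ENNReal.ofReal D) :
    gfEnergy γ A f ≤ ENNReal.ofReal (c * D) := by
  rw [ENNReal.ofReal_mul hc]
  calc gfEnergy γ A f ≤ ∫⁻ x in A, ENNReal.ofReal c * ENNReal.ofReal (g x) := by
        refine lintegral_mono_ae ?_
        filter_upwards [ae_restrict_mem hA, ae_restrict_of_ae (measure_eq_zero_iff_ae_notMem.1
          (measure_singleton (μ := volume) (0:ℝ)))] with x hx h0
        rw [← ENNReal.ofReal_mul hc]
        exact ENNReal.ofReal_le_ofReal (h x hx h0)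
    _ = ENNReal.ofReal c * ∫⁻ x in A, ENNReal.ofReal (g x) := lintegral_const_mul' _ _ (by simp)
    _ ≤ _ := by gcongr

/-- Far part of the increments of the kernel. -/
theorem gfEnergy_Iic_le {α γ s h r : ℝ} (hα : |α| ≤ 1) (hH : α - γ / 2 < 1 / 2) (hs : 0 ≤ s)
    (hh : 0 ≤ h) (hr : 0 < r) :
    gfEnergy γ (Iic (-r)) (fun x => gfKer α (s + h) x - gfKer α s x) ≤
      ENNReal.ofReal (h ^ 2 * (r ^ (2 * (α - γ / 2 + 1 / 2) - 2) / (1 - 2 * (α - γ/2)))) := by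
  have h1 := lintegral_Iic_neg_rpow (p := 2 * α - 2 - γ) (c := r) (by linarith) hr
  refine (gfEnergy_le_of_forall_le (sq_nonneg h) measurableSet_Iic ?_ h1.le).trans_eq ?_
  · intro x hx _
    have hx : x ≤ -r := hx
    have hx0 : 0 < -x := by linarith
    rw [gfKer_sub]
    have h2 := abs_max_rpow_sub_le (p := 1) (s := s) (x := x) hα (abs_le.1 hα).2 zero_le_one le_rfl
        (by linarith) hh
    have h3 : (s - x) ^ (α - 1) ≤ (-x) ^ (α - 1) :=
      Real.rpow_le_rpow_of_nonpos hx0 (by linarith) (by linarith [(abs_le.1 hα).2])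
    rw [Real.rpow_one] at h2
    have h4 := sq_mul_rpow_le hx0 (h2.trans (mul_le_mul_of_nonneg_left h3 hh))
    rw [abs_of_neg (by linarith)]
    calc _ ≤ h ^ 2 * (-x) ^ (2 * (α - 1)) * (-x) ^ (-γ) := by gcongr
      _ = _ := by rw [mul_assoc, ← Real.rpow_add hx0]; ring_nf
  · ring_nf

/-- Increments of the kernel over the whole line. -/
theorem exists_gfEnergy_increment_le {α γ p : ℝ} (hγ : γ ∈ Ico (0:ℝ) 1) (hα : |α| ≤ 1)
    (hH : α - γ / 2 < 1 / 2) (hp : α ≤ p) (hp0 : 0 ≤ p) (hp1 : p ≤ 1) (hpa : p < α + 1 / 2) :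
    ∃ C : ℝ, 0 < C ∧ ∀ s h : ℝ, 0 < s → 0 ≤ h → h ≤ s →
      gfEnergy γ univ (fun x => gfKer α (s + h) x - gfKer α s x) ≤
        ENNReal.ofReal (C * (s ^ (2 * (α - γ / 2 + 1 / 2) - 2 * p) * h ^ (2 * p))) := by
  obtain ⟨hγ0, hγ1⟩ := hγ
  set H := α - γ / 2 + 1 / 2 with hHdef
  set C1 : ℝ := (1 - 2 * (α - γ/2))⁻¹
  set C2 : ℝ := 2⁻¹ ^ (2 * (α - p)) * (2 * (1 / (-γ + 1)))
  set C3 : ℝ := 2⁻¹ ^ (-γ) * (2⁻¹ ^ (2 * (α - p) + 1) / (2 * (α - p) + 1))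
  set C4 : ℝ := (2 * α + 1)⁻¹
  have hC1 : 0 < C1 := inv_pos.2 (by linarith)
  have hC2 : 0 < C2 := by have : 0 < -γ + 1 := by linarith
                          positivity
  have hC3 : 0 < C3 := by have : 0 < 2 * (α - p) + 1 := by linarith
                          positivity
  have hC4 : 0 < C4 := inv_pos.2 (by linarith)
  refine ⟨C1 + C2 + C3 + C4, by positivity, fun s h hs hh0 hhs => ?_⟩
  rcases hh0.eq_or_lt with rfl | hh
  · simp [gfEnergy]
  set B := s ^ (2 * H - 2 * p) * h ^ (2 * p) with hB
  have hB0 : 0 < B := by positivity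
  set f := fun x => gfKer α (s + h) x - gfKer α s x with hf
  have hpp : (h ^ p) ^ 2 = h ^ (2 * p) := by
    rw [← Real.rpow_natCast, ← Real.rpow_mul hh.le, Nat.cast_ofNat, mul_comm]
  have b1 : gfEnergy γ (Iic (-s)) f ≤ ENNReal.ofReal (C1 * B) := by
    refine (gfEnergy_Iic_le hα hH hs.le hh.le hs).trans (ENNReal.ofReal_le_ofReal ?_)
    have e1 : h ^ 2 * s ^ (2 * H - 2) ≤ B := by
      have : h ^ (2 - 2 * p) ≤ s ^ (2 - 2 * p) := Real.rpow_le_rpow hh.le hhs (by linarith)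
      calc h ^ 2 * s ^ (2 * H - 2) = h ^ (2 * p) * h ^ (2 - 2 * p) * s ^ (2 * H - 2) := by
            rw [← Real.rpow_add hh]; norm_num
        _ ≤ h ^ (2 * p) * s ^ (2 - 2 * p) * s ^ (2 * H - 2) := by gcongr
        _ = B := by rw [hB, mul_assoc, ← Real.rpow_add hs, mul_comm]; ring_nf
    calc _ = C1 * (h ^ 2 * s ^ (2 * H - 2)) := by rw [hHdef]; ring
      _ ≤ _ := by gcongr
  have b2 : gfEnergy γ (Icc (-s) (s/2)) f ≤ ENNReal.ofReal (C2 * B) := by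
    have h1 : ∫⁻ x in Icc (-s) (s/2), ENNReal.ofReal (|x| ^ (-γ)) ≤
        ENNReal.ofReal (2 * (s ^ (-γ + 1) / (-γ + 1))) :=
      (lintegral_mono_set (Icc_subset_Icc_right (by linarith))).trans
        (lintegral_Icc_abs_rpow (by linarith) hs.le)
    refine (gfEnergy_le_of_forall_le (c := h ^ (2 * p) * (s * 2⁻¹) ^ (2 * (α - p)))
      (by positivity) measurableSet_Icc ?_ h1).trans_eq ?_
    · intro x hx _
      simp only [hf, gfKer_sub]
      have hx2 := hx.2
      have h2 := abs_max_rpow_sub_le (s := s) (x := x) hα hp hp0 hp1 (by linarith) hh.le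
      have h3 : (s - x) ^ (α - p) ≤ (s * 2⁻¹) ^ (α - p) :=
        Real.rpow_le_rpow_of_nonpos (by positivity) (by linarith) (by linarith)
      have h4 := sq_mul_rpow_le (by positivity)
        (h2.trans (mul_le_mul_of_nonneg_left h3 (by positivity)))
      rw [hpp] at h4
      gcongr
    · congr 1
      rw [Real.mul_rpow hs.le (by positivity), hB,
        show 2 * H - 2 * p = 2 * (α - p) + (-γ + 1) by rw [hHdef]; ring,
            Real.rpow_add hs (2 * (α - p))]
      simp only [C2]
      ring
  have b3 : gfEnergy γ (Icc (s - s/2) s) f ≤ ENNReal.ofReal (C3 * B) := by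
    have h1 := lintegral_Icc_sub_rpow s (p := 2 * (α - p)) (c := s/2) (by linarith) (by positivity)
    have hae : gfEnergy γ (Icc (s - s/2) s) f = gfEnergy γ (Ico (s - s/2) s) f :=
      setLIntegral_congr Ico_ae_eq_Icc.symm
    rw [setLIntegral_congr Ico_ae_eq_Icc.symm] at h1
    rw [hae]
    refine (gfEnergy_le_of_forall_le (c := h ^ (2 * p) * (s * 2⁻¹) ^ (-γ))
      (by positivity) measurableSet_Ico ?_ h1.le).trans_eq ?_
    · intro x hx _
      simp only [hf, gfKer_sub]
      have hx1 := hx.1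
      have hx2 := hx.2
      have h2 := abs_max_rpow_sub_le (s := s) (x := x) hα hp hp0 hp1 (by linarith) hh.le
      have h3 : |x| ^ (-γ) ≤ (s * 2⁻¹) ^ (-γ) :=
        Real.rpow_le_rpow_of_nonpos (by positivity) (by rw [abs_of_pos] <;> linarith) (by linarith)
      have h4 := sq_mul_rpow_le (sub_pos.2 hx2) h2
      rw [hpp] at h4
      have : 0 < s - x := by linarith
      calc _ ≤ h ^ (2 * p) * (s - x) ^ (2 * (α - p)) * (s * 2⁻¹) ^ (-γ) := by gcongr
        _ = _ := by ring
    · congr 1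
      rw [Real.mul_rpow hs.le (by positivity), hB, div_eq_mul_inv s,
          Real.mul_rpow hs.le (by positivity),
        show 2 * H - 2 * p = -γ + (2 * (α - p) + 1) by rw [hHdef]; ring, Real.rpow_add hs (-γ)]
      ring
  have b4 : gfEnergy γ (Icc (s + h - h) (s + h)) f ≤ ENNReal.ofReal (C4 * B) := by
    have h1 := lintegral_Icc_sub_rpow (s + h) (p := 2 * α) (c := h) (by linarith) (by positivity)
    have hae : gfEnergy γ (Icc (s + h - h) (s + h)) f = gfEnergy γ (Ico (s + h - h) (s + h)) f :=
      setLIntegral_congr Ico_ae_eq_Icc.symm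
    rw [setLIntegral_congr Ico_ae_eq_Icc.symm] at h1
    rw [hae]
    refine (gfEnergy_le_of_forall_le (c := s ^ (-γ))
      (by positivity) measurableSet_Ico ?_ h1.le).trans (ENNReal.ofReal_le_ofReal ?_)
    · intro x hx _
      simp only [hf, gfKer_sub]
      have hx1 := hx.1
      have hx2 := hx.2
      have hz : 0 < s + h - x := by linarith
      rw [max_eq_right (by linarith : s - x ≤ 0), max_eq_left hz.le]
      have h3 : |x| ^ (-γ) ≤ s ^ (-γ) :=
        Real.rpow_le_rpow_of_nonpos (by positivity) (by rw [abs_of_pos] <;> linarith) (by linarith)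
      have h4 := sq_mul_rpow_le (b := 1) (a := α) hz
          (by rw [one_mul]; exact abs_rpow_sub_zero_rpow_le hz)
      rw [one_pow, one_mul] at h4
      rw [mul_comm]
      gcongr
    · have e1 : h ^ (2 * α + 1 - 2 * p) ≤ s ^ (2 * α + 1 - 2 * p) :=
        Real.rpow_le_rpow hh.le hhs (by linarith)
      calc s ^ (-γ) * (h ^ (2 * α + 1) / (2 * α + 1))
          = C4 * (s ^ (-γ) * (h ^ (2 * α + 1 - 2 * p) * h ^ (2 * p))) := by
            rw [← Real.rpow_add hh]; simp only [C4]; ring_nf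
        _ ≤ C4 * (s ^ (-γ) * (s ^ (2 * α + 1 - 2 * p) * h ^ (2 * p))) := by gcongr
        _ = C4 * B := by
            rw [← mul_assoc (s ^ (-γ)), ← Real.rpow_add hs, hB,
              show 2 * H - 2 * p = -γ + (2 * α + 1 - 2 * p) by rw [hHdef]; ring]
  have b5 : gfEnergy γ (Ioi (s + h)) f ≤ 0 := by
    apply le_of_eq
    rw [gfEnergy, ← lintegral_zero (μ := volume.restrict (Ioi (s + h)))]
    refine setLIntegral_congr_fun measurableSet_Ioi fun x hx => ?_
    have hx : s + h < x := hx
    simp only [hf, gfKer_sub]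
    rw [max_eq_right (by linarith), max_eq_right (by linarith)]; simp
  have hcov : (univ : Set ℝ) ⊆ Iic (-s) ∪ (Icc (-s) (s/2) ∪ (Icc (s - s/2) s ∪
      (Icc (s + h - h) (s + h) ∪ Ioi (s + h)))) := by
    intro x _
    simp only [mem_union, mem_Iic, mem_Icc, mem_Ioi]
    by_contra! hcon
    have a1 := hcon.1
    have a2 := hcon.2.1 a1.le
    have a3 := hcon.2.2.1 (by linarith)
    have a4 := hcon.2.2.2.1 (by linarith)
    linarith [hcon.2.2.2.2]
  calc gfEnergy γ univ f ≤ _ := gfEnergy_mono hcov f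
    _ ≤ ENNReal.ofReal (C1 * B) + (ENNReal.ofReal (C2 * B) + (ENNReal.ofReal (C3 * B) +
        (ENNReal.ofReal (C4 * B) + 0))) := by
      refine (gfEnergy_union_le _ _ _ _).trans (add_le_add b1 ?_)
      refine (gfEnergy_union_le _ _ _ _).trans (add_le_add b2 ?_)
      refine (gfEnergy_union_le _ _ _ _).trans (add_le_add b3 ?_)
      exact (gfEnergy_union_le _ _ _ _).trans (add_le_add b4 b5)
    _ = _ := by
      rw [add_zero, ← ENNReal.ofReal_add (by positivity) (by positivity),
        ← ENNReal.ofReal_add (by positivity) (by positivity),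
        ← ENNReal.ofReal_add (by positivity) (by positivity)]
      ring_nf

theorem exists_gfEnergy_le {α γ : ℝ} (hγ : γ ∈ Ico (0:ℝ) 1) (hα : |α| ≤ 1)
    (hα' : -1/2 + γ / 2 < α) (hH : α - γ / 2 < 1 / 2) :
    ∃ C : ℝ, 0 < C ∧ ∀ s : ℝ, 0 < s →
      gfEnergy γ univ (gfKer α s) ≤ ENNReal.ofReal (C * s ^ (2 * (α - γ / 2 + 1 / 2))) := by
  obtain ⟨hγ0, hγ1⟩ := hγ
  obtain ⟨p, hp, hp0, hp1, hpγ⟩ : ∃ p : ℝ, α ≤ p ∧ 0 ≤ p ∧ p ≤ 1 ∧ -1 < 2 * (α - p) - γ := by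
    rcases le_total 0 α with h | h
    · exact ⟨α, le_rfl, h, (abs_le.1 hα).2, by linarith⟩
    · exact ⟨0, h, le_rfl, zero_le_one, by linarith⟩
  set H := α - γ / 2 + 1 / 2 with hHdef
  set C1 : ℝ := (1 - 2 * (α - γ/2))⁻¹
  set C2 : ℝ := (2 * (α - p) - γ + 1)⁻¹
  set C3 : ℝ := 2⁻¹ ^ (2 * (α - p)) * (2⁻¹ ^ (-γ + 1) / (-γ + 1))
  set C4 : ℝ := 2⁻¹ ^ (-γ) * (2⁻¹ ^ (2 * α + 1) / (2 * α + 1))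
  have hC1 : 0 < C1 := inv_pos.2 (by linarith)
  have hC2 : 0 < C2 := inv_pos.2 (by linarith)
  have hC3 : 0 < C3 := by have : 0 < -γ + 1 := by linarith
                          positivity
  have hC4 : 0 < C4 := by have : 0 < 2 * α + 1 := by linarith
                          positivity
  refine ⟨C1 + C2 + C3 + C4, by positivity, fun s hs => ?_⟩
  set B := s ^ (2 * H) with hB
  have hB0 : 0 < B := by positivity
  set f := gfKer α s
  have hf : ∀ x, f x = max (s - x) 0 ^ α - max (-x) 0 ^ α := fun x => rfl
  have hpp : (s ^ p) ^ 2 = s ^ (2 * p) := by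
    rw [← Real.rpow_natCast, ← Real.rpow_mul hs.le, Nat.cast_ofNat, mul_comm]
  have b1 : gfEnergy γ (Iic (-s)) f ≤ ENNReal.ofReal (C1 * B) := by
    have := gfEnergy_Iic_le (s := 0) (h := s) hα hH le_rfl hs.le hs
    simp only [gfKer_zero, sub_zero, zero_add] at this
    refine this.trans_eq (congrArg _ ?_)
    rw [← Real.rpow_natCast s 2, ← mul_div_assoc, ← Real.rpow_add hs, hB, hHdef]
    simp only [C1]
    push_cast
    ring_nf
  have b2 : gfEnergy γ (Icc (0 - s) 0) f ≤ ENNReal.ofReal (C2 * B) := by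
    have h1 := lintegral_Icc_sub_rpow 0 (p := 2 * (α - p) - γ) (c := s) hpγ hs.le
    refine (gfEnergy_le_of_forall_le (c := s ^ (2 * p))
      (by positivity) measurableSet_Icc ?_ h1.le).trans_eq ?_
    · intro x hx hx0
      have hx2 : x < 0 := lt_of_le_of_ne hx.2 hx0
      have h2 := abs_max_rpow_sub_le (s := 0) (x := x) hα hp hp0 hp1 hx2 hs.le
      simp only [zero_sub, zero_add] at h2 ⊢
      have h4 := sq_mul_rpow_le (neg_pos.2 hx2) h2
      rw [hpp] at h4
      rw [hf, abs_of_neg hx2]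
      have : 0 < -x := by linarith
      calc _ ≤ s ^ (2 * p) * (-x) ^ (2 * (α - p)) * (-x) ^ (-γ) := by gcongr
        _ = _ := by rw [mul_assoc, ← Real.rpow_add this]; ring_nf
    · congr 1
      rw [← mul_div_assoc, ← Real.rpow_add hs, hB, hHdef]
      simp only [C2]
      ring_nf
  have b3 : gfEnergy γ (Icc 0 (s/2)) f ≤ ENNReal.ofReal (C3 * B) := by
    have h1 := lintegral_Icc_rpow (p := -γ) (c := s/2) (by linarith) (by positivity)
    refine (gfEnergy_le_of_forall_le (c := s ^ (2 * p) * (s * 2⁻¹) ^ (2 * (α - p)))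
      (by positivity) measurableSet_Icc ?_ h1.le).trans_eq ?_
    · intro x hx _
      have hx1 := hx.1
      have hx2 := hx.2
      have hz : 0 < s - x := by linarith
      rw [hf, max_eq_right (by linarith : -x ≤ 0), max_eq_left hz.le, abs_of_nonneg hx1]
      have h3 : (s - x) ^ α ≤ s ^ p * (s * 2⁻¹) ^ (α - p) := by
        rw [show α = p + (α - p) by ring, Real.rpow_add hz, show p + (α - p) - p = α - p by ring]
        have : (s - x) ^ (α - p) ≤ (s * 2⁻¹) ^ (α - p) :=
          Real.rpow_le_rpow_of_nonpos (by positivity) (by linarith) (by linarith)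
        have : (s - x) ^ p ≤ s ^ p := Real.rpow_le_rpow hz.le (by linarith) hp0
        gcongr
      have h4 := sq_mul_rpow_le (by positivity) ((abs_rpow_sub_zero_rpow_le hz).trans h3)
      rw [hpp] at h4
      gcongr
    · congr 1
      rw [div_eq_mul_inv s, Real.mul_rpow hs.le (by positivity), hB,
        Real.mul_rpow hs.le (by positivity),
        show 2 * H = 2 * p + 2 * (α - p) + (-γ + 1) by rw [hHdef]; ring,
            Real.rpow_add hs (2 * p + 2 * (α - p)), Real.rpow_add hs (2 * p)]
      simp only [C3]
      ring
  have b4 : gfEnergy γ (Icc (s - s/2) s) f ≤ ENNReal.ofReal (C4 * B) := by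
    have h1 := lintegral_Icc_sub_rpow s (p := 2 * α) (c := s/2) (by linarith) (by positivity)
    have hae : gfEnergy γ (Icc (s - s/2) s) f = gfEnergy γ (Ico (s - s/2) s) f :=
      setLIntegral_congr Ico_ae_eq_Icc.symm
    rw [setLIntegral_congr Ico_ae_eq_Icc.symm] at h1
    rw [hae]
    refine (gfEnergy_le_of_forall_le (c := (s * 2⁻¹) ^ (-γ))
      (by positivity) measurableSet_Ico ?_ h1.le).trans_eq (congrArg _ ?_)
    · intro x hx _
      have hx1 := hx.1
      have hx2 := hx.2
      have hz : 0 < s - x := by linarith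
      rw [hf, max_eq_right (by linarith : -x ≤ 0), max_eq_left hz.le]
      have h3 : |x| ^ (-γ) ≤ (s * 2⁻¹) ^ (-γ) :=
        Real.rpow_le_rpow_of_nonpos (by positivity) (by rw [abs_of_pos] <;> linarith) (by linarith)
      have h4 := sq_mul_rpow_le (b := 1) (a := α) hz
          (by rw [one_mul]; exact abs_rpow_sub_zero_rpow_le hz)
      rw [one_pow, one_mul] at h4
      rw [mul_comm]
      gcongr
    · rw [Real.mul_rpow hs.le (by positivity), hB, div_eq_mul_inv s,
          Real.mul_rpow hs.le (by positivity),
        show 2 * H = -γ + (2 * α + 1) by rw [hHdef]; ring, Real.rpow_add hs (-γ)]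
      simp only [C4]
      ring
  have b5 : gfEnergy γ (Ioi s) f ≤ 0 := by
    apply le_of_eq
    rw [gfEnergy, ← lintegral_zero (μ := volume.restrict (Ioi s))]
    refine setLIntegral_congr_fun measurableSet_Ioi fun x hx => ?_
    have hx : s < x := hx
    simp only [hf]
    rw [max_eq_right (by linarith), max_eq_right (by linarith)]; simp
  have hcov : (univ : Set ℝ) ⊆ Iic (-s) ∪ (Icc (0-s) 0 ∪ (Icc 0 (s/2) ∪
      (Icc (s - s/2) s ∪ Ioi s))) := by
    intro x _
    simp only [mem_union, mem_Iic, mem_Icc, mem_Ioi]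
    by_contra! hcon
    have a1 := hcon.1
    have a2 := hcon.2.1 (by linarith)
    have a3 := hcon.2.2.1 (by linarith)
    have a4 := hcon.2.2.2.1 (by linarith)
    linarith [hcon.2.2.2.2]
  calc gfEnergy γ univ f ≤ _ := gfEnergy_mono hcov f
    _ ≤ ENNReal.ofReal (C1 * B) + (ENNReal.ofReal (C2 * B) + (ENNReal.ofReal (C3 * B) +
        (ENNReal.ofReal (C4 * B) + 0))) := by
      refine (gfEnergy_union_le _ _ _ _).trans (add_le_add b1 ?_)
      refine (gfEnergy_union_le _ _ _ _).trans (add_le_add b2 ?_)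
      refine (gfEnergy_union_le _ _ _ _).trans (add_le_add b3 ?_)
      exact (gfEnergy_union_le _ _ _ _).trans (add_le_add b4 b5)
    _ = _ := by
      rw [add_zero, ← ENNReal.ofReal_add (by positivity) (by positivity),
        ← ENNReal.ofReal_add (by positivity) (by positivity),
        ← ENNReal.ofReal_add (by positivity) (by positivity)]
      ring_nf

/-- Translating by at most half of the distance to the origin changes increments of a power by a
bounded factor. -/
theorem abs_rpow_sub_rpow_translate_le {α s s' x : ℝ} (hα : |α| ≤ 1) (hs : 0 < s) (hss : s ≤ s')
    (hx : 2 * |x| ≤ s) : |(s' - x) ^ α - (s - x) ^ α| ≤ 4 * |s' ^ α - s ^ α| := by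
  obtain ⟨hα1, hα2⟩ := abs_le.1 hα
  have hxl : ∀ v ∈ Ici s, v / 2 ≤ v - x := fun v hv => by
    have := le_abs_self x; have : s ≤ v := hv; linarith
  have hd : ∀ v ∈ Ici s, HasDerivAt (fun v => α * (4 * v ^ α - (v - x) ^ α))
      (α * (4 * (α * v ^ (α - 1)) - α * (v - x) ^ (α - 1))) v := fun v hv => by
    have hv0 : s ≤ v := hv
    have h0 : 0 < v - x := by have := hxl v hv; linarith
    have h1 : HasDerivAt (fun v => v ^ α) (α * v ^ (α - 1)) v :=
      Real.hasDerivAt_rpow_const (Or.inl (by linarith))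
    have h2 := ((hasDerivAt_id v).sub_const x).rpow_const (p := α) (Or.inl h0.ne')
    simp only [id, one_mul] at h2
    exact ((h1.const_mul 4).sub h2).const_mul α
  have hmono : MonotoneOn (fun v => α * (4 * v ^ α - (v - x) ^ α)) (Ici s) := by
    refine monotoneOn_of_deriv_nonneg (convex_Ici s)
      (fun v hv => (hd v hv).continuousAt.continuousWithinAt)
      (fun v hv => (hd v (interior_subset hv)).differentiableAt.differentiableWithinAt)
      fun v hv => ?_
    have hv' := interior_subset hv
    rw [(hd v hv').deriv]
    have hv0 : 0 < v := lt_of_lt_of_le hs hv'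
    have h3 : (v - x) ^ (α - 1) ≤ (v / 2) ^ (α - 1) :=
      Real.rpow_le_rpow_of_nonpos (by positivity) (hxl v hv') (by linarith)
    have h4 : (v / 2) ^ (α - 1) ≤ 4 * v ^ (α - 1) := by
      rw [div_eq_mul_inv, Real.mul_rpow hv0.le (by positivity), mul_comm]
      gcongr
      rw [Real.inv_rpow (by norm_num), ← Real.rpow_neg (by norm_num)]
      calc (2:ℝ) ^ (-(α - 1)) ≤ 2 ^ (2:ℝ) :=
          Real.rpow_le_rpow_of_exponent_le (by norm_num) (by linarith)
        _ = 4 := by norm_num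
    nlinarith [mul_nonneg (mul_self_nonneg α) (sub_nonneg.2 (h3.trans h4))]
  have h5 := hmono (mem_Ici.2 le_rfl) (mem_Ici.2 hss) hss
  simp only at h5
  have hsx : 0 < s - x := by have := hxl s (mem_Ici.2 le_rfl); linarith
  have h6 : 0 ≤ α * ((s' - x) ^ α - (s - x) ^ α) := by
    rcases le_total 0 α with h | h
    · exact mul_nonneg h (sub_nonneg.2 (Real.rpow_le_rpow hsx.le (by linarith) h))
    · exact mul_nonneg_of_nonpos_of_nonpos h
        (sub_nonpos.2 (Real.rpow_le_rpow_of_nonpos hsx (by linarith) h))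
  rcases eq_or_ne α 0 with rfl | hne
  · simp
  have h7 : |α| * |(s' - x) ^ α - (s - x) ^ α| ≤ |α| * (4 * |s' ^ α - s ^ α|) := by
    rw [← abs_mul, abs_of_nonneg h6]
    calc _ ≤ 4 * (α * (s' ^ α - s ^ α)) := by linarith
      _ ≤ 4 * |α * (s' ^ α - s ^ α)| := by gcongr; exact le_abs_self _
      _ = _ := by rw [abs_mul]; ring
  exact le_of_mul_le_mul_left h7 (abs_pos.2 hne)

theorem gfEnergy_Icc_le {α γ r s s' : ℝ} (hγ : γ < 1) (hα : |α| ≤ 1) (hr : 0 < r)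
    (hs : 2 * r ≤ s) (hss : s ≤ s') :
    gfEnergy γ (Icc (-r) r) (fun x => gfKer α s' x - gfKer α s x) ≤
      ENNReal.ofReal (32 / (1 - γ) * (r ^ (1 - γ) * (s' ^ α - s ^ α) ^ 2)) := by
  have h1 := lintegral_Icc_abs_rpow (p := -γ) (c := r) (by linarith) hr.le
  refine (gfEnergy_le_of_forall_le (c := (4 * |s' ^ α - s ^ α|) ^ 2) (sq_nonneg _)
    measurableSet_Icc ?_ h1).trans_eq ?_
  · intro x hx _
    have hx1 := abs_le.2 hx
    have hx2 := le_abs_self x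
    rw [gfKer_sub, max_eq_left (by linarith), max_eq_left (by linarith)]
    refine mul_le_mul_of_nonneg_right ?_ (by positivity)
    rw [← sq_abs]
    gcongr
    exact abs_rpow_sub_rpow_translate_le hα (by linarith) hss (by linarith)
  · rw [mul_pow, sq_abs]; congr 1; ring_nf

theorem gfKer_mul_mul {c : ℝ} (hc : 0 < c) (α s x : ℝ) :
    gfKer α (c * s) (c * x) = c ^ α * gfKer α s x := by
  have h : ∀ y, max (c * y) 0 ^ α = c ^ α * max y 0 ^ α := fun y => by
    rw [← Real.mul_rpow hc.le (le_max_right _ _), mul_max_of_nonneg _ _ hc.le, mul_zero]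
  rw [gfKer, gfKer, ← mul_sub, ← mul_neg, h, h, mul_sub]

theorem gfbmCov_eq (α γ s t : ℝ) :
    gfbmCov α γ s t = ∫ u, gfKer α s u * gfKer α t u * |u| ^ (-γ) := rfl

theorem gfbmCov_mul_mul {c : ℝ} (hc : 0 < c) (α γ s t : ℝ) :
    gfbmCov α γ (c * s) (c * t) = c ^ (2 * (α - γ / 2 + 1 / 2)) * gfbmCov α γ s t := by
  have h := Measure.integral_comp_mul_left
    (fun u => gfKer α (c * s) u * gfKer α (c * t) u * |u| ^ (-γ)) c
  have h2 : ∀ u, gfKer α (c * s) (c * u) * gfKer α (c * t) (c * u) * |c * u| ^ (-γ) =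
      c ^ (2 * α - γ) * (gfKer α s u * gfKer α t u * |u| ^ (-γ)) := fun u => by
    rw [gfKer_mul_mul hc, gfKer_mul_mul hc, abs_mul, abs_of_pos hc,
      Real.mul_rpow hc.le (abs_nonneg _), show 2 * α - γ = α + α + -γ by ring,
          Real.rpow_add hc (α + α),
      Real.rpow_add hc]
    ring
  simp only [h2] at h
  rw [integral_const_mul, abs_of_pos (inv_pos.2 hc), smul_eq_mul, ← gfbmCov_eq, ← gfbmCov_eq] at h
  rw [show 2 * (α - γ / 2 + 1 / 2) = (2 * α - γ) + 1 by ring, Real.rpow_add hc, Real.rpow_one]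
  field_simp at h
  linarith

/-- The covariance matrix of the contribution of the noise in `A` to the values of the process at
the first `n` integers. -/
noncomputable def gfMat (α γ : ℝ) (A : Set ℝ) (n : ℕ) : Matrix (Fin n) (Fin n) ℝ :=
  Matrix.of fun i j => ∫ u in A, gfKer α (i:ℕ) u * gfKer α (j:ℕ) u * |u| ^ (-γ)

/-- The admissible range of the parameters of generalized fractional Brownian motion. -/
structure GFParam (α γ : ℝ) : Prop where
  mem : γ ∈ Ico (0:ℝ) 1
  lt : -1/2 + γ / 2 < α
  lt' : α - γ / 2 < 1 / 2

theorem GFParam.abs_le {α γ : ℝ} (h : GFParam α γ) : |α| ≤ 1 := by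
  have := h.mem.1
  have := h.mem.2
  have := h.lt
  have := h.lt'
  rw [_root_.abs_le]; constructor <;> linarith

theorem integrable_gfKer_sq {α γ : ℝ} (hP : GFParam α γ) {s : ℝ} (hs : 0 ≤ s) :
    Integrable fun u => gfKer α s u ^ 2 * |u| ^ (-γ) := by
  rcases hs.eq_or_lt with rfl | hs
  · simp [gfKer_zero]
  obtain ⟨C, -, hC⟩ := exists_gfEnergy_le hP.mem hP.abs_le hP.lt hP.lt'
  refine ⟨by fun_prop, (hasFiniteIntegral_iff_ofReal (ae_of_all _ fun u => by positivity)).2 ?_⟩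
  have := (hC s hs).trans_lt ENNReal.ofReal_lt_top
  rwa [gfEnergy, Measure.restrict_univ] at this

theorem integrable_gfKer_mul {α γ : ℝ} (hP : GFParam α γ) {s t : ℝ} (hs : 0 ≤ s) (ht : 0 ≤ t) :
    Integrable fun u => gfKer α s u * gfKer α t u * |u| ^ (-γ) := by
  refine ((integrable_gfKer_sq hP hs).add (integrable_gfKer_sq hP ht)).mono'
    (by fun_prop) (ae_of_all _ fun u => ?_)
  have h : 0 ≤ |u| ^ (-γ) := by positivity
  rw [Real.norm_eq_abs, abs_mul, abs_of_nonneg h, Pi.add_apply, ← add_mul]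
  gcongr
  rw [abs_le]
  constructor <;> nlinarith [sq_nonneg (gfKer α s u + gfKer α t u),
      sq_nonneg (gfKer α s u - gfKer α t u), sq_nonneg (gfKer α s u), sq_nonneg (gfKer α t u)]

theorem gfMat_quadForm {α γ : ℝ} (hP : GFParam α γ) (A : Set ℝ) (n : ℕ) (l : Fin n → ℝ) :
    l ⬝ᵥ (gfMat α γ A n).mulVec l = ∫ u in A, (∑ i, l i * gfKer α (i:ℕ) u) ^ 2 * |u| ^ (-γ) := by
  have h : ∀ u, (∑ i, l i * gfKer α (i:ℕ) u) ^ 2 * |u| ^ (-γ) =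
      ∑ i, ∑ j, l i * l j * (gfKer α (i:ℕ) u * gfKer α (j:ℕ) u * |u| ^ (-γ)) := fun u => by
    rw [sq, Finset.sum_mul_sum, Finset.sum_mul]
    refine Finset.sum_congr rfl fun i _ => ?_
    rw [Finset.sum_mul]
    exact Finset.sum_congr rfl fun j _ => by ring
  have h_int : ∀ i j : Fin n, Integrable
      (fun u => l i * l j * (gfKer α (i:ℕ) u * gfKer α (j:ℕ) u * |u| ^ (-γ))) (volume.restrict A) :=
    fun i j => ((integrable_gfKer_mul hP (Nat.cast_nonneg _)
        (Nat.cast_nonneg _)).restrict).const_mul _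
  simp only [h]
  rw [integral_finsetSum _ fun i _ => integrable_finsetSum _ fun j _ => h_int i j]
  simp only [dotProduct, Matrix.mulVec, Finset.mul_sum]
  refine Finset.sum_congr rfl fun i _ => ?_
  rw [integral_finsetSum _ fun j _ => h_int i j]
  refine Finset.sum_congr rfl fun j _ => ?_
  rw [integral_const_mul, gfMat, Matrix.of_apply]
  ring

theorem gfMat_posSemidef {α γ : ℝ} (hP : GFParam α γ) (A : Set ℝ)
    (n : ℕ) : (gfMat α γ A n).PosSemidef := by
  refine Matrix.PosSemidef.of_dotProduct_mulVec_nonneg ?_ fun l => ?_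
  · ext i j
    simp only [gfMat, Matrix.conjTranspose_apply, Matrix.of_apply, star_trivial]
    congr 1; ext u; ring
  · rw [star_trivial, gfMat_quadForm hP]
    exact integral_nonneg fun u => by positivity

theorem gfMat_quadForm_le {α γ : ℝ} (hP : GFParam α γ) {A : Set ℝ} {n : ℕ} {l : Fin n → ℝ} {c : ℝ}
    (hc : 0 ≤ c)
    {f : ℝ → ℝ} (hf : ∀ u, ∑ i, l i * gfKer α (i:ℕ) u = f u)
    (h : gfEnergy γ A f ≤ ENNReal.ofReal c) : l ⬝ᵥ (gfMat α γ A n).mulVec l ≤ c := by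
  rw [gfMat_quadForm hP, integral_eq_lintegral_of_nonneg_ae
    (ae_of_all _ fun u => by positivity) (by fun_prop)]
  simp only [hf]
  exact ENNReal.toReal_le_of_le_ofReal hc h

theorem gfMat_add_compl {α γ : ℝ} (hP : GFParam α γ) {A : Set ℝ} (hA : MeasurableSet A) (n : ℕ) :
    gfMat α γ A n + gfMat α γ Aᶜ n = gfMat α γ univ n := by
  ext i j
  simp only [gfMat, Matrix.add_apply, Matrix.of_apply, Measure.restrict_univ]
  exact integral_add_compl hA (integrable_gfKer_mul hP (Nat.cast_nonneg _) (Nat.cast_nonneg _))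

theorem ENNReal.prod_ofReal_exp_neg {ι : Type*} (s : Finset ι) (c : ι → ℝ) :
    ∏ i ∈ s, ENNReal.ofReal (rexp (-c i)) = ENNReal.ofReal (rexp (-∑ i ∈ s, c i)) := by
  rw [← ENNReal.ofReal_prod_of_nonneg fun i _ => (Real.exp_pos _).le, ← Real.exp_sum,
    Finset.sum_neg_distrib]

/-- Intersecting with finitely many strips costs at most the sum of the individual costs. -/
theorem IsGaussLaw.sidak_exp {q C : ℝ}
    (hC : ∀ (v : NNReal) (σ b : ℝ), 0 < σ → 0 < b → (v : ℝ) ≤ σ ^ 2 →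
      ENNReal.ofReal (rexp (-(C * (σ / b) ^ q))) ≤ gaussianReal 0 v {x | |x| ≤ b}) {n : ℕ}
    {μ : Measure (Fin n → ℝ)} {S : Matrix (Fin n) (Fin n) ℝ} (h : IsGaussLaw μ S)
    (hS : S.PosSemidef) {K : Set (Fin n → ℝ)} (hK : MeasurableSet K) (hc : Convex ℝ K)
    (hs : ∀ x ∈ K, -x ∈ K) {ι : Type*} (s : Finset ι) (l : ι → Fin n → ℝ) {σ b : ι → ℝ}
    (hσ : ∀ i ∈ s, 0 < σ i) (hb : ∀ i ∈ s, 0 < b i)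
    (hl : ∀ i ∈ s, l i ⬝ᵥ S.mulVec (l i) ≤ σ i ^ 2) :
    μ K * ENNReal.ofReal (rexp (-(C * ∑ i ∈ s, (σ i / b i) ^ q))) ≤
      μ (K ∩ {x | ∀ i ∈ s, |l i ⬝ᵥ x| ≤ b i}) := by
  refine le_trans ?_ (h.sidak_finset hS hK hc hs s l b)
  rw [Finset.mul_sum, ← ENNReal.prod_ofReal_exp_neg]
  gcongr with i hi
  exact h.le_measure_abs_le hC (l i) (hσ i hi) (hb i hi) (hl i hi)

/-- The coordinate functional of index `k`, which vanishes if `k` is out of range. -/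
def nodeVec (n k : ℕ) : Fin n → ℝ := fun j => if (j : ℕ) = k then 1 else 0

theorem nodeVec_dotProduct {n : ℕ} (k : Fin n) (x : Fin n → ℝ) : nodeVec n k ⬝ᵥ x = x k := by
  simp [nodeVec, dotProduct, Fin.val_inj]

theorem sum_nodeVec_mul {n k : ℕ} (hk : k < n) (f : ℕ → ℝ) :
    ∑ i, nodeVec n k i * f i = f k := by
  have := nodeVec_dotProduct ⟨k, hk⟩ (fun i : Fin n => f i)
  simpa [dotProduct] using this

/-- A vector is bounded by `b` at all nodes up to `T`. -/
def nodeBall (n : ℕ) (T b : ℝ) : Set (Fin n → ℝ) := {x | ∀ j : Fin n, (j : ℝ) ≤ T → |x j| ≤ b}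

theorem nodeBall_eq (n : ℕ) (T b : ℝ) :
    nodeBall n T b = ⋂ j : Fin n, ⋂ (_ : (j : ℝ) ≤ T), (fun x => x j) ⁻¹' Icc (-b) b := by
  ext x; simp [nodeBall, abs_le]

theorem measurableSet_nodeBall (n : ℕ) (T b : ℝ) : MeasurableSet (nodeBall n T b) := by
  rw [nodeBall_eq]
  exact MeasurableSet.iInter fun j => MeasurableSet.iInter fun _ =>
    (measurable_pi_apply j) measurableSet_Icc

theorem convex_nodeBall (n : ℕ) (T b : ℝ) : Convex ℝ (nodeBall n T b) := by
  rw [nodeBall_eq]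
  exact convex_iInter fun j => convex_iInter fun _ =>
    (convex_Icc (-b) b).linear_preimage (LinearMap.proj (R := ℝ) (φ := fun _ : Fin n => ℝ) j)

theorem neg_mem_nodeBall {n : ℕ} {T b : ℝ} {x : Fin n → ℝ} (hx : x ∈ nodeBall n T b) :
    -x ∈ nodeBall n T b := fun j hj => by simpa using hx j hj

theorem sum_dyadic_rpow_le {ρ y : ℝ} (hρ : 0 < ρ) (hy : 0 < y) (n : ℕ) :
    ∑ i ∈ (Finset.range n).filter (fun i => 2 ^ i * y ≤ 1), (2 ^ i * y) ^ ρ ≤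
      (1 - 2 ^ (-ρ))⁻¹ := by
  have h2 : (2:ℝ) ^ (-ρ) < 1 := Real.rpow_lt_one_of_one_lt_of_neg (by norm_num) (by linarith)
  set K : ℝ := (1 - 2 ^ (-ρ))⁻¹ with hK
  have hK0 : 0 < K := inv_pos.2 (by linarith)
  set F : ℕ → ℝ := fun i => min (2 ^ i * (y / 2)) 1 ^ ρ with hF
  have hF0 : ∀ i, 0 ≤ F i := fun i => by positivity
  have hFm : ∀ i, F i ≤ F (i + 1) := fun i => by
    simp only [hF]; gcongr <;> norm_num
  have hF1 : ∀ i, F i ≤ 1 := fun i => Real.rpow_le_one (by positivity) (min_le_right _ _) hρ.le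
  have hterm : ∀ i : ℕ, 2 ^ i * y ≤ 1 → (2 ^ i * y) ^ ρ ≤ K * (F (i + 1) - F i) := fun i hi => by
    have e1 : F (i + 1) = (2 ^ i * y) ^ ρ := by
      simp only [hF]; rw [min_eq_left (by rw [pow_succ]; linarith)]; ring_nf
    have e2 : F i = (2 ^ i * y) ^ ρ * 2 ^ (-ρ) := by
      simp only [hF]
      rw [min_eq_left (by nlinarith [(by positivity : 0 < 2 ^ i * y)]), Real.rpow_neg (by norm_num),
        ← Real.inv_rpow (by norm_num), ← Real.mul_rpow (by positivity) (by norm_num)]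
      ring_nf
    rw [e1, e2, hK]
    have : 1 - (2:ℝ) ^ (-ρ) ≠ 0 := by linarith
    apply le_of_eq
    field_simp
  calc _ ≤ ∑ i ∈ (Finset.range n).filter (fun i => 2 ^ i * y ≤ 1), K * (F (i + 1) - F i) :=
        Finset.sum_le_sum fun i hi => hterm i (Finset.mem_filter.1 hi).2
    _ ≤ ∑ i ∈ Finset.range n, K * (F (i + 1) - F i) :=
        Finset.sum_le_sum_of_subset_of_nonneg (Finset.filter_subset _ _) fun i _ _ =>
          mul_nonneg hK0.le (sub_nonneg.2 (hFm i))
    _ = K * (F n - F 0) := by rw [← Finset.mul_sum, Finset.sum_range_sub]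
    _ ≤ K * 1 := by gcongr; linarith [hF1 n, hF0 0]
    _ = K := mul_one K

/-- The vector of a strip in the binary chaining of the integers: the increment from
`2 ^ (i + 1) * m` to `2 ^ i * (2 * m + 1)`. -/
def chainVec (n : ℕ) (p : ℕ × ℕ) : Fin n → ℝ :=
  nodeVec n (2 ^ p.1 * (2 * p.2 + 1)) - if p.2 = 0 then 0 else nodeVec n (2 ^ (p.1 + 1) * p.2)

/-- The strips used up to `T`. -/
noncomputable def chainIndex (n : ℕ) (T : ℝ) : Finset (ℕ × ℕ) :=
  (Finset.range n ×ˢ Finset.range n).filter fun p =>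
    2 ^ p.1 * (2 * p.2 + 1) < n ∧ (2:ℝ) ^ p.1 * (2 * p.2 + 1) ≤ T

theorem mem_chainIndex {n : ℕ} {T : ℝ} {i m : ℕ} (h : 2 ^ i * (2 * m + 1) < n)
    (hT : (2:ℝ) ^ i * (2 * m + 1) ≤ T) : (i, m) ∈ chainIndex n T := by
  simp only [chainIndex, Finset.mem_filter, Finset.mem_product, Finset.mem_range]
  have h1 : i < 2 ^ i := Nat.lt_two_pow_self
  have h2 : 1 ≤ 2 ^ i := Nat.one_le_two_pow
  exact ⟨⟨by nlinarith, by nlinarith⟩, h, hT⟩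

theorem abs_le_of_chain {n : ℕ} {T c b : ℝ} (hc : 0 ≤ c) (hb : 0 < b) {x : Fin n → ℝ}
    (hx : ∀ p ∈ chainIndex n T, |chainVec n p ⬝ᵥ x| ≤ c * (2 * p.2 + 1 : ℝ) ^ (-b)) (k : Fin n)
    (hk : 1 ≤ (k : ℕ)) (hkT : (k : ℝ) ≤ T) : |x k| ≤ c * (1 + 2 ^ (-b) / (1 - 2 ^ (-b))) := by
  set D : ℝ := 2 ^ (-b) / (1 - 2 ^ (-b)) with hD
  have h2 : (2:ℝ) ^ (-b) < 1 := Real.rpow_lt_one_of_one_lt_of_neg (by norm_num) (by linarith)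
  have h2' : (0:ℝ) < 2 ^ (-b) := by positivity
  have hD0 : 0 < D := div_pos h2' (by linarith)
  have hD1 : (1 + D) * 2 ^ (-b) = D := by
    rw [hD]; have : 1 - (2:ℝ) ^ (-b) ≠ 0 := by linarith
    field_simp; ring
  have key : ∀ m : ℕ, 1 ≤ m → ∀ i : ℕ, 2 ^ i * m < n → (2:ℝ) ^ i * m ≤ T →
      |nodeVec n (2 ^ i * m) ⬝ᵥ x| ≤ c * (1 + D - D * (m:ℝ) ^ (-b)) := by
    intro m
    induction m using Nat.strong_induction_on with
    | _ m ih =>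
      intro hm i hn hT
      rcases Nat.even_or_odd' m with ⟨m', rfl | rfl⟩
      · have hm' : 1 ≤ m' := by omega
        have e : 2 ^ i * (2 * m') = 2 ^ (i + 1) * m' := by ring
        have := ih m' (by omega) hm' (i + 1) (e ▸ hn) (by push_cast at hT; rw [pow_succ]; linarith)
        rw [e]
        refine this.trans ?_
        have h3 : ((2 * m' : ℕ) : ℝ) ^ (-b) ≤ (m' : ℝ) ^ (-b) :=
          Real.rpow_le_rpow_of_nonpos (by exact_mod_cast hm')
              (by push_cast; linarith [(Nat.cast_nonneg m' : (0:ℝ) ≤ m')]) (by linarith)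
        gcongr
      · rcases Nat.eq_zero_or_pos m' with rfl | hm'
        · have h3 := hx (i, 0) (mem_chainIndex hn (by push_cast at hT; simpa using hT))
          simpa [chainVec] using h3
        · have h3 := hx (i, m') (mem_chainIndex hn (by exact_mod_cast hT))
          have hle : 2 ^ (i + 1) * m' ≤ 2 ^ i * (2 * m' + 1) := by
            rw [pow_succ, mul_assoc]; gcongr; omega
          have hle' : (2:ℝ) ^ (i + 1) * m' ≤ 2 ^ i * ((2 * m' + 1 : ℕ) : ℝ) := by exact_mod_cast hle
          have h4 := ih m' (by omega) hm' (i + 1) (hle.trans_lt hn) (hle'.trans hT)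
          simp only [chainVec, hm'.ne', if_false, sub_dotProduct] at h3
          have h5 : ((2 * m' + 1 : ℕ) : ℝ) ^ (-b) ≤ 2 ^ (-b) * (m' : ℝ) ^ (-b) := by
            rw [← Real.mul_rpow (by norm_num) (by positivity)]
            exact Real.rpow_le_rpow_of_nonpos (by positivity) (by push_cast; linarith) (by linarith)
          push_cast at h5 ⊢
          have h6 : (1 + D) * (2 * (m':ℝ) + 1) ^ (-b) ≤ D * (m':ℝ) ^ (-b) := by
            calc _ ≤ (1 + D) * (2 ^ (-b) * (m' : ℝ) ^ (-b)) := by gcongr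
              _ = _ := by rw [← mul_assoc, hD1]
          have h7 := abs_add_le (nodeVec n (2 ^ i * (2 * m' + 1)) ⬝ᵥ x - nodeVec n
              (2 ^ (i + 1) * m') ⬝ᵥ x)
            (nodeVec n (2 ^ (i + 1) * m') ⬝ᵥ x)
          rw [sub_add_cancel] at h7
          nlinarith [mul_le_mul_of_nonneg_left h6 hc]
  have := key k hk 0 (by simp) (by simpa using hkT)
  rw [pow_zero, one_mul, nodeVec_dotProduct] at this
  refine this.trans ?_
  have : 0 ≤ D * (k:ℝ) ^ (-b) := by positivity
  gcongr
  linarith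

theorem exists_chainVec_quadForm_le {α γ p : ℝ} (hP : GFParam α γ) (hp : α ≤ p) (hp0 : 0 ≤ p)
    (hp1 : p ≤ 1) (hpa : p < α + 1 / 2) : ∃ D : ℝ, 0 < D ∧ ∀ n i m : ℕ, 2 ^ i * (2 * m + 1) < n →
      chainVec n (i, m) ⬝ᵥ (gfMat α γ univ n).mulVec (chainVec n (i, m)) ≤
        (D * ((2 ^ i * (2 * m + 1) : ℝ) ^ (α - γ / 2 + 1 / 2) * (2 * m + 1 : ℝ) ^ (-p))) ^ 2 := by
  obtain ⟨C0, hC0, h0⟩ := exists_gfEnergy_le hP.mem hP.abs_le hP.lt hP.lt'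
  obtain ⟨C1, hC1, h1⟩ := exists_gfEnergy_increment_le hP.mem hP.abs_le hP.lt' hp hp0 hp1 hpa
  set H := α - γ / 2 + 1 / 2 with hHdef
  have hH0 : 0 < H := by have := hP.lt; rw [hHdef]; linarith
  set D : ℝ := 1 + (C0 + 4 * C1) with hD
  have hDD : C0 + 4 * C1 ≤ D ^ 2 := by rw [hD]; nlinarith
  refine ⟨D, by positivity, fun n i m hn => ?_⟩
  have hk0 : (0:ℝ) < 2 ^ i * (2 * m + 1) := by positivity
  set k : ℝ := 2 ^ i * (2 * m + 1) with hk
  have hsq : (k ^ H * (2 * m + 1 : ℝ) ^ (-p)) ^ 2 = k ^ (2 * H) * (2 * m + 1 : ℝ) ^ (-(2 * p)) := by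
    have hm : (0:ℝ) ≤ 2 * m + 1 := by positivity
    rw [mul_pow, ← Real.rpow_natCast, ← Real.rpow_natCast, ← Real.rpow_mul hk0.le,
        ← Real.rpow_mul hm]
    push_cast; ring_nf
  rw [mul_pow, hsq]
  rcases Nat.eq_zero_or_pos m with rfl | hm
  · have hle := h0 k hk0
    refine (gfMat_quadForm_le hP (f := gfKer α k) (by positivity) (fun u => ?_) hle).trans ?_
    · simp only [chainVec, if_true, sub_zero]
      rw [sum_nodeVec_mul hn (fun j => gfKer α (j:ℝ) u), hk]
      norm_num
    · norm_num
      gcongr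
      linarith
  · have hmr : (1:ℝ) ≤ m := by exact_mod_cast hm
    set s : ℝ := 2 ^ (i + 1) * m with hs
    have hs0 : 0 < s := by positivity
    have hsk : s + 2 ^ i = k := by rw [hs, hk]; ring
    have h2i : (0:ℝ) < 2 ^ i := by positivity
    have his : (2:ℝ) ^ i ≤ s := by rw [hs, pow_succ]; nlinarith
    have hle := h1 s (2 ^ i) hs0 (by positivity) his
    rw [hsk] at hle
    refine (gfMat_quadForm_le hP (f := fun u => gfKer α k u - gfKer α s u) (by positivity)
      (fun u => ?_) hle).trans ?_
    · simp only [chainVec, hm.ne', if_false, Pi.sub_apply, sub_mul, Finset.sum_sub_distrib]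
      rw [sum_nodeVec_mul hn (fun j => gfKer α (j:ℝ) u), sum_nodeVec_mul
        ((show 2 ^ (i + 1) * m ≤ 2 ^ i * (2 * m + 1) by
          rw [pow_succ, mul_assoc]; gcongr; omega).trans_lt hn) (fun j => gfKer α (j:ℝ) u), hk, hs]
      push_cast; rfl
    · have e1 : s ^ (2 * H - 2 * p) ≤ 4 * k ^ (2 * H - 2 * p) := by
        rcases le_total 0 (2 * H - 2 * p) with h | h
        · have : s ^ (2 * H - 2 * p) ≤ k ^ (2 * H - 2 * p) :=
            Real.rpow_le_rpow hs0.le (by linarith) h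
          have : 0 < k ^ (2 * H - 2 * p) := by positivity
          linarith
        · calc s ^ (2 * H - 2 * p) ≤ (2⁻¹ * k) ^ (2 * H - 2 * p) :=
                Real.rpow_le_rpow_of_nonpos (by positivity) (by linarith) h
            _ = 2 ^ (-(2 * H - 2 * p)) * k ^ (2 * H - 2 * p) := by
                rw [Real.mul_rpow (by norm_num) hk0.le, Real.inv_rpow (by norm_num),
                  Real.rpow_neg (by norm_num)]
            _ ≤ 2 ^ (2:ℝ) * k ^ (2 * H - 2 * p) := by
                gcongr
                · norm_num
                · linarith
            _ = _ := by norm_num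
      have e2 : k ^ (2 * H - 2 * p) * ((2:ℝ) ^ i) ^ (2 * p) =
          k ^ (2 * H) * (2 * m + 1 : ℝ) ^ (-(2 * p)) := by
        rw [Real.rpow_sub hk0, Real.rpow_neg (by positivity), hk,
          Real.mul_rpow (by positivity) (by positivity) (z := 2 * p)]
        field_simp
      rw [← e2]
      calc C1 * (s ^ (2 * H - 2 * p) * (2 ^ i) ^ (2 * p))
          ≤ C1 * (4 * k ^ (2 * H - 2 * p) * (2 ^ i) ^ (2 * p)) := by gcongr
        _ = (4 * C1) * (k ^ (2 * H - 2 * p) * (2 ^ i) ^ (2 * p)) := by ring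
        _ ≤ _ := by gcongr; linarith

/-- Small ball lower bound for the values at the nodes. -/
theorem exists_nodeBall_ge {α γ r : ℝ} (hP : GFParam α γ) (hr : 0 < r) (hr1 : r < 1)
    (hra : r < α + 1 / 2) : ∃ C : ℝ, 0 < C ∧ ∀ (n : ℕ) (μ : Measure (Fin n → ℝ)),
      IsGaussLaw μ (gfMat α γ univ n) → ∀ T ε : ℝ, 0 < T → 0 < ε →
      ENNReal.ofReal (rexp (-(C * ε ^ (-(1 / r))))) ≤
        μ (nodeBall n T (ε * T ^ (α - γ / 2 + 1 / 2))) := by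
  have hα1 : α < 1 := by have := hP.lt'; have := hP.mem.2; linarith
  set p : ℝ := (max r α + min 1 (α + 1 / 2)) / 2 with hp
  have hlt : max r α < min 1 (α + 1 / 2) :=
    max_lt (lt_min hr1 hra) (lt_min hα1 (by linarith))
  have hp1 : r < p := by have := le_max_left r α; rw [hp]; linarith
  have hp2 : α < p := by have := le_max_right r α; rw [hp]; linarith
  have hp3 : p < 1 := by have := min_le_left 1 (α + 1/2); rw [hp]; linarith
  have hp4 : p < α + 1/2 := by have := min_le_right 1 (α + 1/2); rw [hp]; linarith
  obtain ⟨D, hD, hvar⟩ := exists_chainVec_quadForm_le hP hp2.le (hr.le.trans hp1.le) hp3.le hp4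
  set H := α - γ / 2 + 1 / 2 with hHdef
  have hH0 : 0 < H := by have := hP.lt; rw [hHdef]; linarith
  set b : ℝ := (p - r) / 2 with hb
  have hb0 : 0 < b := by rw [hb]; linarith
  set q : ℝ := 1 / r with hq
  have hq0 : 0 < q := by positivity
  set e : ℝ := (p - b) * q with he
  have he1 : 1 < e := by
    rw [he, hb, hq, mul_one_div, lt_div_iff₀ hr]; linarith
  obtain ⟨Cg, hCg, hg⟩ := exists_gaussianReal_smallBall hq0
  set A : ℝ := 1 + 2 ^ (-b) / (1 - 2 ^ (-b)) with hA
  have h2 : (2:ℝ) ^ (-b) < 1 := Real.rpow_lt_one_of_one_lt_of_neg (by norm_num) (by linarith)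
  have hA0 : 0 < A := by
    have : 0 < 2 ^ (-b) / (1 - (2:ℝ) ^ (-b)) := div_pos (by positivity) (by linarith)
    positivity
  set G : ℝ := (1 - 2 ^ (-(H * q)))⁻¹ with hG
  have hG0 : 0 < G := inv_pos.2 (by
    have : (2:ℝ) ^ (-(H * q)) < 1 := Real.rpow_lt_one_of_one_lt_of_neg (by norm_num) (by
      have : 0 < H * q := by positivity
      linarith)
    linarith)
  have hsum : Summable fun m : ℕ => ((m:ℝ) + 1) ^ (-e) := by
    have := (summable_nat_add_iff 1).2 (Real.summable_nat_rpow.2 (by linarith : -e < -1))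
    simpa using this
  set Z : ℝ := ∑' m : ℕ, ((m:ℝ) + 1) ^ (-e) with hZ
  have hZ0 : 0 ≤ Z := tsum_nonneg fun m => by positivity
  refine ⟨Cg * ((D * A) ^ q * (G * Z)) + Cg, by positivity, fun n μ hμ T ε hT hε => ?_⟩
  have hTH : 0 < T ^ H := by positivity
  have hPSD := gfMat_posSemidef hP univ n
  set K : Set (Fin n → ℝ) := {x | |nodeVec n 0 ⬝ᵥ x| ≤ ε * T ^ H} with hK
  have hKm : MeasurableSet K := measurableSet_le (by fun_prop) (by fun_prop)
  have hKc : Convex ℝ K := by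
    intro x hx y hy a c ha hc hac
    simp only [hK, mem_ofPred_eq] at hx hy ⊢
    rw [dotProduct_add, dotProduct_smul, dotProduct_smul, smul_eq_mul, smul_eq_mul]
    refine (abs_add_le _ _).trans ?_
    rw [abs_mul, abs_mul, abs_of_nonneg ha, abs_of_nonneg hc]
    calc _ ≤ a * (ε * T ^ H) + c * (ε * T ^ H) := by gcongr
      _ = _ := by rw [← add_mul, hac, one_mul]
  have hKs : ∀ x ∈ K, -x ∈ K := fun x hx => by
    simp only [hK, mem_ofPred_eq, dotProduct_neg, abs_neg] at hx ⊢; exact hx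
  have hK0 : ENNReal.ofReal (rexp (-(Cg * ε ^ (-q)))) ≤ μ K := by
    have h1 : nodeVec n 0 ⬝ᵥ (gfMat α γ univ n).mulVec (nodeVec n 0) ≤ (T ^ H) ^ 2 := by
      refine (gfMat_quadForm_le hP (f := fun _ => 0) (c := 0) le_rfl (fun u => ?_) ?_).trans
          (sq_nonneg _)
      · rcases Nat.eq_zero_or_pos n with rfl | hn
        · simp
        · rw [sum_nodeVec_mul hn (fun j => gfKer α (j:ℝ) u), Nat.cast_zero, gfKer_zero]
      · simp [gfEnergy]
    have h2 := hμ.le_measure_abs_le hg (nodeVec n 0) hTH (by positivity : 0 < ε * T ^ H) h1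
    rw [show T ^ H / (ε * T ^ H) = ε⁻¹ by field_simp, Real.inv_rpow hε.le,
        ← Real.rpow_neg hε.le] at h2
    exact h2
  set σ : ℕ × ℕ → ℝ := fun p' => D * ((2 ^ p'.1 * (2 * p'.2 + 1) : ℝ) ^ H * (2 * p'.2 +
      1 : ℝ) ^ (-p)) with hσ
  set c : ℝ := ε * T ^ H / A with hc
  have hc0 : 0 < c := by positivity
  set B : ℕ × ℕ → ℝ := fun p' => c * (2 * p'.2 + 1 : ℝ) ^ (-b) with hB
  have hsid := hμ.sidak_exp hg hPSD hKm hKc hKs (chainIndex n T) (chainVec n) (σ := σ) (b := B)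
    (fun i _ => by positivity) (fun i _ => by positivity)
    (fun i hi => hvar n i.1 i.2 (Finset.mem_filter.1 hi).2.1)
  have hcost : ∑ i ∈ chainIndex n T, (σ i / B i) ^ q ≤ (D * A) ^ q * (G * Z) * ε ^ (-q) := by
    have hterm : ∀ i m : ℕ, (σ (i, m) / B (i, m)) ^ q = (D * A) ^ q * ε ^ (-q) *
        ((2 ^ i * ((2 * m + 1) / T) : ℝ) ^ (H * q) * (2 * m + 1 : ℝ) ^ (-e)) := fun i m => by
      have hm : (0:ℝ) < 2 * m + 1 := by positivity
      have e1 : σ (i, m) / B (i, m) = (D * A) * ε⁻¹ * ((2 ^ i * ((2 * m + 1) / T) : ℝ) ^ H *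
          (2 * m + 1 : ℝ) ^ (-(p - b))) := by
        simp only [hσ, hB, hc]
        rw [← mul_div_assoc, Real.div_rpow (by positivity) hT.le, neg_sub, sub_eq_add_neg b p,
          add_comm b, Real.rpow_add hm, Real.rpow_neg hm.le b]
        field_simp
      rw [e1, Real.mul_rpow (by positivity) (by positivity),
          Real.mul_rpow (by positivity) (by positivity),
        Real.mul_rpow (by positivity) (by positivity),
            Real.mul_rpow (by positivity) (by positivity),
        Real.inv_rpow hε.le, ← Real.rpow_neg hε.le, ← Real.rpow_mul (by positivity),
            ← Real.rpow_mul hm.le, he, neg_mul]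
    calc ∑ i ∈ chainIndex n T, (σ i / B i) ^ q
        ≤ ∑ i ∈ (Finset.range n ×ˢ Finset.range n).filter
            (fun p' => (2:ℝ) ^ p'.1 * ((2 * p'.2 + 1) / T) ≤ 1), (σ i / B i) ^ q := by
          refine Finset.sum_le_sum_of_subset_of_nonneg (fun p' hp' => ?_) fun i _ _ => by positivity
          simp only [chainIndex, Finset.mem_filter] at hp' ⊢
          exact ⟨hp'.1, by rw [← mul_div_assoc, div_le_one hT]; exact hp'.2.2⟩
      _ = ∑ m ∈ Finset.range n, ∑ i ∈ (Finset.range n).filter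
            (fun i => (2:ℝ) ^ i * ((2 * m + 1) / T) ≤ 1), (σ (i, m) / B (i, m)) ^ q := by
          rw [Finset.sum_filter, Finset.sum_product_right]
          exact Finset.sum_congr rfl fun m _ => (Finset.sum_filter _ _).symm
      _ ≤ ∑ m ∈ Finset.range n, (D * A) ^ q * ε ^ (-q) * (G * ((m:ℝ) + 1) ^ (-e)) := by
          refine Finset.sum_le_sum fun m _ => ?_
          simp only [hterm]
          rw [← Finset.mul_sum, ← Finset.sum_mul]
          have h3 : (2 * m + 1 : ℝ) ^ (-e) ≤ ((m:ℝ) + 1) ^ (-e) :=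
            Real.rpow_le_rpow_of_nonpos (by positivity)
                (by linarith [(Nat.cast_nonneg m : (0:ℝ) ≤ m)]) (by linarith)
          gcongr
          exact sum_dyadic_rpow_le (by positivity) (by positivity) n
      _ = (D * A) ^ q * ε ^ (-q) * (G * ∑ m ∈ Finset.range n, ((m:ℝ) + 1) ^ (-e)) := by
          rw [← Finset.mul_sum, ← Finset.mul_sum]
      _ ≤ (D * A) ^ q * ε ^ (-q) * (G * Z) := by
          gcongr
          exact hsum.sum_le_tsum _ fun m _ => by positivity
      _ = _ := by ring
  calc ENNReal.ofReal (rexp (-((Cg * ((D * A) ^ q * (G * Z)) + Cg) * ε ^ (-q))))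
      ≤ ENNReal.ofReal (rexp (-(Cg * ε ^ (-q)))) * ENNReal.ofReal
          (rexp (-(Cg * ∑ i ∈ chainIndex n T, (σ i / B i) ^ q))) := by
        rw [← ENNReal.ofReal_mul (Real.exp_pos _).le, ← Real.exp_add]
        apply ENNReal.ofReal_le_ofReal
        rw [Real.exp_le_exp]
        nlinarith [mul_le_mul_of_nonneg_left hcost hCg.le]
    _ ≤ _ := (mul_le_mul_left hK0 _).trans hsid
    _ ≤ _ := by
        refine measure_mono fun x hx j hj => ?_
        rcases Nat.eq_zero_or_pos (j:ℕ) with h0 | h0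
        · have h1 := hx.1
          rw [hK, mem_ofPred_eq, ← h0, nodeVec_dotProduct] at h1
          exact h1
        · have h1 := abs_le_of_chain hc0.le hb0 hx.2 j h0 hj
          refine h1.trans_eq ?_
          rw [← hA, hc]; field_simp

/-- Weight of the `j`-th node in the fractional integral of order `θ` up to time `s` of a step
function with mesh one. -/
noncomputable def rlWeight (θ s : ℝ) (j : ℕ) : ℝ :=
  (max (s - j) 0 ^ θ - max (s - (j + 1 : ℕ)) 0 ^ θ) / Gamma (θ + 1)

noncomputable def rlVec (θ s : ℝ) (n : ℕ) : Fin n → ℝ := fun j => rlWeight θ s j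

/-- Node values whose fractional integral stays within `b` up to time `T`. -/
def rlBall (n : ℕ) (θ T b : ℝ) : Set (Fin n → ℝ) := {x | ∀ s ∈ Icc 0 T, |rlVec θ s n ⬝ᵥ x| ≤ b}

theorem measurableSet_rlBall (n : ℕ) (θ T b : ℝ) : MeasurableSet (rlBall n θ T b) := by
  have : rlBall n θ T b = ⋂ s ∈ Icc 0 T, {x | |rlVec θ s n ⬝ᵥ x| ≤ b} := by
    ext x; simp [rlBall]
  rw [this]
  refine IsClosed.measurableSet (isClosed_biInter fun s _ => isClosed_le ?_ continuous_const)
  simp only [dotProduct]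
  fun_prop

theorem combo_mem_rlBall {n : ℕ} {θ T b b' a c : ℝ} (ha : 0 ≤ a) (hc : 0 ≤ c) {x y : Fin n → ℝ}
    (hx : x ∈ rlBall n θ T b) (hy : y ∈ rlBall n θ T b') :
    a • x + c • y ∈ rlBall n θ T (a * b + c * b') := fun s hs => by
  rw [dotProduct_add, dotProduct_smul, dotProduct_smul, smul_eq_mul, smul_eq_mul]
  refine (abs_add_le _ _).trans ?_
  rw [abs_mul, abs_mul, abs_of_nonneg ha, abs_of_nonneg hc]
  have h1 := hx s hs
  have h2 := hy s hs
  gcongr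

theorem add_mem_rlBall {n : ℕ} {θ T b b' : ℝ} {x y : Fin n → ℝ}
    (hx : x ∈ rlBall n θ T b) (hy : y ∈ rlBall n θ T b') : x + y ∈ rlBall n θ T (b + b') := by
  simpa using combo_mem_rlBall zero_le_one zero_le_one hx hy

theorem convex_rlBall (n : ℕ) (θ T b : ℝ) : Convex ℝ (rlBall n θ T b) :=
  fun x hx y hy a c ha hc hac => by
    have := combo_mem_rlBall ha hc hx hy
    rwa [← add_mul, hac, one_mul] at this

theorem neg_mem_rlBall {n : ℕ} {θ T b : ℝ} {x : Fin n → ℝ} (hx : x ∈ rlBall n θ T b) :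
    -x ∈ rlBall n θ T b := fun s hs => by
  rw [dotProduct_neg, abs_neg]; exact hx s hs

theorem rlBall_mono {n : ℕ} {θ T b b' : ℝ} (h : b ≤ b') : rlBall n θ T b ⊆ rlBall n θ T b' :=
  fun _ hx s hs => (hx s hs).trans h

theorem rlWeight_nonneg {θ : ℝ} (hθ : 0 < θ) (s : ℝ) (j : ℕ) : 0 ≤ rlWeight θ s j := by
  refine div_nonneg (sub_nonneg.2 ?_) (Gamma_pos_of_pos (by linarith)).le
  refine Real.rpow_le_rpow (le_max_right _ _) (max_le_max_right _ ?_) hθ.le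
  push_cast; linarith

theorem rlWeight_eq_zero {θ s : ℝ} {j : ℕ} (h : s ≤ j) : rlWeight θ s j = 0 := by
  rw [rlWeight, max_eq_right (by linarith), max_eq_right (by push_cast; linarith), sub_self,
      zero_div]

theorem sum_rlWeight_le {θ s : ℝ} (hθ : 0 < θ) (hs : 0 ≤ s) (n : ℕ) :
    ∑ j : Fin n, rlVec θ s n j ≤ s ^ θ / Gamma (θ + 1) := by
  simp only [rlVec, rlWeight]
  rw [Fin.sum_univ_eq_sum_range
    (fun j => (max (s - j) 0 ^ θ - max (s - (j + 1 : ℕ)) 0 ^ θ) / Gamma (θ + 1)) n,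
        ← Finset.sum_div,
    Finset.sum_range_sub' (fun j : ℕ => max (s - j) 0 ^ θ) n]
  have h1 : 0 < Gamma (θ + 1) := Gamma_pos_of_pos (by linarith)
  have h2 : 0 ≤ max (s - n) 0 ^ θ := by positivity
  gcongr
  simp only [Nat.cast_zero, sub_zero, max_eq_left hs]
  linarith

theorem Matrix.PosSemidef.dotProduct_mulVec_le {n : ℕ} {S : Matrix (Fin n) (Fin n) ℝ}
    (hS : S.PosSemidef) {w : Fin n → ℝ} (hw : ∀ i, 0 ≤ w i) {M : ℝ}
        (hM : ∀ i, w i ≠ 0 → S i i ≤ M) :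
    w ⬝ᵥ S.mulVec w ≤ (∑ i, w i) ^ 2 * M := by
  have h0 : ∀ i j, 0 ≤ S i i + S j j - S i j - S j i := fun i j => by
    have := hS.dotProduct_mulVec_nonneg (Pi.single i 1 - Pi.single j 1)
    simp only [star_trivial, Matrix.mulVec_sub, sub_dotProduct, dotProduct_sub,
      Matrix.mulVec_single_one, single_one_dotProduct, Matrix.col_apply] at this
    linarith
  have h1 : 0 ≤ ∑ i, ∑ j, w i * w j * (S i i + S j j - S i j - S j i) :=
    Finset.sum_nonneg fun i _ => Finset.sum_nonneg fun j _ =>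
      mul_nonneg (mul_nonneg (hw i) (hw j)) (h0 i j)
  have e1 : ∑ i, ∑ j, w i * w j * (S i i + S j j - S i j - S j i) =
      2 * ((∑ i, w i) * ∑ i, w i * S i i) - 2 * (w ⬝ᵥ S.mulVec w) := by
    have a1 : ∑ i, ∑ j, w i * w j * S i j = w ⬝ᵥ S.mulVec w := by
      simp only [dotProduct, Matrix.mulVec, Finset.mul_sum]
      exact Finset.sum_congr rfl fun i _ => Finset.sum_congr rfl fun j _ => by ring
    have a2 : ∑ i, ∑ j, w i * w j * S j i = w ⬝ᵥ S.mulVec w := by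
      rw [Finset.sum_comm, ← a1]
      exact Finset.sum_congr rfl fun i _ => Finset.sum_congr rfl fun j _ => by ring
    have a3 : ∑ i, ∑ j, w i * w j * S i i = (∑ i, w i) * ∑ i, w i * S i i := by
      rw [Finset.sum_mul_sum, Finset.sum_comm]
      exact Finset.sum_congr rfl fun i _ => Finset.sum_congr rfl fun j _ => by ring
    have a4 : ∑ i, ∑ j, w i * w j * S j j = (∑ i, w i) * ∑ i, w i * S i i := by
      rw [Finset.sum_mul_sum]
      exact Finset.sum_congr rfl fun i _ => Finset.sum_congr rfl fun j _ => by ring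
    simp only [mul_sub, mul_add, Finset.sum_sub_distrib, Finset.sum_add_distrib]
    rw [a1, a2, a3, a4]; ring
  have h2 : ∑ i, w i * S i i ≤ ∑ i, w i * M := Finset.sum_le_sum fun i _ => by
    rcases eq_or_ne (w i) 0 with h | h
    · simp [h]
    · exact mul_le_mul_of_nonneg_left (hM i h) (hw i)
  rw [← Finset.sum_mul] at h2
  have h3 : 0 ≤ ∑ i, w i := Finset.sum_nonneg fun i _ => hw i
  nlinarith [mul_le_mul_of_nonneg_left h2 h3]

theorem exists_rlVec_quadForm_le {α γ θ : ℝ} (hP : GFParam α γ) (hθ : 0 < θ) :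
    ∃ D : ℝ, 0 < D ∧ ∀ (n : ℕ) (s T : ℝ), s ∈ Icc 0 T →
      rlVec θ s n ⬝ᵥ (gfMat α γ univ n).mulVec (rlVec θ s n) ≤
        (D * T ^ (α - γ / 2 + 1 / 2 + θ)) ^ 2 := by
  obtain ⟨C, hC, h⟩ := exists_gfEnergy_le hP.mem hP.abs_le hP.lt hP.lt'
  set H := α - γ / 2 + 1 / 2 with hHdef
  have hH0 : 0 < H := by have := hP.lt; rw [hHdef]; linarith
  have hG : 0 < Gamma (θ + 1) := Gamma_pos_of_pos (by linarith)
  refine ⟨√C / Gamma (θ + 1), by positivity, fun n s T hs => ?_⟩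
  have hT : 0 ≤ T := hs.1.trans hs.2
  have hM : ∀ i : Fin n, rlVec θ s n i ≠ 0 → gfMat α γ univ n i i ≤ C * T ^ (2 * H) :=
      fun i hi => by
    have his : (i:ℝ) < s := not_le.1 fun hle => hi (rlWeight_eq_zero hle)
    have hb : gfEnergy γ univ (gfKer α (i:ℕ)) ≤ ENNReal.ofReal (C * T ^ (2 * H)) := by
      rcases Nat.eq_zero_or_pos (i:ℕ) with h0 | h0
      · rw [h0, Nat.cast_zero]; simp [gfEnergy, gfKer_zero]
      · refine (h _ (by exact_mod_cast h0)).trans (ENNReal.ofReal_le_ofReal ?_)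
        gcongr
        exact his.le.trans hs.2
    have := gfMat_quadForm_le hP (A := univ) (n := n) (l := nodeVec n i) (by positivity)
      (fun u => sum_nodeVec_mul i.2 (fun j => gfKer α (j:ℝ) u)) hb
    rw [nodeVec_dotProduct] at this
    refine le_trans (le_of_eq ?_) this
    have h2 : (nodeVec n i) ⬝ᵥ (gfMat α γ univ n) i = gfMat α γ univ n i i := nodeVec_dotProduct _ _
    rw [← h2, dotProduct_comm]; rfl
  refine ((gfMat_posSemidef hP univ n).dotProduct_mulVec_le (fun i => rlWeight_nonneg hθ s i)
      hM).trans ?_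
  have h1 := sum_rlWeight_le hθ hs.1 n
  have h0 : 0 ≤ ∑ j : Fin n, rlVec θ s n j := Finset.sum_nonneg fun i _ => rlWeight_nonneg hθ s i
  calc (∑ i, rlVec θ s n i) ^ 2 * (C * T ^ (2 * H))
      ≤ (T ^ θ / Gamma (θ + 1)) ^ 2 * (C * T ^ (2 * H)) := by
        gcongr
        refine h1.trans ?_
        gcongr
        exacts [hs.1, hs.2]
    _ = _ := by
        rw [Real.rpow_add_of_nonneg hT hH0.le hθ.le, mul_comm 2 H, Real.rpow_mul hT]
        rw [mul_pow, div_pow, div_pow, Real.sq_sqrt hC.le, mul_pow, Real.rpow_two]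
        ring

theorem rpow_add_sub_rpow_antitone {θ h z z' : ℝ} (hθ : 0 ≤ θ) (hθ1 : θ ≤ 1) (hh : 0 ≤ h)
    (hz : 0 ≤ z) (hzz : z ≤ z') : (z' + h) ^ θ - z' ^ θ ≤ (z + h) ^ θ - z ^ θ := by
  rcases (add_nonneg (sub_nonneg.2 hzz) hh).eq_or_lt with h0 | h0
  · have h1 : h = 0 := by linarith
    simp [h1]
  · have hc := (Real.concaveOn_rpow hθ hθ1).2
    set w := z' - z + h with hw
    have h1 := hc (x := z) hz (y := z' + h) (by simp only [mem_Ici]; linarith) (a := (z' - z) / w)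
      (b := h / w) (div_nonneg (by linarith) h0.le) (by positivity) (by field_simp; linarith)
    have h2 := hc (x := z) hz (y := z' + h) (by simp only [mem_Ici]; linarith) (a := h / w)
      (b := (z' - z) / w) (by positivity) (div_nonneg (by linarith) h0.le) (by field_simp; linarith)
    simp only [smul_eq_mul] at h1 h2
    have e1 : (z' - z) / w * z + h / w * (z' + h) = z + h := by
      field_simp; rw [hw]; ring
    have e2 : h / w * z + (z' - z) / w * (z' + h) = z' := by
      field_simp; rw [hw]; ring
    rw [e1] at h1
    rw [e2] at h2
    have e3 : (z' - z) / w + h / w = 1 := by field_simp; linarith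
    have e4 : (z' - z) / w = 1 - h / w := by linarith
    rw [e4] at h1 h2
    linarith

theorem abs_rlVec_sub_le_of_mem_nodeBall {n : ℕ} {θ T b s s' : ℝ} (hθ : 0 < θ) (hθ1 : θ ≤ 1)
    (hb : 0 ≤ b) (hss : s ≤ s') (hsT : s' ≤ T) {x : Fin n → ℝ} (hx : x ∈ nodeBall n T b) :
    |rlVec θ s' n ⬝ᵥ x - rlVec θ s n ⬝ᵥ x| ≤ 2 / Gamma (θ + 1) * b * (s' - s) ^ θ := by
  have hG : 0 < Gamma (θ + 1) := Gamma_pos_of_pos (by linarith)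
  set φ : ℝ → ℝ := fun v => max (s' - v) 0 ^ θ - max (s - v) 0 ^ θ with hφ
  have hmono : ∀ v v', v ≤ v' → v' ≤ s → φ v ≤ φ v' := fun v v' h1 h2 => by
    simp only [hφ]
    rw [max_eq_left (by linarith), max_eq_left (by linarith), max_eq_left (by linarith),
      max_eq_left (by linarith)]
    have := rpow_add_sub_rpow_antitone hθ.le hθ1 (sub_nonneg.2 hss) (sub_nonneg.2 h2)
      (by linarith : s - v' ≤ s - v)
    rwa [show s - v + (s' - s) = s' - v by ring, show s - v' + (s' - s) = s' - v' by ring] at this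
  have hanti : ∀ v v', v ≤ v' → s ≤ v → φ v' ≤ φ v := fun v v' h1 h2 => by
    simp only [hφ]
    rw [max_eq_right (by linarith : s - v ≤ 0), max_eq_right (by linarith : s - v' ≤ 0)]
    gcongr
  have hnn : ∀ v, 0 ≤ φ v := fun v => by
    simp only [hφ, sub_nonneg]; gcongr
  have hφs : φ s = (s' - s) ^ θ := by
    simp only [hφ, sub_self, max_self, Real.zero_rpow hθ.ne', sub_zero,
        max_eq_left (sub_nonneg.2 hss)]
  have hdec : ∀ v, φ v = φ (min v s) + φ (max v s) - φ s := fun v => by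
    rcases le_total v s with h | h
    · rw [min_eq_left h, max_eq_right h]; ring
    · rw [min_eq_right h, max_eq_left h]; ring
  set g : ℕ → ℝ := fun j => φ (min j s) - φ (max j s) with hg
  have hstep : ∀ j : ℕ, |φ j - φ (j + 1 : ℕ)| ≤ g (j + 1) - g j := fun j => by
    have h1 := hmono (min (j:ℝ) s) (min ((j + 1 : ℕ):ℝ) s)
        (min_le_min_right _ (by push_cast; linarith))
      (min_le_right _ _)
    have h2 := hanti (max (j:ℝ) s) (max ((j + 1 : ℕ):ℝ) s)
        (max_le_max_right _ (by push_cast; linarith))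
      (le_max_right _ _)
    rw [hdec j, hdec (j + 1 : ℕ), abs_le]
    constructor <;> linarith
  have htot : ∑ j : Fin n, |φ j - φ ((j + 1 : ℕ))| ≤ 2 * (s' - s) ^ θ := by
    rw [Fin.sum_univ_eq_sum_range (fun j => |φ j - φ ((j + 1 : ℕ))|) n]
    refine (Finset.sum_le_sum fun j _ => hstep j).trans ?_
    rw [Finset.sum_range_sub]
    have h1 := hmono (min (n:ℝ) s) s (min_le_right _ _) le_rfl
    have h2 := hanti s (max ((0:ℕ):ℝ) s) (le_max_right _ _) le_rfl
    have h3 := hnn (max n s)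
    have h4 := hnn (min ((0:ℕ):ℝ) s)
    simp only [hg]
    linarith
  rw [← sub_dotProduct]
  simp only [dotProduct]
  calc |∑ j, (rlVec θ s' n - rlVec θ s n) j * x j|
      ≤ ∑ j, |(rlVec θ s' n - rlVec θ s n) j * x j| := Finset.abs_sum_le_sum_abs _ _
    _ ≤ ∑ j : Fin n, |φ j - φ ((j + 1 : ℕ))| * (b / Gamma (θ + 1)) := by
        refine Finset.sum_le_sum fun j _ => ?_
        rcases le_or_gt (j:ℝ) T with h | h
        · have e : (rlVec θ s' n - rlVec θ s n) j = (φ j - φ ((j + 1 : ℕ))) / Gamma (θ + 1) := by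
            simp only [Pi.sub_apply, rlVec, rlWeight, hφ]; ring
          rw [e, abs_mul, abs_div, abs_of_pos hG, div_mul_eq_mul_div, mul_div_assoc]
          have := hx j h
          gcongr
        · have e : (rlVec θ s' n - rlVec θ s n) j = 0 := by
            simp only [Pi.sub_apply, rlVec]
            rw [rlWeight_eq_zero (by linarith), rlWeight_eq_zero (by linarith), sub_self]
          rw [e, zero_mul, abs_zero]; positivity
    _ ≤ 2 * (s' - s) ^ θ * (b / Gamma (θ + 1)) := by
        rw [← Finset.sum_mul]; gcongr
    _ = _ := by ring

theorem hasDerivAt_max_rpow {θ : ℝ} (hθ : 0 < θ) (s : ℝ) :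
    HasDerivAt (fun z : ℝ => max z 0 ^ (θ + 1)) ((θ + 1) * max s 0 ^ θ) s := by
  rcases lt_trichotomy s 0 with h | rfl | h
  · rw [max_eq_right h.le, Real.zero_rpow hθ.ne', mul_zero]
    refine (hasDerivAt_const s (0:ℝ)).congr_of_eventuallyEq ?_
    filter_upwards [Iio_mem_nhds h] with z hz
    rw [max_eq_right (le_of_lt hz), Real.zero_rpow (by linarith)]
  · rw [max_self, Real.zero_rpow hθ.ne', mul_zero]
    have h1 : HasDerivWithinAt (fun z : ℝ => max z 0 ^ (θ + 1)) 0 (Iic 0) 0 := by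
      refine (hasDerivWithinAt_const 0 _ (0:ℝ)).congr (fun z hz => ?_) ?_
      · rw [max_eq_right hz, Real.zero_rpow (by linarith)]
      · rw [max_self, Real.zero_rpow (by linarith)]
    have h2 : HasDerivWithinAt (fun z : ℝ => max z 0 ^ (θ + 1)) 0 (Ici 0) 0 := by
      have := (Real.hasDerivAt_rpow_const (x := 0) (p := θ + 1)
          (Or.inr (by linarith))).hasDerivWithinAt
        (s := Ici 0)
      rw [add_sub_cancel_right, Real.zero_rpow hθ.ne', mul_zero] at this
      refine this.congr (fun z hz => ?_) ?_
      · rw [max_eq_left hz]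
      · rw [max_self]
    have := h1.union h2
    rwa [Iic_union_Ici, hasDerivWithinAt_univ] at this
  · rw [max_eq_left h.le]
    have := Real.hasDerivAt_rpow_const (x := s) (p := θ + 1) (Or.inl h.ne')
    rw [add_sub_cancel_right] at this
    refine this.congr_of_eventuallyEq ?_
    filter_upwards [Ioi_mem_nhds h] with z hz
    rw [max_eq_left (le_of_lt hz)]

theorem hasDerivAt_rlVec_dotProduct {n : ℕ} {θ : ℝ} (hθ : 0 < θ) (x : Fin n → ℝ) (s : ℝ) :
    HasDerivAt (fun s => rlVec (θ + 1) s n ⬝ᵥ x) (rlVec θ s n ⬝ᵥ x) s := by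
  simp only [dotProduct]
  refine HasDerivAt.fun_sum fun j _ => HasDerivAt.mul_const ?_ _
  have h1 := (hasDerivAt_max_rpow hθ (s - (j:ℕ))).comp s ((hasDerivAt_id s).sub_const ((j:ℕ):ℝ))
  have h2 := (hasDerivAt_max_rpow hθ (s - (j + 1 : ℕ))).comp s
      ((hasDerivAt_id s).sub_const ((j + 1 : ℕ):ℝ))
  have h3 := (h1.sub h2).div_const (Gamma (θ + 1 + 1))
  have hG : 0 < Gamma (θ + 1) := Gamma_pos_of_pos (by linarith)
  have e : ((θ + 1) * max (s - (j:ℕ)) 0 ^ θ * 1 - (θ + 1) * max (s - (j + 1 : ℕ)) 0 ^ θ * 1) /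
      Gamma (θ + 1 + 1) = rlVec θ s n j := by
    rw [Gamma_add_one (by linarith : θ + 1 ≠ 0)]
    simp only [rlVec, rlWeight]
    field_simp
  rw [e] at h3
  exact h3

theorem abs_rlVec_sub_le_of_mem_rlBall {n : ℕ} {θ T b s s' : ℝ} (hθ : 0 < θ)
    (hs : 0 ≤ s) (hss : s ≤ s') (hsT : s' ≤ T) {x : Fin n → ℝ} (hx : x ∈ rlBall n θ T b) :
    |rlVec (θ + 1) s' n ⬝ᵥ x - rlVec (θ + 1) s n ⬝ᵥ x| ≤ 1 * b * (s' - s) ^ (1:ℝ) := by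
  have := (convex_Icc s s').norm_image_sub_le_of_norm_hasDerivWithin_le
    (f := fun s => rlVec (θ + 1) s n ⬝ᵥ x) (C := b)
    (fun v _ => (hasDerivAt_rlVec_dotProduct hθ x v).hasDerivWithinAt)
    (fun v hv => hx v ⟨hs.trans hv.1, hv.2.trans hsT⟩) (left_mem_Icc.2 hss) (right_mem_Icc.2 hss)
  rwa [Real.norm_eq_abs, Real.norm_eq_abs, abs_of_nonneg (sub_nonneg.2 hss), ← one_mul b,
    ← Real.rpow_one (s' - s)] at this

theorem exists_rlBall_ge_of_increment {α γ θ σ r κ c r' : ℝ} (hP : GFParam α γ) (hθ : 0 < θ)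
    (hσ : 0 < σ) (hr : 0 < r) (hκ : κ + σ = α - γ / 2 + 1 / 2 + θ) (hc : 0 ≤ c)
    (Z : ∀ n : ℕ, ℝ → ℝ → Set (Fin n → ℝ)) (hZm : ∀ n T b, MeasurableSet (Z n T b))
    (hZc : ∀ n T b, Convex ℝ (Z n T b)) (hZs : ∀ n T b, ∀ x ∈ Z n T b, -x ∈ Z n T b)
    (hinc : ∀ n T b s s' x, 0 ≤ b → 0 ≤ s → s ≤ s' → s' ≤ T → x ∈ Z n T b →
      |rlVec θ s' n ⬝ᵥ x - rlVec θ s n ⬝ᵥ x| ≤ c * b * (s' - s) ^ σ)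
    (hball : ∃ C : ℝ, 0 < C ∧ ∀ (n : ℕ) (μ : Measure (Fin n → ℝ)),
      IsGaussLaw μ (gfMat α γ univ n) → ∀ T ε : ℝ, 0 < T → 0 < ε → ε ≤ 1 →
      ENNReal.ofReal (rexp (-(C * ε ^ (-(1 / r))))) ≤ μ (Z n T (ε * T ^ κ)))
    (hr' : 0 < r') (hrr : r' < r + σ) :
    ∃ C : ℝ, 0 < C ∧ ∀ (n : ℕ) (μ : Measure (Fin n → ℝ)),
      IsGaussLaw μ (gfMat α γ univ n) → ∀ T ε : ℝ, 0 < T → 0 < ε → ε ≤ 1 →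
      ENNReal.ofReal (rexp (-(C * ε ^ (-(1 / r'))))) ≤
        μ (rlBall n θ T (ε * T ^ (α - γ / 2 + 1 / 2 + θ))) := by
  obtain ⟨C, hC, hball⟩ := hball
  obtain ⟨D, hD, hvar⟩ := exists_rlVec_quadForm_le hP hθ
  set ρ : ℝ := 1 / (r + σ) with hρ
  have hρ0 : 0 < ρ := by positivity
  set e : ℝ := 1 / r' - ρ with he
  have he0 : 0 < e := by
    rw [he, hρ, sub_pos]; exact one_div_lt_one_div_of_lt hr' hrr
  obtain ⟨Cg, hCg, hg⟩ := exists_gaussianReal_smallBall he0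
  set c' : ℝ := 2 * c + 2 ^ σ with hc'
  have h2σ : (0:ℝ) < 2 ^ σ := by positivity
  have hc'0 : 0 < c' := by positivity
  refine ⟨C * c' ^ (1 / r) + Cg * (3 * (2 * D) ^ e), by positivity, fun n μ hμ T ε hT hε hε1 => ?_⟩
  set Q : ℝ := α - γ / 2 + 1 / 2 + θ with hQ
  set m : ℕ := ⌈ε ^ (-ρ)⌉₊ with hm
  have hερ : 1 ≤ ε ^ (-ρ) := Real.one_le_rpow_of_pos_of_le_one_of_nonpos hε hε1 (by linarith)
  have hm1 : ε ^ (-ρ) ≤ m := Nat.le_ceil _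
  have hm2 : (m:ℝ) ≤ 2 * ε ^ (-ρ) := by
    have := (Nat.ceil_lt_add_one (by linarith : 0 ≤ ε ^ (-ρ))).le
    rw [← hm] at this; linarith
  have hm0 : (0:ℝ) < m := by linarith
  set b : ℝ := ε * (m:ℝ) ^ σ / c' with hb
  have hb0 : 0 < b := by positivity
  have hb1 : b ≤ 1 := by
    rw [hb, div_le_one hc'0]
    calc ε * (m:ℝ) ^ σ ≤ ε * (2 * ε ^ (-ρ)) ^ σ := by gcongr
      _ = 2 ^ σ * ε ^ (1 - ρ * σ) := by
        rw [Real.mul_rpow (by norm_num) (by positivity), ← Real.rpow_mul hε.le,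
          show 1 - ρ * σ = 1 + -ρ * σ by ring, Real.rpow_add hε, Real.rpow_one]; ring
      _ ≤ 2 ^ σ * 1 := by
        gcongr
        refine Real.rpow_le_one hε.le hε1 ?_
        rw [hρ, sub_nonneg, one_div_mul_eq_div, div_le_one (by positivity)]; linarith
      _ ≤ c' := by rw [hc']; linarith
  have hb2 : b ^ (-(1 / r)) ≤ c' ^ (1 / r) * ε ^ (-(1 / r')) := by
    have h1 : ε ^ (1 - ρ * σ) / c' ≤ b := by
      rw [hb]
      gcongr
      calc ε ^ (1 - ρ * σ) = ε * (ε ^ (-ρ)) ^ σ := by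
            rw [← Real.rpow_mul hε.le, show 1 - ρ * σ = 1 + -ρ * σ by ring, Real.rpow_add hε,
              Real.rpow_one]
        _ ≤ _ := by gcongr
    calc b ^ (-(1 / r)) ≤ (ε ^ (1 - ρ * σ) / c') ^ (-(1 / r)) :=
          Real.rpow_le_rpow_of_nonpos (by positivity) h1 (by
            have : 0 < 1 / r := by positivity
            linarith)
      _ = c' ^ (1 / r) * ε ^ (-ρ) := by
          rw [Real.div_rpow (by positivity) hc'0.le, ← Real.rpow_mul hε.le, Real.rpow_neg hc'0.le,
            div_inv_eq_mul, mul_comm]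
          congr 2
          rw [hρ]; field_simp; ring
      _ ≤ _ := by
          refine mul_le_mul_of_nonneg_left ?_ (by positivity)
          exact Real.rpow_le_rpow_of_exponent_ge hε hε1 (by linarith)
  have hsid := hμ.sidak_exp hg (gfMat_posSemidef hP univ n) (hZm n T (b * T ^ κ))
      (hZc n T (b * T ^ κ))
    (hZs n T (b * T ^ κ)) (Finset.range (m + 1)) (fun k => rlVec θ (k * T / m) n)
    (σ := fun _ => D * T ^ Q) (b := fun _ => ε / 2 * T ^ Q)
    (fun i _ => by positivity) (fun i _ => by positivity)
    (fun i hi => hvar n _ T ⟨by positivity, by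
      rw [div_le_iff₀ hm0, mul_comm]
      have : (i:ℝ) ≤ m := by exact_mod_cast Nat.lt_succ_iff.1 (Finset.mem_range.1 hi)
      gcongr⟩)
  have hcost : ∑ i ∈ Finset.range (m + 1), (D * T ^ Q / (ε / 2 * T ^ Q)) ^ e ≤
      3 * (2 * D) ^ e * ε ^ (-(1 / r')) := by
    rw [Finset.sum_const, Finset.card_range, nsmul_eq_mul,
      show D * T ^ Q / (ε / 2 * T ^ Q) = (2 * D) * ε⁻¹ by field_simp,
      Real.mul_rpow (by positivity) (by positivity), Real.inv_rpow hε.le, ← Real.rpow_neg hε.le,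
      show -(1 / r') = -ρ + -e by rw [he]; ring, Real.rpow_add hε]
    calc ((m + 1 : ℕ):ℝ) * ((2 * D) ^ e * ε ^ (-e)) ≤
        (3 * ε ^ (-ρ)) * ((2 * D) ^ e * ε ^ (-e)) := by
          gcongr; push_cast; linarith
      _ = _ := by ring
  calc ENNReal.ofReal (rexp (-((C * c' ^ (1 / r) + Cg * (3 * (2 * D) ^ e)) * ε ^ (-(1 / r')))))
      ≤ ENNReal.ofReal (rexp (-(C * b ^ (-(1 / r))))) *
        ENNReal.ofReal (rexp (-(Cg * ∑ i ∈ Finset.range (m + 1),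
            (D * T ^ Q / (ε / 2 * T ^ Q)) ^ e))) := by
        rw [← ENNReal.ofReal_mul (Real.exp_pos _).le, ← Real.exp_add]
        apply ENNReal.ofReal_le_ofReal
        rw [Real.exp_le_exp]
        nlinarith [mul_le_mul_of_nonneg_left hcost hCg.le, mul_le_mul_of_nonneg_left hb2 hC.le]
    _ ≤ _ := (mul_le_mul_left (hball n μ hμ T b hT hb0 hb1) _).trans hsid
    _ ≤ _ := by
        refine measure_mono fun x hx s hs => ?_
        set k : ℕ := ⌊s * m / T⌋₊ with hk
        have hsm : 0 ≤ s * m / T := div_nonneg (mul_nonneg hs.1 hm0.le) hT.le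
        have hk1 : (k:ℝ) ≤ s * m / T := Nat.floor_le hsm
        have hk2 : s * m / T < k + 1 := Nat.lt_floor_add_one _
        have hkm : k ≤ m := by
          have h1 : s * m / T ≤ m := by
            rw [div_le_iff₀ hT, mul_comm]; exact mul_le_mul_of_nonneg_left hs.2 hm0.le
          exact_mod_cast hk1.trans h1
        have hks : k * T / m ≤ s := by
          rw [div_le_iff₀ hm0]; rwa [le_div_iff₀ hT] at hk1
        have hks' : s - k * T / m ≤ T / m := by
          rw [sub_le_iff_le_add, ← add_div, le_div_iff₀ hm0]
          rw [div_lt_iff₀ hT] at hk2; linarith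
        have h1 := hx.2 k (Finset.mem_range.2 (by omega))
        have h2 := hinc n T (b * T ^ κ) (k * T / m) s x (by positivity) (by positivity) hks hs.2
            hx.1
        have h3 : c * (b * T ^ κ) * (s - k * T / m) ^ σ ≤ ε / 2 * T ^ Q := by
          calc c * (b * T ^ κ) * (s - k * T / m) ^ σ ≤ c * (b * T ^ κ) * (T / m) ^ σ := by
                gcongr
            _ = (c / c') * ε * T ^ Q := by
                rw [← hκ, Real.rpow_add hT, Real.div_rpow hT.le hm0.le, hb]
                field_simp
            _ ≤ (1 / 2) * ε * T ^ Q := by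
                refine mul_le_mul_of_nonneg_right (mul_le_mul_of_nonneg_right ?_ hε.le)
                    (by positivity)
                rw [div_le_div_iff₀ hc'0 (by norm_num), hc']; linarith
            _ = _ := by ring
        have h4 := abs_sub_abs_le_abs_sub (rlVec θ s n ⬝ᵥ x) (rlVec θ (k * T / m) n ⬝ᵥ x)
        linarith

/-- Small ball lower bound for the discretized fractional integral. -/
theorem exists_rlBall_ge {α γ θ r : ℝ} (hP : GFParam α γ) (hθ : 0 < θ) (hr : 0 < r)
    (hrθ : r < min 1 (α + 1 / 2) + θ) :
    ∃ C : ℝ, 0 < C ∧ ∀ (n : ℕ) (μ : Measure (Fin n → ℝ)),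
      IsGaussLaw μ (gfMat α γ univ n) → ∀ T ε : ℝ, 0 < T → 0 < ε → ε ≤ 1 →
      ENNReal.ofReal (rexp (-(C * ε ^ (-(1 / r))))) ≤
        μ (rlBall n θ T (ε * T ^ (α - γ / 2 + 1 / 2 + θ))) := by
  have ha : 0 < min 1 (α + 1 / 2) := lt_min one_pos (by have := hP.lt; have := hP.mem.1; linarith)
  have key : ∀ (θ₀ : ℝ), 0 < θ₀ → θ₀ ≤ 1 → ∀ (k : ℕ) (r : ℝ), 0 < r → r < min 1 (α + 1 / 2) +
      (θ₀ + k) →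
      ∃ C : ℝ, 0 < C ∧ ∀ (n : ℕ) (μ : Measure (Fin n → ℝ)),
        IsGaussLaw μ (gfMat α γ univ n) → ∀ T ε : ℝ, 0 < T → 0 < ε → ε ≤ 1 →
        ENNReal.ofReal (rexp (-(C * ε ^ (-(1 / r))))) ≤
          μ (rlBall n (θ₀ + k) T (ε * T ^ (α - γ / 2 + 1 / 2 + (θ₀ + k)))) := by
    intro θ₀ h0 h1 k
    induction k with
    | zero =>
      intro r hr hrθ
      simp only [Nat.cast_zero, add_zero] at hrθ ⊢
      obtain ⟨p, hp1, hp2⟩ := exists_between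
          (max_lt (by linarith) ha : max (r - θ₀) 0 < min 1 (α + 1 / 2))
      have hp0 : 0 < p := (le_max_right _ _).trans_lt hp1
      have hG : 0 < Gamma (θ₀ + 1) := Gamma_pos_of_pos (by linarith)
      refine exists_rlBall_ge_of_increment hP h0 h0 hp0 (κ := α - γ / 2 + 1 / 2) rfl
        (div_nonneg zero_le_two hG.le) nodeBall (fun n T b => measurableSet_nodeBall n T b)
        (fun n T b => convex_nodeBall n T b) (fun n T b x hx => neg_mem_nodeBall hx)
        (fun n T b s s' x hb _ hss hsT hx => abs_rlVec_sub_le_of_mem_nodeBall h0 h1 hb hss hsT hx)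
        ?_ hr (by have := le_max_left (r - θ₀) 0; linarith)
      obtain ⟨C, hC, h⟩ := exists_nodeBall_ge hP hp0 (hp2.trans_le (min_le_left _ _))
        (hp2.trans_le (min_le_right _ _))
      exact ⟨C, hC, fun n μ hμ T ε hT hε _ => h n μ hμ T ε hT hε⟩
    | succ k ih =>
      intro r hr hrθ
      push_cast at hrθ ⊢
      have hk : (0:ℝ) ≤ k := k.cast_nonneg
      have hθk : 0 < θ₀ + k := by linarith
      obtain ⟨p, hp1, hp2⟩ := exists_between
        (max_lt (by linarith) (by linarith) : max (r - 1) 0 < min 1 (α + 1 / 2) + (θ₀ + k))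
      have hp0 : 0 < p := (le_max_right _ _).trans_lt hp1
      rw [← add_assoc θ₀ (k:ℝ) 1]
      exact exists_rlBall_ge_of_increment hP (by linarith) one_pos hp0
        (κ := α - γ / 2 + 1 / 2 + (θ₀ + k)) (by ring) zero_le_one
            (fun n T b => rlBall n (θ₀ + k) T b)
        (fun n T b => measurableSet_rlBall n _ T b)
        (fun n T b => convex_rlBall n _ T b) (fun n T b x hx => neg_mem_rlBall hx)
        (fun n T b s s' x hb hs hss hsT hx => abs_rlVec_sub_le_of_mem_rlBall hθk hs hss hsT hx)
        (ih p hp0 hp2) hr (by have := le_max_left (r - 1) 0; linarith)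
  have hceil := Nat.ceil_lt_add_one hθ.le
  have hceil' := Nat.le_ceil θ
  have hpos : 0 < ⌈θ⌉₊ := Nat.ceil_pos.2 hθ
  obtain ⟨k, hk⟩ := Nat.exists_eq_succ_of_ne_zero hpos.ne'
  rw [hk] at hceil hceil'
  push_cast at hceil hceil'
  have := key (θ - k) (by linarith) (by linarith) k r hr (by rw [sub_add_cancel]; exact hrθ)
  rwa [sub_add_cancel] at this

/-- Enlarging a ball by `s` costs at most an exponential factor, by log-concavity. -/
theorem IsGaussLaw.rlBall_add_le {n : ℕ} {μ : Measure (Fin n → ℝ)} {S : Matrix (Fin n) (Fin n) ℝ}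
    (hμ : IsGaussLaw μ S) (hS : S.PosSemidef) {θ T b s Ψ : ℝ} (hb : 0 < b) (hs : 0 < s)
    (hΨ : ENNReal.ofReal (rexp (-Ψ)) ≤ μ (rlBall n θ T (b / 2))) :
    μ (rlBall n θ T (b + s)) ≤ μ (rlBall n θ T b) * ENNReal.ofReal (rexp (2 * s / b * Ψ)) := by
  have := hμ.isProbabilityMeasure
  set l : ℝ := (b / 2) / (b / 2 + s) with hl
  have hl0 : 0 < l := by positivity
  have hl1 : 0 < 1 - l := by
    rw [hl, one_sub_div (by positivity), add_sub_cancel_left]; positivity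
  have hPL := hμ.isPL hS hl1 hl0 (by ring)
  have h1 := hPL.measure_le hl1 hl0 (measurableSet_rlBall n θ T (b / 2))
      (measurableSet_rlBall n θ T (b + s))
    (measurableSet_rlBall n θ T b) (fun x hx y hy => by
      have := combo_mem_rlBall hl1.le hl0.le hx hy
      refine rlBall_mono (le_of_eq ?_) this
      rw [hl]; field_simp; ring)
  have h2 : ENNReal.ofReal (rexp (-((1 - l) * Ψ))) ≤ μ (rlBall n θ T (b / 2)) ^ (1 - l) := by
    refine le_trans (le_of_eq ?_) (ENNReal.rpow_le_rpow hΨ hl1.le)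
    rw [ENNReal.ofReal_rpow_of_pos (Real.exp_pos _), ← Real.exp_mul]; ring_nf
  have h3 : μ (rlBall n θ T (b + s)) ^ l ≤
      μ (rlBall n θ T b) * ENNReal.ofReal (rexp ((1 - l) * Ψ)) := by
    have h4 := (mul_le_mul_left h2 (μ (rlBall n θ T (b + s)) ^ l)).trans h1
    calc μ (rlBall n θ T (b + s)) ^ l
        = ENNReal.ofReal (rexp (-((1 - l) * Ψ))) * μ (rlBall n θ T (b + s)) ^ l *
            ENNReal.ofReal (rexp ((1 - l) * Ψ)) := by
          rw [mul_comm, ← mul_assoc, ← ENNReal.ofReal_mul (Real.exp_pos _).le, ← Real.exp_add]; simp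
      _ ≤ _ := mul_le_mul_left h4 _
  have h5 := ENNReal.rpow_le_rpow h3 (inv_nonneg.2 hl0.le)
  rw [← ENNReal.rpow_mul, mul_inv_cancel₀ hl0.ne', ENNReal.rpow_one,
    ENNReal.mul_rpow_of_nonneg _ _ (inv_nonneg.2 hl0.le),
    ENNReal.ofReal_rpow_of_pos (Real.exp_pos _), ← Real.exp_mul] at h5
  refine h5.trans ?_
  have e1 : (1 - l) * Ψ * l⁻¹ = 2 * s / b * Ψ := by
    rw [hl]; field_simp; ring
  rw [e1]
  gcongr
  refine (ENNReal.rpow_le_rpow_of_exponent_ge prob_le_one (?_ : 1 ≤ l⁻¹)).trans_eq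
      (ENNReal.rpow_one _)
  exact (one_le_inv₀ hl0).2 (by linarith)

theorem exists_nodeBall_compl_le : ∃ C c : ℝ, 0 < C ∧ 0 < c ∧
    ∀ (n : ℕ) (μ : Measure (Fin n → ℝ)) (S : Matrix (Fin n) (Fin n) ℝ), IsGaussLaw μ S →
    ∀ T A : ℝ, 0 < A → μ (nodeBall n T A)ᶜ ≤ ENNReal.ofReal (1 / 4) → ∀ t : ℝ, 0 ≤ t →
      μ (nodeBall n T t)ᶜ ≤ ENNReal.ofReal (C * rexp (-(c * (t / A) ^ 2))) := by
  obtain ⟨C, c, hC, hc, h⟩ := exists_fernique_tail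
  refine ⟨C, c, hC, hc, fun n μ S hμ T A hA hsmall t ht => ?_⟩
  have := hμ.isProbabilityMeasure
  set B : Matrix (Fin n) (Fin n) ℝ := Matrix.diagonal fun j => if (j:ℝ) ≤ T then 1 else 0 with hB
  have hball : ∀ a : ℝ, 0 ≤ a → (fun x => B.mulVec x) ⁻¹' {x | ‖x‖ ≤ a} = nodeBall n T a := by
    intro a ha
    ext x
    simp only [mem_preimage, mem_ofPred_eq, pi_norm_le_iff_of_nonneg ha, hB, Matrix.mulVec_diagonal,
      nodeBall, Real.norm_eq_abs]
    refine forall_congr' fun j => ?_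
    by_cases hj : (j:ℝ) ≤ T <;> simp [hj, ha]
  have hm : ∀ a : ℝ, MeasurableSet {x : Fin n → ℝ | ‖x‖ ≤ a} := fun a =>
    measurableSet_le (by fun_prop) (by fun_prop)
  have h1 := h n _ _ (hμ.map_mulVec B) A hA (by
    rw [Measure.map_apply (by fun_prop) (hm A), hball A hA.le]
    have e : μ (nodeBall n T A) = 1 - μ (nodeBall n T A)ᶜ := by
      rw [← prob_compl_eq_one_sub (measurableSet_nodeBall n T A).compl, compl_compl]
    rw [e]
    refine le_trans (le_of_eq ?_) (tsub_le_tsub_left hsmall 1)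
    rw [← ENNReal.ofReal_one, ← ENNReal.ofReal_sub _ (by norm_num)]; norm_num) t ht
  have e2 : {x : Fin n → ℝ | t < ‖x‖} = {x | ‖x‖ ≤ t}ᶜ := by ext; simp
  rwa [e2, Measure.map_apply (by fun_prop) (hm t).compl, preimage_compl, hball t ht] at h1

theorem lintegral_abs_gaussianReal_le {v : NNReal} {σ : ℝ} (hσ : 0 ≤ σ) (hv : v ≤ σ ^ 2) :
    ∫⁻ y, ENNReal.ofReal |y| ∂(gaussianReal 0 v) ≤ ENNReal.ofReal σ := by
  rcases hσ.eq_or_lt with rfl | hσ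
  · have : v = 0 := by
      rw [← NNReal.coe_eq_zero]; exact le_antisymm (by simpa using hv) v.2
    rw [this, gaussianReal_zero_var]; simp
  · have h2 : MemLp id 2 (gaussianReal 0 v) := memLp_id_gaussianReal 2
    have hi2 : Integrable (fun y : ℝ => y ^ 2) (gaussianReal 0 v) := h2.integrable_sq
    have h_int : Integrable (fun y : ℝ => (y ^ 2 / σ + σ) / 2) (gaussianReal 0 v) :=
      ((hi2.div_const σ).add (integrable_const σ)).div_const 2
    have hvar : ∫ y, y ^ 2 ∂(gaussianReal 0 v) = v := by
      have h := variance_of_integral_eq_zero (X := id) (μ := gaussianReal 0 v) (by fun_prop)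
        (by simp)
      rw [variance_id_gaussianReal] at h
      exact h.symm
    calc ∫⁻ y, ENNReal.ofReal |y| ∂(gaussianReal 0 v)
        ≤ ∫⁻ y, ENNReal.ofReal ((y ^ 2 / σ + σ) / 2) ∂(gaussianReal 0 v) := by
          refine lintegral_mono fun y => ENNReal.ofReal_le_ofReal ?_
          rw [le_div_iff₀ two_pos, div_add' _ _ _ hσ.ne', le_div_iff₀ hσ, ← sq_abs y]
          nlinarith [sq_nonneg (|y| - σ)]
      _ = ENNReal.ofReal (∫ y, (y ^ 2 / σ + σ) / 2 ∂(gaussianReal 0 v)) :=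
          (ofReal_integral_eq_lintegral_ofReal h_int (ae_of_all _ fun y => by positivity)).symm
      _ ≤ _ := by
          apply ENNReal.ofReal_le_ofReal
          rw [integral_div, integral_add (hi2.div_const σ) (integrable_const σ),
            integral_div, hvar, integral_const]
          simp only [probReal_univ, one_smul]
          have : v / σ ≤ σ := by rw [div_le_iff₀ hσ]; nlinarith
          linarith

theorem IsGaussLaw.measure_lt_sum_abs_le {n : ℕ} {μ : Measure (Fin n → ℝ)}
    {S : Matrix (Fin n) (Fin n) ℝ}
    (h : IsGaussLaw μ S) {ι : Type*} (s : Finset ι) (l : ι → Fin n → ℝ) {σ : ι → ℝ} {A : ℝ}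
        (hA : 0 < A)
    (hσ : ∀ i ∈ s, 0 ≤ σ i) (hl : ∀ i ∈ s, l i ⬝ᵥ S.mulVec (l i) ≤ σ i ^ 2)
        (hσA : ∑ i ∈ s, σ i ≤ A) :
    μ {x | 8 * A < ∑ i ∈ s, |l i ⬝ᵥ x|} ≤ ENNReal.ofReal (1 / 8) := by
  have h1 : ∀ i ∈ s, ∫⁻ x, ENNReal.ofReal |l i ⬝ᵥ x| ∂μ ≤ ENNReal.ofReal (σ i) := fun i hi => by
    have := lintegral_abs_gaussianReal_le (v := (l i ⬝ᵥ S.mulVec (l i)).toNNReal) (hσ i hi)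
      (by rw [Real.coe_toNNReal']; exact max_le (hl i hi) (sq_nonneg _))
    rwa [← h, lintegral_map (by fun_prop) (by fun_prop)] at this
  have h2 : ∫⁻ x, ENNReal.ofReal (∑ i ∈ s, |l i ⬝ᵥ x|) ∂μ ≤ ENNReal.ofReal A := by
    simp only [ENNReal.ofReal_sum_of_nonneg fun i _ => abs_nonneg _]
    rw [lintegral_finsetSum _ fun i _ => by fun_prop]
    refine (Finset.sum_le_sum h1).trans ?_
    rw [← ENNReal.ofReal_sum_of_nonneg hσ]
    exact ENNReal.ofReal_le_ofReal hσA
  have hA8 : ENNReal.ofReal (8 * A) ≠ 0 := by simp; linarith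
  calc μ {x | 8 * A < ∑ i ∈ s, |l i ⬝ᵥ x|}
      ≤ μ {x | ENNReal.ofReal (8 * A) ≤ ENNReal.ofReal (∑ i ∈ s, |l i ⬝ᵥ x|)} :=
        measure_mono fun x hx => ENNReal.ofReal_le_ofReal (le_of_lt hx)
    _ ≤ _ := meas_ge_le_lintegral_div (by fun_prop) hA8 ENNReal.ofReal_ne_top
    _ ≤ ENNReal.ofReal A / ENNReal.ofReal (8 * A) := by gcongr
    _ = _ := by
        rw [← ENNReal.ofReal_div_of_pos (by positivity)]
        congr 1; field_simp

theorem abs_nodeVec_dotProduct_le (n : ℕ) (x : Fin n → ℝ) {i j N : ℕ} (hij : i ≤ j) (hj : j ≤ N) :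
    |nodeVec n j ⬝ᵥ x| ≤ |nodeVec n i ⬝ᵥ x| +
      ∑ k ∈ Finset.Ico i N, |(nodeVec n (k + 1) - nodeVec n k) ⬝ᵥ x| := by
  have h : |nodeVec n j ⬝ᵥ x| ≤ |nodeVec n i ⬝ᵥ x| +
      ∑ k ∈ Finset.Ico i j, |(nodeVec n (k + 1) - nodeVec n k) ⬝ᵥ x| := by
    induction j, hij using Nat.le_induction with
    | base => simp
    | succ j hij ih =>
      rw [Finset.sum_Ico_succ_top hij, sub_dotProduct]
      have := abs_sub_abs_le_abs_sub (nodeVec n (j + 1) ⬝ᵥ x) (nodeVec n j ⬝ᵥ x)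
      have := ih (by omega)
      linarith
  refine h.trans (add_le_add_right ?_ _)
  exact Finset.sum_le_sum_of_subset_of_nonneg (Finset.Ico_subset_Ico_right hj) fun _ _ _ =>
      abs_nonneg _

theorem gfMat_quadForm_nodeVec_sub_le {α γ : ℝ} (hP : GFParam α γ) {A : Set ℝ} {n k : ℕ} {c : ℝ}
    (hc : 0 ≤ c) (hk : k + 1 < n)
    (h : gfEnergy γ A (fun x => gfKer α (k + 1) x - gfKer α k x) ≤ ENNReal.ofReal c) :
    (nodeVec n (k + 1) - nodeVec n k) ⬝ᵥ
      (gfMat α γ A n).mulVec (nodeVec n (k + 1) - nodeVec n k) ≤ c := by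
  refine gfMat_quadForm_le hP hc (fun u => ?_) h
  simp only [Pi.sub_apply, sub_mul, Finset.sum_sub_distrib]
  rw [sum_nodeVec_mul hk (fun j => gfKer α (j:ℝ) u),
    sum_nodeVec_mul (by omega : k < n) (fun j => gfKer α (j:ℝ) u)]
  push_cast; rfl

/-- Tail bound, up to time `T`, for the part driven by the noise outside `[-r, r]`. -/
theorem exists_far_tail {α γ : ℝ} (hP : GFParam α γ) : ∃ C c : ℝ, 0 < C ∧ 0 < c ∧
    ∀ (n : ℕ) (T r : ℝ) (μ : Measure (Fin n → ℝ)), 0 < T → T ≤ r → T < n →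
      IsGaussLaw μ (gfMat α γ (Icc (-r) r)ᶜ n) → ∀ t : ℝ, 0 ≤ t →
      μ (nodeBall n T (t * T ^ (α - γ / 2 + 1 / 2)))ᶜ ≤
        ENNReal.ofReal (C * rexp (-(c * (t / (T / r) ^ (1 - (α - γ / 2 + 1 / 2))) ^ 2))) := by
  obtain ⟨C, c, hC, hc, hF⟩ := exists_nodeBall_compl_le
  set H := α - γ / 2 + 1 / 2 with hHdef
  have hH0 : 0 < H := by have := hP.lt; rw [hHdef]; linarith
  have hd : 0 < 1 - 2 * (α - γ / 2) := by have := hP.lt'; linarith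
  set e : ℝ := (√(1 - 2 * (α - γ / 2)))⁻¹ with he
  have he0 : 0 < e := inv_pos.2 (Real.sqrt_pos.2 hd)
  refine ⟨C, c / (16 * e) ^ 2, hC, by positivity, fun n T r μ hT hTr hTn hμ t ht => ?_⟩
  have hr : 0 < r := hT.trans_le hTr
  have hn : 0 < n := by exact_mod_cast hT.trans hTn
  set σ : ℝ := e * r ^ (H - 1) with hσ
  have hσ0 : 0 < σ := by positivity
  have hσ2 : σ ^ 2 = 1 ^ 2 * (r ^ (2 * H - 2) / (1 - 2 * (α - γ / 2))) := by
    rw [hσ, mul_pow, he, inv_pow, Real.sq_sqrt hd.le, ← Real.rpow_natCast, ← Real.rpow_mul hr.le]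
    push_cast
    rw [show (H - 1) * 2 = 2 * H - 2 by ring]
    field_simp
  have hvar : ∀ k ∈ Finset.Ico 0 ⌊T⌋₊, (nodeVec n (k + 1) - nodeVec n k) ⬝ᵥ
      (gfMat α γ (Icc (-r) r)ᶜ n).mulVec (nodeVec n (k + 1) - nodeVec n k) ≤ σ ^ 2 := fun k hk => by
    have hkT : (k:ℝ) + 1 ≤ T := by
      have h1 : k + 1 ≤ ⌊T⌋₊ := (Finset.mem_Ico.1 hk).2
      have h2 : ((k + 1 : ℕ):ℝ) ≤ T := (Nat.cast_le.2 h1).trans (Nat.floor_le hT.le)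
      push_cast at h2; exact h2
    have hkn : k + 1 < n := by exact_mod_cast hkT.trans_lt hTn
    refine gfMat_quadForm_nodeVec_sub_le hP (sq_nonneg σ) hkn ?_
    have h0 : gfEnergy γ (Ioi r) (fun x => gfKer α (k + 1) x - gfKer α k x) = 0 := by
      rw [gfEnergy, ← lintegral_zero (μ := volume.restrict (Ioi r))]
      refine setLIntegral_congr_fun measurableSet_Ioi fun x hx => ?_
      have hx : r < x := hx
      simp only [gfKer]
      rw [max_eq_right (by linarith : (k:ℝ) + 1 - x ≤ 0),
          max_eq_right (by linarith : (k:ℝ) - x ≤ 0)]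
      simp
    have hsub : (Icc (-r) r)ᶜ ⊆ Iic (-r) ∪ Ioi r := fun x hx => by
      by_contra hcon
      simp only [mem_union, mem_Iic, mem_Ioi, not_or, not_le, not_lt] at hcon
      exact hx ⟨hcon.1.le, hcon.2⟩
    refine (gfEnergy_mono hsub _).trans ((gfEnergy_union_le _ _ _ _).trans ?_)
    rw [h0, add_zero, hσ2]
    exact gfEnergy_Iic_le hP.abs_le hP.lt' k.cast_nonneg zero_le_one hr
  have hA : 0 < T * σ := by positivity
  have m1 := hμ.measure_lt_sum_abs_le (Finset.Ico 0 ⌊T⌋₊) _ hA (fun _ _ => hσ0.le) hvar (by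
    rw [Finset.sum_const, Nat.card_Ico, tsub_zero, nsmul_eq_mul]
    have := Nat.floor_le hT.le
    gcongr)
  have m2 := hμ.measure_lt_sum_abs_le (Finset.range 1) (fun _ => nodeVec n 0) (σ := fun _ => T * σ)
      hA
    (fun _ _ => hA.le) (fun _ _ => (gfMat_quadForm_le hP (f := fun _ => 0) (c := 0) le_rfl
        (fun u => by
      rw [sum_nodeVec_mul hn (fun j => gfKer α (j:ℝ) u), Nat.cast_zero, gfKer_zero])
      (by simp [gfEnergy])).trans (sq_nonneg _)) (by simp)
  have hsmall : μ (nodeBall n T (16 * (T * σ)))ᶜ ≤ ENNReal.ofReal (1 / 4) := by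
    have hsub : (nodeBall n T (16 * (T * σ)))ᶜ ⊆
        {x | 8 * (T * σ) < ∑ k ∈ Finset.Ico 0 ⌊T⌋₊, |(nodeVec n (k + 1) - nodeVec n k) ⬝ᵥ x|} ∪
        {x | 8 * (T * σ) < ∑ k ∈ Finset.range 1, |nodeVec n 0 ⬝ᵥ x|} := by
      intro x hx
      by_contra hcon
      simp only [mem_union, mem_ofPred_eq, not_or, not_lt, Finset.range_one,
          Finset.sum_singleton] at hcon
      refine hx fun j hj => ?_
      have := abs_nodeVec_dotProduct_le n x (Nat.zero_le j) (Nat.le_floor hj)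
      rw [nodeVec_dotProduct] at this
      linarith [hcon.1, hcon.2]
    refine (measure_mono hsub).trans ((measure_union_le _ _).trans ((add_le_add m1 m2).trans_eq ?_))
    rw [← ENNReal.ofReal_add (by norm_num) (by norm_num)]; norm_num
  refine (hF n μ _ hμ T (16 * (T * σ)) (by positivity) hsmall _ (by positivity)).trans_eq ?_
  have e1 : T * r ^ (H - 1) = T ^ H * (T / r) ^ (1 - H) := by
    rw [Real.div_rpow hT.le hr.le, ← neg_sub H 1, Real.rpow_neg hr.le, Real.rpow_neg hT.le,
      Real.rpow_sub hT, Real.rpow_one]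
    field_simp
  have e2 : t * T ^ H / (16 * (T * σ)) = (16 * e)⁻¹ * (t / (T / r) ^ (1 - H)) := by
    rw [hσ, mul_left_comm T e, e1]
    field_simp
  have e3 : c * ((16 * e)⁻¹ * (t / (T / r) ^ (1 - H))) ^ 2 =
      c / (16 * e) ^ 2 * (t / (T / r) ^ (1 - H)) ^ 2 := by
    rw [mul_pow (16 * e)⁻¹, inv_pow, ← mul_assoc, div_eq_mul_inv c]
  rw [e2, e3]

theorem sum_abs_rpow_sub_le {α r U : ℝ} (hr : 0 < r) {i N : ℕ} (hi : r ≤ i) (hN : N ≤ U) :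
    ∑ k ∈ Finset.Ico i N, |((k:ℝ) + 1) ^ α - (k:ℝ) ^ α| ≤ U ^ α + r ^ α := by
  have hi0 : (0:ℝ) < i := by linarith
  have hU : 0 ≤ U := le_trans (Nat.cast_nonneg N) hN
  rcases le_or_gt i N with hiN | hiN
  swap
  · rw [Finset.Ico_eq_empty_of_le hiN.le, Finset.sum_empty]; positivity
  rcases le_total 0 α with h | h
  · have key : ∑ k ∈ Finset.Ico i N, |((k:ℝ) + 1) ^ α - (k:ℝ) ^ α| ≤ (N:ℝ) ^ α - (i:ℝ) ^ α := by
      clear hN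
      induction N, hiN using Nat.le_induction with
      | base => simp
      | succ N hiN ih =>
        rw [Finset.sum_Ico_succ_top hiN, abs_of_nonneg (sub_nonneg.2 (by gcongr; linarith))]
        push_cast; linarith
    have h1 : (N:ℝ) ^ α ≤ U ^ α := by gcongr
    have : 0 < (i:ℝ) ^ α := by positivity
    have : 0 < r ^ α := by positivity
    linarith
  · have key : ∑ k ∈ Finset.Ico i N, |((k:ℝ) + 1) ^ α - (k:ℝ) ^ α| ≤ (i:ℝ) ^ α - (N:ℝ) ^ α := by
      clear hN
      induction N, hiN using Nat.le_induction with
      | base => simp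
      | succ N hiN ih =>
        have hN0 : (0:ℝ) < N := hi0.trans_le (by exact_mod_cast hiN)
        rw [Finset.sum_Ico_succ_top hiN, abs_of_nonpos (sub_nonpos.2
          (Real.rpow_le_rpow_of_nonpos hN0 (by linarith) h))]
        push_cast; linarith
    have h1 : (i:ℝ) ^ α ≤ r ^ α := Real.rpow_le_rpow_of_nonpos hr hi h
    have : 0 ≤ (N:ℝ) ^ α := by positivity
    have : 0 ≤ U ^ α := by positivity
    linarith

theorem IsGaussLaw.measure_le_of_add {n : ℕ} {μ ν ρ : Measure (Fin n → ℝ)}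
    {S S' : Matrix (Fin n) (Fin n) ℝ}
    (hμ : IsGaussLaw μ S) (hν : IsGaussLaw ν S') (hρ : IsGaussLaw ρ (S + S')) (hS : S.PosSemidef)
    (hS' : S'.PosSemidef) {K : Set (Fin n → ℝ)} (hK : MeasurableSet K) (hc : Convex ℝ K)
    (hs : ∀ x ∈ K, -x ∈ K) : ρ K ≤ μ K := by
  have := hμ.isProbabilityMeasure
  have := hν.isProbabilityMeasure
  rw [hρ.unique (hμ.add hν hS hS'), Measure.map_apply (by fun_prop) hK,
    Measure.prod_apply_symm (hK.preimage (by fun_prop))]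
  calc _ ≤ ∫⁻ _, μ K ∂ν := lintegral_mono fun y => by
        have := hμ.shift_mono hS hK hc hs y (z := 0) (z' := 1) (by simp)
        simp only [one_smul, zero_smul, add_zero] at this
        exact this
    _ = μ K := by simp

theorem exists_near_tail {α γ : ℝ} (hP : GFParam α γ) : ∃ C c : ℝ, 0 < C ∧ 0 < c ∧
    ∀ (n : ℕ) (r U : ℝ) (μ : Measure (Fin n → ℝ)), 1 ≤ r → r ≤ U → U < n →
      IsGaussLaw μ (gfMat α γ (Icc (-r) r) n) → ∀ t : ℝ, 0 ≤ t →
      μ (nodeBall n U (t * U ^ (α - γ / 2 + 1 / 2)))ᶜ ≤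
        ENNReal.ofReal (C * rexp (-(c * (t / ((r / U) ^ (α - γ / 2 + 1 / 2) +
          (r / U) ^ ((1 - γ) / 2))) ^ 2))) := by
  obtain ⟨C, c, hC, hc, hF⟩ := exists_nodeBall_compl_le
  have ha : 0 < α + 1 / 2 := by have := hP.lt; have := hP.mem.1; linarith
  have hm : 0 < min 1 (α + 1 / 2) := lt_min one_pos ha
  have hm1 : min 1 (α + 1 / 2) ≤ 1 := min_le_left _ _
  have hm2 : min 1 (α + 1 / 2) ≤ α + 1 / 2 := min_le_right _ _
  obtain ⟨C₀, hC₀, hball⟩ := exists_nodeBall_ge hP (r := min 1 (α + 1 / 2) / 2) (by linarith)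
    (by linarith) (by linarith)
  set r₀ := min 1 (α + 1 / 2) / 2
  have hr₀ : 0 < r₀ := by simp only [r₀]; linarith
  set H := α - γ / 2 + 1 / 2 with hHdef
  have hH0 : 0 < H := by have := hP.lt; rw [hHdef]; linarith
  have hγ1 : 0 < 1 - γ := by have := hP.mem.2; linarith
  set K : ℝ := (8 * C₀) ^ r₀ with hKdef
  have hK0 : 0 < K := by positivity
  have hKexp : (7:ℝ) / 8 ≤ rexp (-(C₀ * K ^ (-(1 / r₀)))) := by
    rw [hKdef, ← Real.rpow_mul (by positivity), show r₀ * -(1 / r₀) = -1 by field_simp,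
        Real.rpow_neg_one]
    have := Real.add_one_le_exp (-(C₀ * (8 * C₀)⁻¹))
    have e : C₀ * (8 * C₀)⁻¹ = 1 / 8 := by field_simp
    rw [e] at this ⊢
    linarith
  set D : ℝ := √(32 / (1 - γ)) with hD
  have hD0 : 0 < D := by positivity
  set C' : ℝ := K * 3 ^ H + 8 * (D * (2 ^ α + 1)) with hC'
  have hC'0 : 0 < C' := by positivity
  refine ⟨C, c / C' ^ 2, hC, by positivity, fun n r U μ hr hrU hUn hμ t ht => ?_⟩
  have hr0 : 0 < r := by linarith
  have hU0 : 0 < U := by linarith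
  have hn : 0 < n := by exact_mod_cast hU0.trans hUn
  set E : ℝ := (r / U) ^ H + (r / U) ^ ((1 - γ) / 2) with hE
  have hE0 : 0 < E := by positivity
  have hμp := hμ.isProbabilityMeasure
  obtain ⟨ν, hν, -⟩ := exists_isGaussLaw (gfMat_posSemidef hP (Icc (-r) r)ᶜ n)
  obtain ⟨ρ, hρ, -⟩ := exists_isGaussLaw (gfMat_posSemidef hP univ n)
  have m0 : μ (nodeBall n (3 * r) (K * (3 * r) ^ H))ᶜ ≤ ENNReal.ofReal (1 / 8) := by
    rw [prob_compl_eq_one_sub (measurableSet_nodeBall _ _ _)]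
    have h1 : ENNReal.ofReal (7 / 8) ≤ μ (nodeBall n (3 * r) (K * (3 * r) ^ H)) :=
      (ENNReal.ofReal_le_ofReal hKexp).trans ((hball n ρ hρ (3 * r) K (by positivity) hK0).trans
        (hμ.measure_le_of_add hν (gfMat_add_compl hP measurableSet_Icc n ▸ hρ)
          (gfMat_posSemidef hP _ n) (gfMat_posSemidef hP _ n) (measurableSet_nodeBall _ _ _)
          (convex_nodeBall _ _ _) fun x hx => neg_mem_nodeBall hx))
    refine (tsub_le_tsub_left h1 1).trans ?_
    rw [← ENNReal.ofReal_one, ← ENNReal.ofReal_sub _ (by norm_num)]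
    norm_num
  set j₀ := ⌈2 * r⌉₊ with hj₀
  have hj1 : 2 * r ≤ j₀ := Nat.le_ceil _
  have hj2 : (j₀:ℝ) ≤ 3 * r := by
    have := Nat.ceil_lt_add_one (a := 2 * r) (by positivity)
    linarith
  set σ : ℕ → ℝ := fun k => D * r ^ ((1 - γ) / 2) * |((k:ℝ) + 1) ^ α - (k:ℝ) ^ α| with hσ
  have hσ0 : ∀ k, 0 ≤ σ k := fun k => by positivity
  have hvar : ∀ k ∈ Finset.Ico j₀ ⌊U⌋₊, (nodeVec n (k + 1) - nodeVec n k) ⬝ᵥ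
      (gfMat α γ (Icc (-r) r) n).mulVec (nodeVec n (k + 1) - nodeVec n k) ≤ σ k ^ 2 :=
          fun k hk => by
    have hkT : (k:ℝ) + 1 ≤ U := by
      have h1 : k + 1 ≤ ⌊U⌋₊ := (Finset.mem_Ico.1 hk).2
      have h2 : ((k + 1 : ℕ):ℝ) ≤ U := (Nat.cast_le.2 h1).trans (Nat.floor_le hU0.le)
      push_cast at h2; exact h2
    have hkn : k + 1 < n := by exact_mod_cast hkT.trans_lt hUn
    have hk2 : 2 * r ≤ k := hj1.trans (by exact_mod_cast (Finset.mem_Ico.1 hk).1)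
    refine gfMat_quadForm_nodeVec_sub_le hP (sq_nonneg _) hkn ?_
    refine (gfEnergy_Icc_le hP.mem.2 hP.abs_le hr0 hk2 (by linarith)).trans_eq ?_
    congr 1
    rw [hσ]
    simp only
    rw [mul_pow, mul_pow, sq_abs, hD, Real.sq_sqrt (by positivity), ← Real.rpow_natCast (r ^ _),
      ← Real.rpow_mul hr0.le]
    push_cast
    rw [div_mul_cancel₀ _ two_ne_zero, mul_assoc]
  set A₂ : ℝ := D * r ^ ((1 - γ) / 2) * (U ^ α + (2 * r) ^ α) with hA₂
  have hA₂0 : 0 < A₂ := by positivity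
  have m1 := hμ.measure_lt_sum_abs_le (Finset.Ico j₀ ⌊U⌋₊) _ hA₂0 (fun k _ => hσ0 k) hvar (by
    rw [hσ, ← Finset.mul_sum]
    exact mul_le_mul_of_nonneg_left
      (sum_abs_rpow_sub_le (by positivity) hj1 (Nat.floor_le hU0.le)) (by positivity))
  have hAle : K * (3 * r) ^ H + 8 * A₂ ≤ C' * (U ^ H * E) := by
    have hHα : H = α + (1 - γ) / 2 := by rw [hHdef]; ring
    have e1 : r ^ H = U ^ H * (r / U) ^ H := by rw [Real.div_rpow hr0.le hU0.le]; field_simp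
    have e2 : r ^ ((1 - γ) / 2) * U ^ α = U ^ H * (r / U) ^ ((1 - γ) / 2) := by
      rw [Real.div_rpow hr0.le hU0.le, hHα, Real.rpow_add hU0]; field_simp
    have e3 : r ^ ((1 - γ) / 2) * (2 * r) ^ α = 2 ^ α * (U ^ H * (r / U) ^ H) := by
      rw [← e1, Real.mul_rpow two_pos.le hr0.le, hHα, Real.rpow_add hr0]; ring
    have e4 : K * (3 * r) ^ H + 8 * A₂ = K * 3 ^ H * (U ^ H * (r / U) ^ H) +
        8 * D * (U ^ H * (r / U) ^ ((1 - γ) / 2)) + 8 * D * 2 ^ α * (U ^ H * (r / U) ^ H) := by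
      rw [hA₂, Real.mul_rpow three_pos.le hr0.le, e1]
      linear_combination 8 * D * e2 + 8 * D * e3
    rw [e4, hE, hC']
    have p1 : 0 ≤ U ^ H * (r / U) ^ H := by positivity
    have p2 : 0 ≤ U ^ H * (r / U) ^ ((1 - γ) / 2) := by positivity
    have q1 : 0 ≤ K * 3 ^ H := by positivity
    have q2 : 0 ≤ D * 2 ^ α := by positivity
    nlinarith [mul_nonneg q1 p2, mul_nonneg q2 p2, mul_nonneg hD0.le p1]
  have hsmall : μ (nodeBall n U (C' * (U ^ H * E)))ᶜ ≤ ENNReal.ofReal (1 / 4) := by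
    have hsub : (nodeBall n U (C' * (U ^ H * E)))ᶜ ⊆ (nodeBall n (3 * r) (K * (3 * r) ^ H))ᶜ ∪
        {x | 8 * A₂ < ∑ k ∈ Finset.Ico j₀ ⌊U⌋₊, |(nodeVec n (k + 1) - nodeVec n k) ⬝ᵥ x|} := by
      intro x hx
      by_contra hcon
      simp only [mem_union, mem_ofPred_eq, not_or, not_lt, mem_compl_iff, not_not] at hcon
      refine hx fun j hj => ?_
      refine le_trans ?_ hAle
      rcases le_or_gt (j:ℝ) (3 * r) with h | h
      · exact (hcon.1 j h).trans (by linarith)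
      · have hj0 : j₀ ≤ (j:ℕ) := by exact_mod_cast (hj2.trans_lt h).le
        have := abs_nodeVec_dotProduct_le n x hj0 (Nat.le_floor hj)
        have h0 := hcon.1 ⟨j₀, hj0.trans_lt j.2⟩ hj2
        have e0 := nodeVec_dotProduct ⟨j₀, hj0.trans_lt j.2⟩ x
        simp only at e0
        rw [nodeVec_dotProduct, e0] at this
        linarith [hcon.2]
    refine (measure_mono hsub).trans ((measure_union_le _ _).trans ((add_le_add m0 m1).trans_eq ?_))
    rw [← ENNReal.ofReal_add (by norm_num) (by norm_num)]; norm_num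
  refine (hF n μ _ hμ U _ (by positivity) hsmall _ (by positivity)).trans_eq ?_
  have e2 : t * U ^ H / (C' * (U ^ H * E)) = C'⁻¹ * (t / E) := by field_simp
  have e3 : c * (C'⁻¹ * (t / E)) ^ 2 = c / C' ^ 2 * (t / E) ^ 2 := by
    rw [mul_pow C'⁻¹, inv_pow, ← mul_assoc, div_eq_mul_inv c]
  rw [e2, e3]

theorem nodeBall_subset_rlBall {n : ℕ} {θ T b : ℝ} (hθ : 0 < θ) (hb : 0 ≤ b) :
    nodeBall n T b ⊆ rlBall n θ T (b * (T ^ θ / Gamma (θ + 1))) := fun x hx s hs => by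
  have hG : 0 < Gamma (θ + 1) := Gamma_pos_of_pos (by linarith)
  calc |rlVec θ s n ⬝ᵥ x| ≤ ∑ j, rlVec θ s n j * b := by
        refine (Finset.abs_sum_le_sum_abs _ _).trans (Finset.sum_le_sum fun j _ => ?_)
        rw [abs_mul, abs_of_nonneg (show 0 ≤ rlVec θ s n j from rlWeight_nonneg hθ s j)]
        rcases le_total s (j:ℕ) with h | h
        · rw [show rlVec θ s n j = 0 from rlWeight_eq_zero h, zero_mul, zero_mul]
        · exact mul_le_mul_of_nonneg_left (hx j (h.trans hs.2)) (rlWeight_nonneg hθ s j)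
    _ = b * ∑ j, rlVec θ s n j := by rw [← Finset.sum_mul, mul_comm]
    _ ≤ b * (T ^ θ / Gamma (θ + 1)) := by
        have h1 : s ^ θ ≤ T ^ θ := Real.rpow_le_rpow hs.1 hs.2 hθ.le
        refine mul_le_mul_of_nonneg_left ((sum_rlWeight_le hθ hs.1 n).trans ?_) hb
        gcongr

theorem IsGaussLaw.rlBall_inter_le {n : ℕ} {μ ν ρ : Measure (Fin n → ℝ)}
    {S S' : Matrix (Fin n) (Fin n) ℝ}
    (hμ : IsGaussLaw μ S) (hν : IsGaussLaw ν S') (hρ : IsGaussLaw ρ (S + S')) (hS : S.PosSemidef)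
    (hS' : S'.PosSemidef) (θ T U a b d e : ℝ) :
    ρ (rlBall n θ T a ∩ rlBall n θ U b) ≤
        ρ (rlBall n θ T (a + 2 * d)) * ρ (rlBall n θ U (b + 2 * e)) +
      2 * (ν (rlBall n θ T d)ᶜ + μ (rlBall n θ U e)ᶜ) := by
  have := hμ.isProbabilityMeasure
  have := hν.isProbabilityMeasure
  have hm : ∀ T a, MeasurableSet (rlBall n θ T a) := fun T a => measurableSet_rlBall _ _ _ _
  have hρ' := hρ.unique (hμ.add hν hS hS')
  have hfst : ∀ {A : Set (Fin n → ℝ)}, MeasurableSet A → (μ.prod ν) (Prod.fst ⁻¹' A) = μ A :=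
      fun hA => by
    rw [← Measure.map_apply measurable_fst hA, Measure.map_fst_prod, measure_univ, one_smul]
  have hsnd : ∀ {A : Set (Fin n → ℝ)}, MeasurableSet A → (μ.prod ν) (Prod.snd ⁻¹' A) = ν A :=
      fun hA => by
    rw [← Measure.map_apply measurable_snd hA, Measure.map_snd_prod, measure_univ, one_smul]
  have hadd : ∀ {A : Set (Fin n → ℝ)}, MeasurableSet A →
      ρ A = (μ.prod ν) ((fun p => p.1 + p.2) ⁻¹' A) := fun hA => by
    rw [hρ', Measure.map_apply (by fun_prop) hA]
  set e₁ := ν (rlBall n θ T d)ᶜ with he₁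
  set e₂ := μ (rlBall n θ U e)ᶜ with he₂
  rw [← hsnd (hm _ _).compl] at he₁
  rw [← hfst (hm _ _).compl] at he₂
  have h1 : μ (rlBall n θ T (a + d)) ≤ ρ (rlBall n θ T (a + 2 * d)) + e₁ := by
    rw [← hfst (hm _ _), hadd (hm _ _), he₁]
    refine (measure_mono fun p hp => ?_).trans (measure_union_le _ _)
    by_cases h : p.2 ∈ rlBall n θ T d
    · left
      have := add_mem_rlBall (mem_preimage.1 hp) h
      rwa [show a + d + d = a + 2 * d by ring] at this
    · exact Or.inr h
  have h2 : ν (rlBall n θ U (b + e)) ≤ ρ (rlBall n θ U (b + 2 * e)) + e₂ := by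
    rw [← hsnd (hm _ _), hadd (hm _ _), he₂]
    refine (measure_mono fun p hp => ?_).trans (measure_union_le _ _)
    by_cases h : p.1 ∈ rlBall n θ U e
    · left
      have := add_mem_rlBall h (mem_preimage.1 hp)
      rwa [show e + (b + e) = b + 2 * e by ring] at this
    · exact Or.inr h
  have h3 : ρ (rlBall n θ T a ∩ rlBall n θ U b) ≤
      μ (rlBall n θ T (a + d)) * ν (rlBall n θ U (b + e)) + (e₁ + e₂) := by
    rw [hadd ((hm _ _).inter (hm _ _)), ← Measure.prod_prod, he₁, he₂]
    refine (measure_mono fun p hp => ?_).trans ((measure_union_le _ _).trans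
      (add_le_add_right (measure_union_le _ _) _))
    by_cases h : p.2 ∈ rlBall n θ T d
    · by_cases h' : p.1 ∈ rlBall n θ U e
      · left
        have k1 := add_mem_rlBall hp.1 (neg_mem_rlBall h)
        have k2 := add_mem_rlBall hp.2 (neg_mem_rlBall h')
        simp only [add_neg_cancel_right] at k1
        rw [add_assoc, add_comm p.2, ← add_assoc, add_neg_cancel, zero_add] at k2
        exact ⟨k1, k2⟩
      · exact Or.inr (Or.inr h')
    · exact Or.inr (Or.inl h)
  have hρp := hρ.isProbabilityMeasure
  calc _ ≤ _ := h3
    _ ≤ (ρ (rlBall n θ T (a + 2 * d)) + e₁) * ν (rlBall n θ U (b + e)) + (e₁ + e₂) := by gcongr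
    _ ≤ ρ (rlBall n θ T (a + 2 * d)) * (ρ (rlBall n θ U (b + 2 * e)) + e₂) + e₁ * 1 +
        (e₁ + e₂) := by
        rw [add_mul]
        gcongr
        exact prob_le_one
    _ ≤ ρ (rlBall n θ T (a + 2 * d)) * ρ (rlBall n θ U (b + 2 * e)) + 1 * e₂ + e₁ * 1 +
        (e₁ + e₂) := by
        rw [mul_add]
        gcongr
        exact prob_le_one
    _ = _ := by ring

theorem exists_rlBall_add_le {α γ θ q : ℝ} (hP : GFParam α γ) (hθ : 0 < θ) (hq : 0 < q)
    (hqθ : 1 / q < min 1 (α + 1 / 2) + θ) :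
    ∃ C : ℝ, 0 < C ∧ ∀ (n : ℕ) (μ : Measure (Fin n → ℝ)), IsGaussLaw μ (gfMat α γ univ n) →
      ∀ T ε : ℝ, 0 < T → 0 < ε → ε ≤ 1 →
      (1 ≤ μ (rlBall n θ T (ε * T ^ (α - γ / 2 + 1 / 2 + θ))) *
          ENNReal.ofReal (rexp (C * ε ^ (-q)))) ∧
      ∀ δ : ℝ, 0 < δ → μ (rlBall n θ T ((ε + 2 * δ) * T ^ (α - γ / 2 + 1 / 2 + θ))) ≤
          μ (rlBall n θ T (ε * T ^ (α - γ / 2 + 1 / 2 + θ))) *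
            ENNReal.ofReal (rexp (C * (δ * ε ^ (-(1 + q))))) := by
  obtain ⟨C, hC, h⟩ := exists_rlBall_ge hP hθ (r := 1 / q) (by positivity) hqθ
  simp only [one_div_one_div] at h
  refine ⟨C + 4 * 2 ^ q * C, by positivity, fun n μ hμ T ε hT hε hε1 => ⟨?_, fun δ hδ => ?_⟩⟩
  · calc (1:ℝ≥0∞) =
          ENNReal.ofReal (rexp (-(C * ε ^ (-q)))) * ENNReal.ofReal (rexp (C * ε ^ (-q))) := by
          rw [← ENNReal.ofReal_mul (Real.exp_pos _).le, ← Real.exp_add, neg_add_cancel,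
              Real.exp_zero,
            ENNReal.ofReal_one]
      _ ≤ _ := by
          have h0 : 0 ≤ 4 * 2 ^ q * C := by positivity
          refine mul_le_mul' (h n μ hμ T ε hT hε hε1)
              (ENNReal.ofReal_le_ofReal (Real.exp_le_exp.2 ?_))
          have : 0 ≤ ε ^ (-q) := by positivity
          nlinarith
  · have hT' : 0 < T ^ (α - γ / 2 + 1 / 2 + θ) := by positivity
    have h1 := h n μ hμ T (ε / 2) hT (by positivity) (by linarith)
    rw [div_mul_eq_mul_div] at h1
    have h2 := hμ.rlBall_add_le (gfMat_posSemidef hP univ n) (θ := θ) (T := T)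
      (s := 2 * δ * T ^ (α - γ / 2 + 1 / 2 + θ)) (by positivity) (by positivity) h1
    rw [add_mul]
    refine h2.trans (mul_le_mul_right (ENNReal.ofReal_le_ofReal (Real.exp_le_exp.2 ?_)) _)
    have e1 : (ε / 2) ^ (-q) = 2 ^ q * ε ^ (-q) := by
      rw [Real.div_rpow hε.le two_pos.le, Real.rpow_neg two_pos.le, div_inv_eq_mul, mul_comm]
    have e2 : ε ^ (-(1 + q)) = ε⁻¹ * ε ^ (-q) := by
      rw [neg_add, Real.rpow_add hε, Real.rpow_neg_one]
    rw [e1, e2]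
    have : 0 ≤ C * (δ * (ε⁻¹ * ε ^ (-q))) := by positivity
    have e3 : 2 * (2 * δ * T ^ (α - γ / 2 + 1 / 2 + θ)) / (ε * T ^ (α - γ / 2 + 1 / 2 + θ)) *
        (C * (2 ^ q * ε ^ (-q))) = 4 * 2 ^ q * C * (δ * (ε⁻¹ * ε ^ (-q))) := by field_simp; ring
    rw [e3]; linarith

theorem exists_rlBall_inter_le {α γ θ β τ : ℝ} (hP : GFParam α γ) (hθ : 0 < θ)
    (hβ : β = α + θ + 1 / 2)
    (hτ : 0 < τ) (hτ₁ : 3 * τ ≤ 1 - (α - γ / 2 + 1 / 2)) (hτ₂ : 12 * τ ≤ 1 - γ)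
    (hτ₃ : 6 * τ ≤ α - γ / 2 + 1 / 2) :
    ∃ c₂ c₃ c₄ : ℝ, 0 < c₂ ∧ 0 < c₃ ∧ 0 < c₄ ∧ ∀ (n : ℕ) (μ : Measure (Fin n → ℝ)),
      IsGaussLaw μ (gfMat α γ univ n) → ∀ T U ν η : ℝ, 1 ≤ T → T < U → U < n →
      0 < ν → ν ≤ 1 → 0 < η → η ≤ 1 →
      μ (rlBall n θ T (ν * T ^ (α - γ / 2 + 1 / 2 + θ)) ∩
          rlBall n θ U (η * U ^ (α - γ / 2 + 1 / 2 + θ))) ≤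
        μ (rlBall n θ T (ν * T ^ (α - γ / 2 + 1 / 2 + θ))) *
          μ (rlBall n θ U (η * U ^ (α - γ / 2 + 1 / 2 + θ))) *
          ENNReal.ofReal (rexp (c₂ * (T / U) ^ τ * (ν ^ (-(1 + 1 / β)) + η ^ (-(1 + 1 / β))))) +
        ENNReal.ofReal (c₃ * rexp (-c₄ * (U / T) ^ τ)) := by
  have ha : 0 < α + 1 / 2 := by have := hP.lt; have := hP.mem.1; linarith
  have ha2 : α + 1 / 2 < 3 / 2 := by have := hP.lt'; have := hP.mem.2; linarith
  have hβ0 : 0 < β := by rw [hβ]; linarith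
  set q : ℝ := 1 / β + 1 / 3 with hq
  have hq0 : 0 < q := by positivity
  have hqθ : 1 / q < min 1 (α + 1 / 2) + θ := by
    have e1 : 1 / q = 3 * β / (β + 3) := by rw [hq]; field_simp; ring
    rw [e1, div_lt_iff₀ (by linarith)]
    have e2 : β = α + 1 / 2 + θ := by rw [hβ]; ring
    rcases le_total 1 (α + 1 / 2) with h | h
    · rw [min_eq_left h, e2]
      nlinarith [mul_pos hθ ha, mul_pos hθ hθ]
    · rw [min_eq_right h, ← e2]; nlinarith [mul_pos hβ0 hβ0]
  obtain ⟨C, hC, hshift⟩ := exists_rlBall_add_le hP hθ hq0 hqθ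
  obtain ⟨C₁, d₁, hC₁, hd₁, hfar⟩ := exists_far_tail hP
  obtain ⟨C₂, d₂, hC₂, hd₂, hnear⟩ := exists_near_tail hP
  set H := α - γ / 2 + 1 / 2 with hHdef
  have hG : 0 < Gamma (θ + 1) := Gamma_pos_of_pos (by linarith)
  refine ⟨C + C / Gamma (θ + 1), 2 * (C₁ + C₂), min d₁ (d₂ / 4), by positivity, by positivity,
    by positivity, fun n μ hμ T U ν η hT hTU hUn hν hν1 hη hη1 => ?_⟩
  have hμp := hμ.isProbabilityMeasure
  have hT0 : 0 < T := by linarith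
  have hU0 : 0 < U := by linarith
  set L : ℝ := U / T with hL
  have hL1 : 1 ≤ L := (one_le_div hT0).2 hTU.le
  have hL0 : 0 < L := by linarith
  have hLinv : (T / U) ^ τ = L ^ (-τ) := by
    rw [hL, Real.rpow_neg (by positivity), ← Real.inv_rpow (by positivity), inv_div]
  rw [hLinv]
  obtain ⟨hA1, hAs⟩ := hshift n μ hμ T ν hT0 hν hν1
  obtain ⟨hB1, hBs⟩ := hshift n μ hμ U η hU0 hη hη1
  set p := μ (rlBall n θ T (ν * T ^ (H + θ)))
  set p' := μ (rlBall n θ U (η * U ^ (H + θ)))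
  have hsplit : ∀ x : ℝ, 0 < x → x ^ (-q) = x ^ (-(1 + 1 / β)) * x ^ ((2:ℝ) / 3) ∧
      x ^ (-(1 + q)) = x ^ (-(1 + 1 / β)) * x ^ (-((1:ℝ) / 3)) := fun x hx => by
    rw [← Real.rpow_add hx, ← Real.rpow_add hx, hq]
    exact ⟨by congr 1; ring, by congr 1; ring⟩
  have hCC : 0 ≤ C / Gamma (θ + 1) := by positivity
  set N := ν ^ (-(1 + 1 / β)) with hN
  set M := η ^ (-(1 + 1 / β)) with hM
  have hN0 : 0 < N := by positivity
  have hM0 : 0 < M := by positivity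
  have hLτ : 0 < L ^ (-τ) := by positivity
  have hdrop : ∀ x : ℝ, 0 < x → x ^ ((2:ℝ) / 3) ≤ L ^ (-τ) → x ^ (-(1 + 1 / β)) ≤ N + M →
      rexp (C * x ^ (-q)) ≤ rexp ((C + C / Gamma (θ + 1)) * L ^ (-τ) * (N + M)) :=
    fun x hx h1 h2 => by
      rw [Real.exp_le_exp, (hsplit x hx).1]
      have k1 : x ^ (-(1 + 1 / β)) * x ^ ((2:ℝ) / 3) ≤ (N + M) * L ^ (-τ) := by gcongr
      have k2 : 0 ≤ C / Gamma (θ + 1) * ((N + M) * L ^ (-τ)) := by positivity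
      nlinarith
  by_cases hcν : ν ^ ((2:ℝ) / 3) ≤ L ^ (-τ)
  · calc _ ≤ 1 * p' := by rw [one_mul]; exact measure_mono inter_subset_right
      _ ≤ p * ENNReal.ofReal (rexp (C * ν ^ (-q))) * p' := by gcongr
      _ ≤ p * ENNReal.ofReal (rexp ((C + C / Gamma (θ + 1)) * L ^ (-τ) * (N + M))) * p' := by
          gcongr 2
          exact ENNReal.ofReal_le_ofReal (hdrop ν hν hcν (by linarith))
      _ = p * p' * ENNReal.ofReal (rexp ((C + C / Gamma (θ + 1)) * L ^ (-τ) * (N + M))) := by ring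
      _ ≤ _ := le_self_add
  by_cases hcη : η ^ ((2:ℝ) / 3) ≤ L ^ (-τ)
  · calc _ ≤ p * 1 := by rw [mul_one]; exact measure_mono inter_subset_left
      _ ≤ p * (p' * ENNReal.ofReal (rexp (C * η ^ (-q)))) := by gcongr
      _ ≤ p * (p' * ENNReal.ofReal (rexp ((C + C / Gamma (θ + 1)) * L ^ (-τ) * (N + M)))) :=
          mul_le_mul_right (mul_le_mul_right (ENNReal.ofReal_le_ofReal
            (hdrop η hη hcη (by linarith))) _) _
      _ = p * p' * ENNReal.ofReal (rexp ((C + C / Gamma (θ + 1)) * L ^ (-τ) * (N + M))) := by ring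
      _ ≤ _ := le_self_add
  rw [not_le] at hcν hcη
  set δ : ℝ := L ^ (-(3 / 2 * τ)) with hδ
  have hδ0 : 0 < δ := by positivity
  set r : ℝ := T * L ^ ((2:ℝ) / 3) with hr
  have hTr : T ≤ r := le_mul_of_one_le_right hT0.le (Real.one_le_rpow hL1 (by norm_num))
  have hr0 : 0 < r := by linarith
  have hTr' : T / r = L ^ (-((2:ℝ) / 3)) := by
    rw [hr, Real.rpow_neg hL0.le]; field_simp
  have hrU' : r / U = L ^ (-((1:ℝ) / 3)) := by
    have : U = T * L := by rw [hL]; field_simp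
    rw [this, hr, mul_div_mul_left _ _ hT0.ne', show -((1:ℝ) / 3) = 2 / 3 - 1 by norm_num,
      Real.rpow_sub hL0, Real.rpow_one]
  have hrU : r ≤ U := by
    rw [← div_le_one hU0, hrU']
    exact Real.rpow_le_one_of_one_le_of_nonpos hL1 (by norm_num)
  obtain ⟨μ₁, hμ₁, -⟩ := exists_isGaussLaw (gfMat_posSemidef hP (Icc (-r) r) n)
  obtain ⟨μ₂, hμ₂, -⟩ := exists_isGaussLaw (gfMat_posSemidef hP (Icc (-r) r)ᶜ n)
  have hpow : ∀ κ : ℝ, 2 * τ ≤ κ → L ^ (-κ) ≤ L ^ (-(2 * τ)) := fun κ hκ =>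
    Real.rpow_le_rpow_of_exponent_le hL1 (by linarith)
  have hquot : ∀ E k : ℝ, 0 < E → 0 < k → E ≤ k * L ^ (-(2 * τ)) → L ^ τ / k ^ 2 ≤ (δ / E) ^ 2 :=
    fun E k hE hk h => by
      have h1 : L ^ (τ / 2) / k ≤ δ / E := by
        rw [div_le_div_iff₀ hk hE]
        calc L ^ (τ / 2) * E ≤ L ^ (τ / 2) * (k * L ^ (-(2 * τ))) := by gcongr
          _ = k * (L ^ (τ / 2) * L ^ (-(2 * τ))) := by ring
          _ = δ * k := by
            rw [← Real.rpow_add hL0, mul_comm, hδ]; congr 2; ring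
      calc L ^ τ / k ^ 2 = (L ^ (τ / 2) / k) ^ 2 := by
            rw [div_pow, ← Real.rpow_natCast (L ^ _), ← Real.rpow_mul hL0.le]
            congr 2; push_cast; ring
        _ ≤ _ := by gcongr
  have hc₄1 : min d₁ (d₂ / 4) ≤ d₁ := min_le_left _ _
  have hc₄2 : min d₁ (d₂ / 4) ≤ d₂ / 4 := min_le_right _ _
  have hLτ' : 0 < L ^ τ := by positivity
  have t₁ : μ₂ (rlBall n θ T (δ / Gamma (θ + 1) * T ^ (H + θ)))ᶜ ≤
      ENNReal.ofReal (C₁ * rexp (-min d₁ (d₂ / 4) * L ^ τ)) := by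
    have e : δ / Gamma (θ + 1) * T ^ (H + θ) = δ * T ^ H * (T ^ θ / Gamma (θ + 1)) := by
      rw [Real.rpow_add hT0]; ring
    rw [e]
    refine (measure_mono (compl_subset_compl.2 (nodeBall_subset_rlBall hθ (by positivity)))).trans
      ((hfar n T r μ₂ hT0 hTr (hTU.trans hUn) hμ₂ δ hδ0.le).trans (ENNReal.ofReal_le_ofReal ?_))
    rw [mul_le_mul_iff_right₀ hC₁, Real.exp_le_exp, neg_mul, neg_le_neg_iff]
    have h1 := hquot ((T / r) ^ (1 - H)) 1 (by positivity) one_pos (by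
      rw [one_mul, hTr', ← Real.rpow_mul hL0.le, neg_mul]
      exact hpow _ (by linarith))
    rw [one_pow, div_one] at h1
    exact mul_le_mul hc₄1 h1 hLτ'.le hd₁.le
  have t₂ : μ₁ (rlBall n θ U (δ / Gamma (θ + 1) * U ^ (H + θ)))ᶜ ≤
      ENNReal.ofReal (C₂ * rexp (-min d₁ (d₂ / 4) * L ^ τ)) := by
    have e : δ / Gamma (θ + 1) * U ^ (H + θ) = δ * U ^ H * (U ^ θ / Gamma (θ + 1)) := by
      rw [Real.rpow_add hU0]; ring
    rw [e]
    refine (measure_mono (compl_subset_compl.2 (nodeBall_subset_rlBall hθ (by positivity)))).trans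
      ((hnear n r U μ₁ (hT.trans hTr) hrU hUn hμ₁ δ hδ0.le).trans (ENNReal.ofReal_le_ofReal ?_))
    rw [mul_le_mul_iff_right₀ hC₂, Real.exp_le_exp, neg_mul, neg_le_neg_iff]
    have h1 := hquot ((r / U) ^ H + (r / U) ^ ((1 - γ) / 2)) 2 (by positivity) two_pos (by
      rw [hrU', ← Real.rpow_mul hL0.le, ← Real.rpow_mul hL0.le, neg_mul, neg_mul]
      linarith [hpow (1 / 3 * H) (by linarith), hpow (1 / 3 * ((1 - γ) / 2)) (by linarith)])
    calc min d₁ (d₂ / 4) * L ^ τ ≤ d₂ / 4 * L ^ τ := by gcongr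
      _ = d₂ * (L ^ τ / 2 ^ 2) := by ring
      _ ≤ _ := by gcongr
  have hs : ∀ x : ℝ, 0 < x → L ^ (-τ) < x ^ ((2:ℝ) / 3) →
      C * (δ / Gamma (θ + 1) * x ^ (-(1 + q))) ≤
        (C + C / Gamma (θ + 1)) * L ^ (-τ) * x ^ (-(1 + 1 / β)) := fun x hx h => by
    have k1 : x ^ (-((1:ℝ) / 3)) ≤ L ^ (τ / 2) := by
      have := Real.rpow_le_rpow_of_nonpos hLτ h.le (z := -(1 / 2)) (by norm_num)
      rw [← Real.rpow_mul hx.le, ← Real.rpow_mul hL0.le] at this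
      convert this using 2 <;> ring
    have k2 : δ * L ^ (τ / 2) = L ^ (-τ) := by rw [hδ, ← Real.rpow_add hL0]; congr 1; ring
    have hx' : 0 < x ^ (-(1 + 1 / β)) := by positivity
    rw [(hsplit x hx).2]
    calc C * (δ / Gamma (θ + 1) * (x ^ (-(1 + 1 / β)) * x ^ (-((1:ℝ) / 3))))
        = C / Gamma (θ + 1) * x ^ (-(1 + 1 / β)) * (δ * x ^ (-((1:ℝ) / 3))) := by ring
      _ ≤ C / Gamma (θ + 1) * x ^ (-(1 + 1 / β)) * (δ * L ^ (τ / 2)) := by gcongr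
      _ ≤ C / Gamma (θ + 1) * x ^ (-(1 + 1 / β)) * (δ * L ^ (τ / 2)) +
          C * x ^ (-(1 + 1 / β)) * L ^ (-τ) := le_add_of_nonneg_right (by positivity)
      _ = _ := by rw [k2]; ring
  have hδ' : 0 < δ / Gamma (θ + 1) := by positivity
  have hmain := hμ₁.rlBall_inter_le hμ₂ ((gfMat_add_compl hP measurableSet_Icc n).symm ▸ hμ)
    (gfMat_posSemidef hP _ n) (gfMat_posSemidef hP _ n) θ T U (ν * T ^ (H + θ)) (η * U ^ (H + θ))
    (δ / Gamma (θ + 1) * T ^ (H + θ)) (δ / Gamma (θ + 1) * U ^ (H + θ))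
  rw [← mul_assoc 2, ← mul_assoc 2, ← add_mul, ← add_mul] at hmain
  refine hmain.trans (add_le_add ?_ ?_)
  · refine (mul_le_mul' (hAs _ hδ') (hBs _ hδ')).trans ?_
    rw [mul_mul_mul_comm, ← ENNReal.ofReal_mul (Real.exp_pos _).le, ← Real.exp_add]
    refine mul_le_mul_right (ENNReal.ofReal_le_ofReal (Real.exp_le_exp.2 ?_)) _
    rw [mul_add]
    exact add_le_add (hs ν hν hcν) (hs η hη hcη)
  · have e2 : (2:ℝ≥0∞) = ENNReal.ofReal 2 := by simp
    refine (mul_le_mul_right (add_le_add t₁ t₂) 2).trans_eq ?_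
    rw [← ENNReal.ofReal_add (by positivity) (by positivity), e2,
      ← ENNReal.ofReal_mul two_pos.le]
    congr 1; ring

theorem intervalIntegrable_sub_rpow {θ s : ℝ} (hθ : 0 < θ) (a b : ℝ) :
    IntervalIntegrable (fun u : ℝ => (s - u) ^ (θ - 1)) volume a b := by
  have := (intervalIntegral.intervalIntegrable_rpow' (a := s - a) (b := s - b) (r := θ - 1)
    (by linarith)).comp_sub_left s
  simpa using this

theorem integral_sub_rpow {θ s : ℝ} (hθ : 0 < θ) (a b : ℝ) :
    ∫ u in a..b, (s - u) ^ (θ - 1) = ((s - a) ^ θ - (s - b) ^ θ) / θ := by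
  rw [intervalIntegral.integral_comp_sub_left (fun x : ℝ => x ^ (θ - 1)),
    integral_rpow (Or.inl (by linarith)), sub_add_cancel]

theorem rpow_mul_rlWeight {θ h s : ℝ} (hθ : 0 < θ) (hh : 0 < h) (j : ℕ) :
    h ^ θ * rlWeight θ (s / h) j =
      (Gamma θ)⁻¹ * ∫ u in min (j * h) s..min ((j + 1 : ℕ) * h) s, (s - u) ^ (θ - 1) := by
  have hG : 0 < Gamma θ := Gamma_pos_of_pos hθ
  have e : ∀ k : ℕ, h ^ θ * max (s / h - k) 0 ^ θ = (s - min (k * h) s) ^ θ := fun k => by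
    rw [← Real.mul_rpow hh.le (le_max_right _ _), mul_max_of_nonneg _ _ hh.le, mul_zero]
    congr 1
    rcases le_total (k * h) s with h1 | h1
    · rw [min_eq_left h1, mul_sub, mul_div_cancel₀ _ hh.ne', max_eq_left (by linarith)]; ring
    · rw [min_eq_right h1, mul_sub, mul_div_cancel₀ _ hh.ne', max_eq_right (by linarith)]; ring
  rw [integral_sub_rpow hθ, rlWeight, mul_div_assoc', mul_sub, e, e, Real.Gamma_add_one hθ.ne']
  field_simp

theorem abs_fracInt_sub_rlVec_le {θ h s w : ℝ} (hθ : 0 < θ) (hh : 0 < h) (hs : 0 ≤ s) {n : ℕ}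
    (hn : s ≤ n * h) {f : ℝ → ℝ} (hf : ContinuousOn f (Icc 0 s)) (hw : 0 ≤ w)
    (hosc : ∀ u ∈ Icc 0 s, ∀ v ∈ Icc 0 s, |u - v| ≤ h → |f u - f v| ≤ w) :
    |(Gamma θ)⁻¹ * (∫ u in (0:ℝ)..s, (s - u) ^ (θ - 1) * f u) -
      h ^ θ * (rlVec θ (s / h) n ⬝ᵥ fun j => f ((j:ℕ) * h))| ≤ w * (s ^ θ / Gamma (θ + 1)) := by
  have hG : 0 < Gamma θ := Gamma_pos_of_pos hθ
  set a : ℕ → ℝ := fun j => min (j * h) s with ha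
  have ha0 : ∀ j, a j ∈ Icc 0 s := fun j => ⟨le_min (by positivity) hs, min_le_right _ _⟩
  have hmono : ∀ j, a j ≤ a (j + 1) := fun j => by
    refine min_le_min_right _ ?_
    push_cast; nlinarith
  have h_int : ∀ j, IntervalIntegrable (fun u => (s - u) ^ (θ - 1) * f u) volume (a j)
      (a (j + 1)) :=
    fun j => (intervalIntegrable_sub_rpow hθ _ _).mul_continuousOn (hf.mono (by
      rw [uIcc_of_le (hmono j)]; exact Icc_subset_Icc (ha0 j).1 (ha0 (j + 1)).2))
  have h1 : ∫ u in (0:ℝ)..s, (s - u) ^ (θ - 1) * f u =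
      ∑ j : Fin n, ∫ u in a j..a (j + 1), (s - u) ^ (θ - 1) * f u := by
    rw [Fin.sum_univ_eq_sum_range (fun j => ∫ u in a j..a (j + 1), (s - u) ^ (θ - 1) * f u),
      intervalIntegral.sum_integral_adjacent_intervals fun j _ => h_int j]
    simp only [ha, Nat.cast_zero, zero_mul, min_eq_left hs, min_eq_right hn]
  have hterm : ∀ j : Fin n, |(Gamma θ)⁻¹ * (∫ u in a j..a (j + 1), (s - u) ^ (θ - 1) * f u) -
      h ^ θ * (rlVec θ (s / h) n j * f ((j:ℕ) * h))| ≤ w * (h ^ θ * rlVec θ (s / h) n j) :=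
          fun j => by
    have e : h ^ θ * rlVec θ (s / h) n j =
      (Gamma θ)⁻¹ * ∫ u in a j..a (j + 1), (s - u) ^ (θ - 1) := rpow_mul_rlWeight hθ hh j
    rw [← mul_assoc, e, mul_assoc, ← mul_sub, ← intervalIntegral.integral_mul_const,
      ← intervalIntegral.integral_sub (h_int j) ((intervalIntegrable_sub_rpow hθ _ _).mul_const _),
      abs_mul, abs_of_pos (inv_pos.2 hG), mul_left_comm]
    refine mul_le_mul_of_nonneg_left ?_ (inv_pos.2 hG).le
    rw [← intervalIntegral.integral_const_mul]
    rw [← Real.norm_eq_abs]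
    refine intervalIntegral.norm_integral_le_of_norm_le (hmono j) (ae_of_all _ fun u hu => ?_)
      ((intervalIntegrable_sub_rpow hθ _ _).const_mul _)
    have hus : u ≤ s := hu.2.trans (ha0 _).2
    have hk : 0 ≤ (s - u) ^ (θ - 1) := Real.rpow_nonneg (by linarith) _
    have hjs : ((j:ℕ):ℝ) * h ≤ s := by
      by_contra hcon
      have : a j = s := min_eq_right (not_le.1 hcon).le
      linarith [hu.1]
    have haj : a j = (j:ℕ) * h := min_eq_left hjs
    have hu2 : u ≤ ((j:ℕ) + 1) * h := by
      have := hu.2.trans (min_le_left _ _)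
      push_cast at this; exact this
    have hu1 := hu.1
    rw [haj] at hu1
    rw [← mul_sub, Real.norm_eq_abs, abs_mul, abs_of_nonneg hk, mul_comm w]
    refine mul_le_mul_of_nonneg_left (hosc u ⟨?_, hus⟩ _ ⟨by positivity, hjs⟩ ?_) hk
    · exact le_trans (by positivity) hu1.le
    · rw [abs_le]; constructor <;> nlinarith
  have hGθ : 0 < Gamma (θ + 1) := Gamma_pos_of_pos (by linarith)
  rw [h1, dotProduct, Finset.mul_sum, Finset.mul_sum, ← Finset.sum_sub_distrib]
  refine (Finset.abs_sum_le_sum_abs _ _).trans ((Finset.sum_le_sum fun j _ => hterm j).trans ?_)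
  rw [← Finset.mul_sum, ← Finset.mul_sum]
  refine mul_le_mul_of_nonneg_left ?_ hw
  have := sum_rlWeight_le hθ (div_nonneg hs hh.le) n
  calc h ^ θ * ∑ j, rlVec θ (s / h) n j ≤ h ^ θ * ((s / h) ^ θ / Gamma (θ + 1)) := by gcongr
    _ = _ := by rw [Real.div_rpow hs hh.le]; field_simp

theorem exists_abs_fracInt_sub_rlVec_le {θ t ε : ℝ} (hθ : 0 < θ) (ht : 0 < t) (hε : 0 < ε)
    {f : ℝ → ℝ} (hf : ContinuousOn f (Icc 0 t)) :
    ∃ h₀ > 0, ∀ h, 0 < h → h ≤ h₀ → ∀ n : ℕ, t ≤ n * h → ∀ s ∈ Icc 0 t,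
      |(Gamma θ)⁻¹ * (∫ u in (0:ℝ)..s, (s - u) ^ (θ - 1) * f u) -
        h ^ θ * (rlVec θ (s / h) n ⬝ᵥ fun j => f ((j:ℕ) * h))| ≤ ε := by
  have hG : 0 < Gamma (θ + 1) := Gamma_pos_of_pos (by linarith)
  have hw : 0 < ε / (t ^ θ / Gamma (θ + 1)) := by positivity
  obtain ⟨δ, hδ, hu⟩ := Metric.uniformContinuousOn_iff.1
    (isCompact_Icc.uniformContinuousOn_of_continuous hf) _ hw
  refine ⟨δ / 2, by positivity, fun h hh hhδ n hn s hs => ?_⟩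
  refine (abs_fracInt_sub_rlVec_le hθ hh hs.1 (hs.2.trans hn)
    (hf.mono (Icc_subset_Icc_right hs.2)) hw.le fun u hu' v hv huv => ?_).trans ?_
  · have := hu u (Icc_subset_Icc_right hs.2 hu') v (Icc_subset_Icc_right hs.2 hv)
      (by rw [Real.dist_eq]; linarith)
    rw [Real.dist_eq] at this
    exact this.le
  · have : s ^ θ ≤ t ^ θ := Real.rpow_le_rpow hs.1 hs.2 hθ.le
    calc _ ≤ ε / (t ^ θ / Gamma (θ + 1)) * (t ^ θ / Gamma (θ + 1)) := by gcongr
      _ = ε := by field_simp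

theorem mem_rlBall_div_iff {θ h t b H : ℝ} (hh : 0 < h) (ht : 0 ≤ t) {n : ℕ} {x : Fin n → ℝ} :
    (fun j => h ^ (-H) * x j) ∈ rlBall n θ (t / h) (b * (t / h) ^ (H + θ)) ↔
      ∀ s ∈ Icc 0 t, |h ^ θ * (rlVec θ (s / h) n ⬝ᵥ x)| ≤ b * t ^ (H + θ) := by
  have key : ∀ s, |rlVec θ s n ⬝ᵥ fun j => h ^ (-H) * x j| ≤ b * (t / h) ^ (H + θ) ↔
      |h ^ θ * (rlVec θ s n ⬝ᵥ x)| ≤ b * t ^ (H + θ) := fun s => by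
    have e : (rlVec θ s n ⬝ᵥ fun j => h ^ (-H) * x j) = h ^ (-H) * (rlVec θ s n ⬝ᵥ x) := by
      have := dotProduct_smul (h ^ (-H)) (rlVec θ s n) x
      exact this
    have e1 : h ^ (-H) = h ^ θ / h ^ (H + θ) := by rw [← Real.rpow_sub hh]; congr 1; ring
    have hp : 0 < h ^ (H + θ) := by positivity
    rw [e, Real.div_rpow ht hh.le, e1, div_mul_eq_mul_div, abs_div, abs_of_pos hp, mul_div_assoc',
      div_le_div_iff_of_pos_right hp]
  constructor
  · intro hx s hs
    exact (key _).1 (hx (s / h) ⟨div_nonneg hs.1 hh.le, by gcongr; exact hs.2⟩)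
  · intro hx s hs
    have h1 := hx (s * h) ⟨mul_nonneg hs.1 hh.le, (le_div_iff₀ hh).1 hs.2⟩
    rw [mul_div_cancel_right₀ _ hh.ne'] at h1
    exact (key _).2 h1

theorem IsCenteredGaussianProcess.exists_map_eq {Ω : Type*} [MeasurableSpace Ω] {P : Measure Ω}
    {X : ℝ → Ω → ℝ} (hX : IsCenteredGaussianProcess P X) (t : ℝ) :
    ∃ v : NNReal, P.map (X t) = gaussianReal 0 v := by
  obtain ⟨v, hv⟩ := hX 1 (fun _ => t) (fun _ => 1)
  refine ⟨v, ?_⟩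
  simpa using hv

theorem aemeasurable_of_map_eq {Ω : Type*} [MeasurableSpace Ω] {P : Measure Ω} {Z : Ω → ℝ}
    {ν : Measure ℝ} [IsProbabilityMeasure ν] (h : P.map Z = ν) : AEMeasurable Z P := by
  by_contra hcon
  rw [Measure.map_of_not_aemeasurable hcon] at h
  exact IsProbabilityMeasure.ne_zero ν h.symm

theorem IsCenteredGaussianProcess.memLp {Ω : Type*} [MeasurableSpace Ω] {P : Measure Ω}
    {X : ℝ → Ω → ℝ} (hX : IsCenteredGaussianProcess P X) (t : ℝ) : MemLp (X t) 2 P := by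
  obtain ⟨v, hv⟩ := hX.exists_map_eq t
  have h1 : MemLp id 2 (P.map (X t)) := by rw [hv]; exact memLp_id_gaussianReal 2
  exact h1.comp_of_map (aemeasurable_of_map_eq hv)

theorem IsGFBM.isGaussLaw {Ω : Type*} [MeasurableSpace Ω] {P : Measure Ω} {α γ h : ℝ}
    {X : ℝ → Ω → ℝ} (hX : IsGFBM P α γ X) (hh : 0 < h) (n : ℕ) :
    IsGaussLaw (P.map fun ω (j : Fin n) => h ^ (-(α - γ / 2 + 1 / 2)) * X ((j:ℕ) * h) ω)
      (gfMat α γ univ n) := by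
  obtain ⟨hG, -, -, hcov⟩ := hX
  intro c
  set H := α - γ / 2 + 1 / 2 with hH
  have hm : ∀ t, AEMeasurable (X t) P := fun t => (hG.memLp t).1.aemeasurable
  obtain ⟨v, hv⟩ := hG n (fun j => (j:ℕ) * h) (fun j => c j * h ^ (-H))
  set Z : Ω → ℝ := fun ω => ∑ i, c i * h ^ (-H) * X ((i:ℕ) * h) ω with hZ
  have hZm := aemeasurable_of_map_eq hv
  have hcomp : (P.map fun ω (j : Fin n) => h ^ (-H) * X ((j:ℕ) * h) ω).map (fun x => c ⬝ᵥ x) =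
      P.map Z := by
    rw [AEMeasurable.map_map_of_aemeasurable (by fun_prop)
      (aemeasurable_pi_lambda _ fun j => (hm _).const_mul _)]
    congr 1
    ext ω
    simp only [Function.comp, dotProduct, hZ, mul_assoc]
  have hvar : (v:ℝ) = ∫ ω, Z ω ^ 2 ∂P := by
    have h1 : ∫ y, y ^ 2 ∂(gaussianReal 0 v) = v := by
      have h := variance_of_integral_eq_zero (X := id) (μ := gaussianReal 0 v) (by fun_prop)
          (by simp)
      rw [variance_id_gaussianReal] at h
      exact h.symm
    rw [← h1, ← hv, integral_map hZm (by fun_prop)]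
  have h_int : ∀ i j : Fin n, Integrable
      (fun ω => c i * c j * h ^ (-(2 * H)) * (X ((i:ℕ) * h) ω * X ((j:ℕ) * h) ω)) P :=
    fun i j => ((hG.memLp _).integrable_mul (hG.memLp _)).const_mul _
  have hZ2 : ∀ ω, Z ω ^ 2 =
      ∑ i, ∑ j, c i * c j * h ^ (-(2 * H)) * (X ((i:ℕ) * h) ω * X ((j:ℕ) * h) ω) := fun ω => by
    rw [hZ, sq, Finset.sum_mul_sum]
    refine Finset.sum_congr rfl fun i _ => Finset.sum_congr rfl fun j _ => ?_
    rw [show -(2 * H) = -H + -H by ring, Real.rpow_add hh]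
    ring
  have hval : (v:ℝ) = c ⬝ᵥ (gfMat α γ univ n).mulVec c := by
    rw [hvar]
    simp only [hZ2]
    rw [integral_finsetSum _ fun i _ => integrable_finsetSum _ fun j _ => h_int i j]
    simp only [dotProduct, Matrix.mulVec, Finset.mul_sum]
    refine Finset.sum_congr rfl fun i _ => ?_
    rw [integral_finsetSum _ fun j _ => h_int i j]
    refine Finset.sum_congr rfl fun j _ => ?_
    rw [integral_const_mul, hcov _ _ (by positivity) (by positivity), mul_comm _ h, mul_comm _ h,
      gfbmCov_mul_mul hh, ← hH, gfMat, Matrix.of_apply, Measure.restrict_univ, ← gfbmCov_eq,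
      Real.rpow_neg hh.le]
    have : h ^ (2 * H) ≠ 0 := by positivity
    field_simp
  rw [hcomp, hv, ← hval, Real.toNNReal_coe]

theorem abs_fracInt_le_of_runSup_le {Ω : Type*} {θ t b : ℝ} (hθ : 0 < θ) (ht : 0 < t)
    {X : ℝ → Ω → ℝ}
    {ω : Ω} (hc : ContinuousOn (fun t => X t ω) (Ici 0)) (h : runSup (fracInt θ X) t ω ≤ b) {s : ℝ}
    (hs : s ∈ Icc 0 t) : |fracInt θ X s ω| ≤ b := by
  obtain ⟨h₀, hh₀, hdisc⟩ := exists_abs_fracInt_sub_rlVec_le hθ ht one_pos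
    (hc.mono fun x hx => hx.1)
  obtain ⟨n, hn⟩ := exists_nat_ge (t / h₀)
  have hn' : t ≤ n * h₀ := (div_le_iff₀ hh₀).1 hn
  set x : Fin n → ℝ := fun j => X ((j:ℕ) * h₀) ω
  have hx : x ∈ nodeBall n (t / h₀) (∑ j, |x j|) := fun j _ =>
    Finset.single_le_sum (f := fun j => |x j|) (fun i _ => abs_nonneg _) (Finset.mem_univ j)
  have hx' := nodeBall_subset_rlBall hθ (Finset.sum_nonneg fun i _ => abs_nonneg _) hx
  refine (le_ciSup (f := fun s : Icc (0:ℝ) t => |fracInt θ X s.1 ω|)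
    ⟨1 + h₀ ^ θ * ((∑ j, |x j|) * ((t / h₀) ^ θ / Gamma (θ + 1))), ?_⟩ ⟨s, hs⟩).trans h
  rintro _ ⟨⟨v, hv⟩, rfl⟩
  have h1 := hdisc h₀ hh₀ le_rfl n hn' v hv
  have h2 := hx' (v / h₀) ⟨div_nonneg hv.1 hh₀.le, by gcongr; exact hv.2⟩
  have h3 : |h₀ ^ θ * (rlVec θ (v / h₀) n ⬝ᵥ x)| ≤
      h₀ ^ θ * ((∑ j, |x j|) * ((t / h₀) ^ θ / Gamma (θ + 1))) := by
    rw [abs_mul, abs_of_pos (by positivity)]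
    gcongr
  have h4 := abs_add_le (fracInt θ X v ω - h₀ ^ θ * (rlVec θ (v / h₀) n ⬝ᵥ x))
    (h₀ ^ θ * (rlVec θ (v / h₀) n ⬝ᵥ x))
  rw [sub_add_cancel] at h4
  exact h4.trans (add_le_add h1 h3)

/-- The values of `X` on the grid of mesh `h`, rescaled by `h ^ (-H)`. -/
noncomputable def gridSample {Ω : Type*} (H h : ℝ) (X : ℝ → Ω → ℝ) (n : ℕ) (ω : Ω) : Fin n → ℝ :=
  fun j => h ^ (-H) * X ((j:ℕ) * h) ω

theorem exists_gridSample_mem_rlBall_iff {Ω : Type*} {θ H t e : ℝ} (hθ : 0 < θ) (ht : 0 < t)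
    (he : 0 < e) {X : ℝ → Ω → ℝ} {ω : Ω} (hc : ContinuousOn (fun t => X t ω) (Ici 0)) :
    ∃ h₀ > 0, ∀ h, 0 < h → h ≤ h₀ → ∀ n : ℕ, t < n * h → ∀ b,
      ((∀ s ∈ Icc 0 t, |fracInt θ X s ω| ≤ b * t ^ (H + θ)) →
        gridSample H h X n ω ∈ rlBall n θ (t / h) ((b + e) * (t / h) ^ (H + θ))) ∧
      (gridSample H h X n ω ∈ rlBall n θ (t / h) (b * (t / h) ^ (H + θ)) →
        ∀ s ∈ Icc 0 t, |fracInt θ X s ω| ≤ (b + e) * t ^ (H + θ)) := by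
  have hp : 0 < e * t ^ (H + θ) := by positivity
  obtain ⟨h₀, hh₀, hdisc⟩ := exists_abs_fracInt_sub_rlVec_le hθ ht hp
    (hc.mono fun x hx => hx.1)
  refine ⟨h₀, hh₀, fun h hh hle n hn b => ⟨fun hb => ?_, fun hb s hs => ?_⟩⟩
  · refine (mem_rlBall_div_iff hh ht.le).2 fun s hs => ?_
    have h1 := abs_le.1 (hdisc h hh hle n hn.le s hs)
    have h2 := abs_le.1 (hb s hs)
    simp only [fracInt] at h2
    rw [add_mul, abs_le]
    constructor <;> linarith [h1.1, h1.2, h2.1, h2.2]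
  · have h1 := abs_le.1 (hdisc h hh hle n hn.le s hs)
    have h2 := abs_le.1 ((mem_rlBall_div_iff hh ht.le).1 hb s hs)
    rw [add_mul, abs_le, fracInt]
    constructor <;> linarith [h1.1, h1.2, h2.1, h2.2]

theorem IsGFBM.aemeasurable_gridSample {Ω : Type*} [MeasurableSpace Ω] {P : Measure Ω} {α γ : ℝ}
    {X : ℝ → Ω → ℝ} (hX : IsGFBM P α γ X) (H h : ℝ) (n : ℕ) :
    AEMeasurable (gridSample H h X n) P :=
  aemeasurable_pi_lambda _ fun _ => (hX.1.memLp _).1.aemeasurable.const_mul _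

theorem exists_measure_rlBall_le_smallBall {Ω : Type*} [MeasurableSpace Ω] {P : Measure Ω}
    [IsProbabilityMeasure P] {α γ θ : ℝ} (hθ : 0 < θ) {X : ℝ → Ω → ℝ}
    (hX : IsGFBM P α γ X) {ν ξ : ℝ} (hξ : 0 < ξ) :
    ∃ e > 0, ∃ T₀ : ℝ, ∀ T, T₀ ≤ T → ∀ n : ℕ, T < n → ∀ μ, IsGaussLaw μ (gfMat α γ univ n) →
      μ (rlBall n θ T ((ν + e) * T ^ (α - γ / 2 + 1 / 2 + θ))) ≤
        ENNReal.ofReal (smallBall P (fracInt θ X) ν + ξ) := by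
  set H := α - γ / 2 + 1 / 2 with hH
  set G : ℕ → Set Ω := fun m => {ω | ∀ h, 0 < h → h ≤ 1 / ((m:ℝ) + 1) → ∀ n : ℕ, 1 < n * h →
    gridSample H h X n ω ∉ rlBall n θ (1 / h) ((ν + 1 / ((m:ℝ) + 1)) * (1 / h) ^ (H + θ))} with hG
  set S : Set Ω := {ω | runSup (fracInt θ X) 1 ω ≤ ν} with hS
  have hanti : ∀ m m' : ℕ, m ≤ m' → 1 / ((m':ℝ) + 1) ≤ 1 / ((m:ℝ) + 1) := fun m m' h =>
    Nat.one_div_le_one_div h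
  have hmono : Monotone G := by
    intro m m' hm ω hω h hh hle n hn hmem
    refine hω h hh (hle.trans (hanti m m' hm)) n hn (rlBall_mono ?_ hmem)
    have := hanti m m' hm
    gcongr
  have hcover : Sᶜ ⊆ ⋃ m, G m := by
    intro ω hω
    simp only [hS, mem_compl_iff, mem_ofPred_eq, not_le, runSup] at hω
    have : Nonempty (Icc (0:ℝ) 1) := ⟨⟨0, by simp⟩⟩
    obtain ⟨⟨s, hs⟩, hνs⟩ := exists_lt_of_lt_ciSup hω
    simp only at hνs
    obtain ⟨e, he, hes⟩ : ∃ e > 0, ν + 2 * e < |fracInt θ X s ω| :=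
      ⟨(|fracInt θ X s ω| - ν) / 4, by linarith, by linarith⟩
    obtain ⟨h₀, hh₀, hd⟩ := exists_gridSample_mem_rlBall_iff (H := H) hθ one_pos he (hX.2.1 ω)
    obtain ⟨m, hm⟩ := exists_nat_one_div_lt (lt_min hh₀ he)
    refine mem_iUnion.2 ⟨m, fun h hh hle n hn hmem => ?_⟩
    have h1 := (hd h hh (hle.trans (hm.le.trans (min_le_left _ _))) n hn _).2 hmem s hs
    have h2 := hm.le.trans (min_le_right _ _)
    rw [Real.one_rpow, mul_one] at h1
    linarith
  have hsup : P Sᶜ ≤ ⨆ m, P (G m) := by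
    rw [← hmono.measure_iUnion]
    exact measure_mono hcover
  obtain ⟨m, hm⟩ : ∃ m, P Sᶜ ≤ P (G m) + ENNReal.ofReal ξ := by
    by_cases h0 : P Sᶜ = 0
    · exact ⟨0, by simp [h0]⟩
    · have hlt : P Sᶜ - ENNReal.ofReal ξ < ⨆ m, P (G m) :=
        (ENNReal.sub_lt_self (measure_ne_top _ _) h0 (by simpa using hξ)).trans_le hsup
      obtain ⟨m, hm⟩ := lt_iSup_iff.1 hlt
      exact ⟨m, tsub_le_iff_right.1 hm.le⟩
  refine ⟨1 / ((m:ℝ) + 1), by positivity, (m:ℝ) + 1, fun T hT n hn μ hμ => ?_⟩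
  have hT0 : 0 < T := lt_of_lt_of_le (by positivity) hT
  have hlaw : μ = P.map (gridSample H (1 / T) X n) :=
    hμ.unique (hX.isGaussLaw (by positivity) n)
  set B := rlBall n θ T ((ν + 1 / ((m:ℝ) + 1)) * T ^ (H + θ)) with hB
  have hBm : MeasurableSet B := measurableSet_rlBall _ _ _ _
  have := hμ.isProbabilityMeasure
  have hGB : P (G m) ≤ μ Bᶜ := by
    rw [hlaw, Measure.map_apply_of_aemeasurable (hX.aemeasurable_gridSample _ _ _) hBm.compl]
    refine measure_mono fun ω hω => ?_
    have := hω (1 / T) (by positivity) (one_div_le_one_div_of_le (by positivity) hT) n (by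
      rw [mul_one_div, lt_div_iff₀ hT0]; linarith)
    rwa [one_div_one_div] at this
  have hφ : ENNReal.ofReal (smallBall P (fracInt θ X) ν + ξ) = P S + ENNReal.ofReal ξ := by
    rw [smallBall, ENNReal.ofReal_add ENNReal.toReal_nonneg hξ.le,
      ENNReal.ofReal_toReal (measure_ne_top _ _)]
  rw [hφ]
  have hone : μ B + μ Bᶜ = 1 := by rw [measure_add_measure_compl hBm, measure_univ]
  have hS1 : 1 ≤ P S + P Sᶜ := by
    rw [← measure_univ (μ := P), ← union_compl_self S]
    exact measure_union_le _ _
  refine (ENNReal.add_le_add_iff_right (measure_ne_top μ Bᶜ)).1 ?_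
  rw [hone]
  calc 1 ≤ P S + P Sᶜ := hS1
    _ ≤ P S + (P (G m) + ENNReal.ofReal ξ) := by gcongr
    _ ≤ P S + (μ Bᶜ + ENNReal.ofReal ξ) := by gcongr
    _ = P S + ENNReal.ofReal ξ + μ Bᶜ := by ring

theorem IsGFBM.measure_runSup_inter_le {Ω : Type*} [MeasurableSpace Ω] {P : Measure Ω} {α γ θ : ℝ}
    (hθ : 0 < θ) {X : ℝ → Ω → ℝ} (hX : IsGFBM P α γ X) {t u ν η e : ℝ} (ht : 0 < t) (htu : t < u)
    (he : 0 < e) {L : ℝ≥0∞} {T₀ : ℝ}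
    (hL : ∀ T U, T₀ ≤ T → T₀ ≤ U → T < U → T / U = t / u → ∀ n : ℕ, U < n → ∀ μ,
      IsGaussLaw μ (gfMat α γ univ n) →
      μ (rlBall n θ T ((ν + e) * T ^ (α - γ / 2 + 1 / 2 + θ)) ∩
        rlBall n θ U ((η + e) * U ^ (α - γ / 2 + 1 / 2 + θ))) ≤ L) :
    P ({ω | runSup (fracInt θ X) t ω ≤ ν * t ^ (α - γ / 2 + 1 / 2 + θ)} ∩
      {ω | runSup (fracInt θ X) u ω ≤ η * u ^ (α - γ / 2 + 1 / 2 + θ)}) ≤ L := by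
  set H := α - γ / 2 + 1 / 2 with hH
  have hu : 0 < u := ht.trans htu
  set A : ℝ → ℕ → Set Ω := fun h n => {ω | gridSample H h X n ω ∈
    rlBall n θ (t / h) ((ν + e) * (t / h) ^ (H + θ)) ∩
      rlBall n θ (u / h) ((η + e) * (u / h) ^ (H + θ))} with hA
  set G : ℕ → Set Ω := fun m => {ω | ∀ h, 0 < h → h ≤ 1 / ((m:ℝ) + 1) → ∀ n : ℕ, u < n * h →
    ω ∈ A h n} with hG
  have hmono : Monotone G := fun m m' hm ω hω h hh hle n hn =>
    hω h hh (hle.trans (Nat.one_div_le_one_div hm)) n hn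
  refine (measure_mono (t := ⋃ m, G m) fun ω hω => ?_).trans ?_
  · obtain ⟨h₁, hh₁, hd₁⟩ := exists_gridSample_mem_rlBall_iff (H := H) hθ ht he (hX.2.1 ω)
    obtain ⟨h₂, hh₂, hd₂⟩ := exists_gridSample_mem_rlBall_iff (H := H) hθ hu he (hX.2.1 ω)
    obtain ⟨m, hm⟩ := exists_nat_one_div_lt (lt_min hh₁ hh₂)
    refine mem_iUnion.2 ⟨m, fun h hh hle n hn => ⟨?_, ?_⟩⟩
    · exact (hd₁ h hh (hle.trans (hm.le.trans (min_le_left _ _))) n (htu.trans hn) _).1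
        fun s hs => abs_fracInt_le_of_runSup_le hθ ht (hX.2.1 ω) hω.1 hs
    · exact (hd₂ h hh (hle.trans (hm.le.trans (min_le_right _ _))) n hn _).1
        fun s hs => abs_fracInt_le_of_runSup_le hθ hu (hX.2.1 ω) hω.2 hs
  rw [hmono.measure_iUnion]
  refine iSup_le fun m => ?_
  obtain ⟨K, hK0, hKT, hKm⟩ : ∃ K : ℝ, 0 < K ∧ T₀ ≤ K * t ∧ (m:ℝ) + 1 ≤ K :=
    ⟨max (|T₀| / t) ((m:ℝ) + 1), lt_max_of_lt_right (by positivity),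
      (le_abs_self _).trans ((div_le_iff₀ ht).1 (le_max_left _ _)), le_max_right _ _⟩
  obtain ⟨n, hn⟩ := exists_nat_gt (u / K⁻¹)
  have hn' : u < n * K⁻¹ := (div_lt_iff₀ (by positivity)).1 hn
  refine (measure_mono (s := G m) (t := A K⁻¹ n) fun ω hω => hω K⁻¹ (by positivity)
    (by rw [← one_div]; exact one_div_le_one_div_of_le (by positivity) hKm) n hn').trans ?_
  have h1 : P (A K⁻¹ n) = P.map (gridSample H K⁻¹ X n)
      (rlBall n θ (t / K⁻¹) ((ν + e) * (t / K⁻¹) ^ (H + θ)) ∩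
        rlBall n θ (u / K⁻¹) ((η + e) * (u / K⁻¹) ^ (H + θ))) :=
    (Measure.map_apply_of_aemeasurable (hX.aemeasurable_gridSample _ _ _)
      ((measurableSet_rlBall _ _ _ _).inter (measurableSet_rlBall _ _ _ _))).symm
  rw [h1]
  have h2 : T₀ ≤ t / K⁻¹ := by rw [div_inv_eq_mul]; linarith [mul_comm t K]
  have h3 : t / K⁻¹ < u / K⁻¹ := div_lt_div_of_pos_right htu (by positivity)
  exact hL _ _ h2 (h2.trans h3.le) h3 (div_div_div_cancel_right₀ (by positivity) _ _) n hn _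
    (hX.isGaussLaw (by positivity) n)

theorem exists_measure_runSup_inter_le {Ω : Type*} [MeasurableSpace Ω] {P : Measure Ω}
    [IsProbabilityMeasure P] {α γ θ β τ : ℝ} (hP : GFParam α γ) (hθ : 0 < θ)
    (hβ : β = α + θ + 1 / 2) {X : ℝ → Ω → ℝ} (hX : IsGFBM P α γ X) (hτ : 0 < τ)
    (hτ₁ : 3 * τ ≤ 1 - (α - γ / 2 + 1 / 2)) (hτ₂ : 12 * τ ≤ 1 - γ)
    (hτ₃ : 6 * τ ≤ α - γ / 2 + 1 / 2) :
    ∃ c₂ c₃ c₄ : ℝ, 0 < c₂ ∧ 0 < c₃ ∧ 0 < c₄ ∧ ∀ u t ν η : ℝ, 0 < t → t < u →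
      ν ∈ Ioo 0 (1 / 2 : ℝ) → η ∈ Ioo 0 (1 / 2 : ℝ) →
      P ({ω | runSup (fracInt θ X) t ω ≤ ν * t ^ (α - γ / 2 + 1 / 2 + θ)} ∩
        {ω | runSup (fracInt θ X) u ω ≤ η * u ^ (α - γ / 2 + 1 / 2 + θ)}) ≤
      ENNReal.ofReal (smallBall P (fracInt θ X) ν * smallBall P (fracInt θ X) η *
        exp (c₂ * (t / u) ^ τ * (ν ^ (-(1 + 1 / β)) + η ^ (-(1 + 1 / β)))) +
        c₃ * exp (-c₄ * (u / t) ^ τ)) := by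
  obtain ⟨c₂, c₃, c₄, hc₂, hc₃, hc₄, hmain⟩ := exists_rlBall_inter_le hP hθ hβ hτ hτ₁ hτ₂ hτ₃
  refine ⟨c₂, c₃, c₄, hc₂, hc₃, hc₄, fun u t ν η ht htu hν hη => ?_⟩
  have hu : 0 < u := ht.trans htu
  have hβ0 : 0 < β := by have := hP.lt; have := hP.mem.1; rw [hβ]; linarith
  have hκ : -(1 + 1 / β) ≤ 0 := by have : 0 < 1 / β := by positivity
                                   linarith
  have hφ0 : ∀ b, 0 ≤ smallBall P (fracInt θ X) b := fun b => ENNReal.toReal_nonneg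
  set φ := smallBall P (fracInt θ X) with hφ
  set E := exp (c₂ * (t / u) ^ τ * (ν ^ (-(1 + 1 / β)) + η ^ (-(1 + 1 / β)))) with hE
  have key : ∀ ξ, 0 < ξ →
      P ({ω | runSup (fracInt θ X) t ω ≤ ν * t ^ (α - γ / 2 + 1 / 2 + θ)} ∩
        {ω | runSup (fracInt θ X) u ω ≤ η * u ^ (α - γ / 2 + 1 / 2 + θ)}) ≤
      ENNReal.ofReal ((φ ν + ξ) * (φ η + ξ) * E + c₃ * exp (-c₄ * (u / t) ^ τ)) := by
    intro ξ hξ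
    obtain ⟨e₁, he₁, T₁, hT₁⟩ := exists_measure_rlBall_le_smallBall hθ hX hξ
    obtain ⟨e₂, he₂, T₂, hT₂⟩ := exists_measure_rlBall_le_smallBall hθ hX hξ
    obtain ⟨e, he, hee₁, hee₂, hee⟩ : ∃ e > 0, e ≤ e₁ ∧ e ≤ e₂ ∧ e ≤ 1 / 2 :=
      ⟨min (min e₁ e₂) (1 / 2), by positivity, (min_le_left _ _).trans (min_le_left _ _),
        (min_le_left _ _).trans (min_le_right _ _), min_le_right _ _⟩
    refine hX.measure_runSup_inter_le hθ ht htu he (T₀ := max 1 (max T₁ T₂)) ?_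
    intro T U hT hU hTU hTUr n hn μ hμ
    have hT1 : 1 ≤ T := (le_max_left _ _).trans hT
    have hT0 : 0 < T := by linarith
    have hU0 : 0 < U := by linarith
    have hUT : U / T = u / t := by rw [← inv_div, hTUr, inv_div]
    have hb₁ := (measure_mono (rlBall_mono (n := n) (θ := θ) (T := T)
      (mul_le_mul_of_nonneg_right (add_le_add_right hee₁ ν) (Real.rpow_nonneg hT0.le _)))).trans
      (hT₁ T (((le_max_left _ _).trans (le_max_right _ _)).trans hT) n (hTU.trans hn) μ hμ)
    have hb₂ := (measure_mono (rlBall_mono (n := n) (θ := θ) (T := U)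
      (mul_le_mul_of_nonneg_right (add_le_add_right hee₂ η) (Real.rpow_nonneg hU0.le _)))).trans
      (hT₂ U (((le_max_right _ _).trans (le_max_right _ _)).trans hU) n hn μ hμ)
    refine (hmain n μ hμ T U (ν + e) (η + e) hT1 hTU hn (by linarith [hν.1]) (by linarith [hν.2])
      (by linarith [hη.1]) (by linarith [hη.2])).trans ?_
    have hν0 : 0 ≤ φ ν + ξ := add_nonneg (hφ0 ν) hξ.le
    have hη0 : 0 ≤ φ η + ξ := add_nonneg (hφ0 η) hξ.le
    rw [ENNReal.ofReal_add (by positivity) (by positivity),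
      ENNReal.ofReal_mul (mul_nonneg hν0 hη0), ENNReal.ofReal_mul hν0, hTUr, hUT]
    have hexp : exp (c₂ * (t / u) ^ τ * ((ν + e) ^ (-(1 + 1 / β)) + (η + e) ^ (-(1 + 1 / β)))) ≤
        E := by
      rw [hE]
      refine exp_le_exp.2 (mul_le_mul_of_nonneg_left (add_le_add ?_ ?_) (by positivity))
      · exact Real.rpow_le_rpow_of_nonpos hν.1 (by linarith) hκ
      · exact Real.rpow_le_rpow_of_nonpos hη.1 (by linarith) hκ
    exact add_le_add (mul_le_mul' (mul_le_mul' hb₁ hb₂) (ENNReal.ofReal_le_ofReal hexp)) le_rfl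
  have hlim : Tendsto (fun ξ : ℝ =>
      ENNReal.ofReal ((φ ν + ξ) * (φ η + ξ) * E + c₃ * exp (-c₄ * (u / t) ^ τ))) (𝓝[>] 0)
      (𝓝 (ENNReal.ofReal (φ ν * φ η * E + c₃ * exp (-c₄ * (u / t) ^ τ)))) := by
    have hcont : Continuous (fun ξ : ℝ =>
        ENNReal.ofReal ((φ ν + ξ) * (φ η + ξ) * E + c₃ * exp (-c₄ * (u / t) ^ τ))) :=
      ENNReal.continuous_ofReal.comp (by fun_prop)
    have := (hcont.tendsto 0).mono_left (nhdsWithin_le_nhds (s := Ioi 0))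
    simpa only [add_zero] using this
  exact ge_of_tendsto hlim (eventually_mem_nhdsWithin.mono fun ξ hξ => key ξ hξ)

end

/-- Second maximal inequality: approximate independence of the running maximum
at two widely separated scales. Here `α ∈ (−1/2+γ/2, 1/2+γ/2)`. -/
theorem maximal_inequality_two
    {Ω : Type*} [MeasurableSpace Ω] (P : Measure Ω) [IsProbabilityMeasure P]
    (γ α θ H β : ℝ) (hγ : γ ∈ Set.Ico (0:ℝ) 1)
    (hα : α ∈ Set.Ioo (-1/2 + γ/2) (1/2 + γ/2)) (hθ : 0 < θ)
    (hH : H = α - γ/2 + 1/2) (hβ : β = α + θ + 1/2)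
    (X : ℝ → Ω → ℝ) (hX : IsGFBM P α γ X)
    (Y : ℝ → Ω → ℝ) (hY : Y = fracInt θ X)
    (M : ℝ → Ω → ℝ) (hM : M = runSup Y)
    (φ : ℝ → ℝ) (hφ : φ = smallBall P Y)
    (τ : ℝ) (hτ : 0 < τ) (hτle : τ ≤ min ((1 - H) / 3) (min ((1 - γ) / 12) (H / 6))) :
    ∃ ε₀ : ℝ, 0 < ε₀ ∧ ∃ c₂ : ℝ, 0 < c₂ ∧ ∃ c₃ : ℝ, 0 < c₃ ∧ ∃ c₄ : ℝ, 0 < c₄ ∧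
      ∀ u t ν η : ℝ, 0 < t → t < u → ν ∈ Set.Ioo 0 ε₀ → η ∈ Set.Ioo 0 ε₀ →
        P ({ω | M t ω ≤ ν * t ^ (H + θ)} ∩ {ω | M u ω ≤ η * u ^ (H + θ)}) ≤
          ENNReal.ofReal (φ ν * φ η *
              Real.exp (c₂ * (t / u) ^ τ * (ν ^ (-(1 + 1/β)) + η ^ (-(1 + 1/β)))) +
            c₃ * Real.exp (-c₄ * (u / t) ^ τ)) := by
  have hP : GFParam α γ := ⟨hγ, hα.1, by linarith [hα.2]⟩
  have h₁ := hτle.trans (min_le_left _ _)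
  have h₂ := hτle.trans ((min_le_right _ _).trans (min_le_left _ _))
  have h₃ := hτle.trans ((min_le_right _ _).trans (min_le_right _ _))
  subst hH hY hM hφ
  obtain ⟨c₂, c₃, c₄, hc₂, hc₃, hc₄, hmain⟩ := exists_measure_runSup_inter_le hP hθ hβ hX hτ
    (by linarith) (by linarith) (by linarith)
  exact ⟨1 / 2, by norm_num, c₂, hc₂, c₃, hc₃, c₄, hc₄, hmain⟩
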